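/- arXiv:1802.09938 — 5 statements merged into one kernel-verified Lean document; each statement's English description precedes it below -/
import Mathlib

section
/- For every integer n ≥ 1, the Gelfand–Tsetlin variety for gl_n is equidimensional of dimension n(n−1)/2, i.e., every irreducible component of it has Krull dimension n(n−1)/2. -/
open scoped Classical

noncomputable section

/-- The Zariski topology on affine space `σ → k`: generated by complements of
hypersurfaces. -/
def zariskiTopology (k : Type*) [CommRing k] (σ : Type*) : TopologicalSpace (σ → k) :=
  TopologicalSpace.generateFrom
    {U | ∃ f : MvPolynomial σ k, U = {x | MvPolynomial.eval x f ≠ 0}}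

/-- The irreducible components of a subset `V` of affine space, with respect to the
subspace topology induced by the Zariski topology. -/
def zComponents (k : Type*) [CommRing k] (σ : Type*) (V : Set (σ → k)) : Set (Set V) :=
  @irreducibleComponents V (TopologicalSpace.induced Subtype.val (zariskiTopology k σ))

/-- The topological Krull dimension of a subset `C` of a subset `V` of affine space
(with the topology induced from the Zariski topology). -/
def zKrullDimSub (k : Type*) [CommRing k] (σ : Type*) {V : Set (σ → k)} (C : Set V) :
    WithBot ℕ∞ :=
  @topologicalKrullDim C (TopologicalSpace.induced Subtype.val
    (TopologicalSpace.induced Subtype.val (zariskiTopology k σ)))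

/-- A subset of affine space is equidimensional of dimension `d` if each of its
irreducible components (w.r.t. the Zariski topology) has Krull dimension `d`. -/
def IsEquidimOfDim (k : Type*) [CommRing k] (σ : Type*) (V : Set (σ → k)) (d : ℕ) : Prop :=
  ∀ C ∈ zComponents k σ V, zKrullDimSub k σ C = (d : WithBot ℕ∞)

/-- The Gelfand–Tsetlin variety for `gl_n`: the set of `n × n` matrices `x` such that
`tr((x_i)^j) = 0` for all `1 ≤ j ≤ i ≤ n`, where `x_i` is the `i`-th leading principal
submatrix of `x`. -/
def GTgl (k : Type*) [CommRing k] (n : ℕ) : Set (Fin n × Fin n → k) :=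
  {x | ∀ (i : ℕ) (hi : i ≤ n) (j : ℕ), 1 ≤ j → j ≤ i →
    Matrix.trace ((Matrix.of fun a b : Fin i => x (Fin.castLE hi a, Fin.castLE hi b)) ^ j) = 0}

section GTAlg

open Polynomial


theorem gt_trace_all {F : Type*} [Field F] {n : ℕ} (X : Matrix (Fin n) (Fin n) F)
    (h : ∀ j, 1 ≤ j → j ≤ n → (X ^ j).trace = 0) : ∀ j, 1 ≤ j → (X ^ j).trace = 0 := by
  intro j
  induction j using Nat.strong_induction_on with
  | _ j ih =>
    intro hj
    by_cases hjn : j ≤ n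
    · exact h j hj hjn
    push Not at hjn
    have hC := X.aeval_self_charpoly
    rw [aeval_eq_sum_range, X.charpoly_natDegree_eq_dim, Fintype.card_fin,
      Finset.sum_range_succ] at hC
    have hm : X.charpoly.coeff n = 1 := by
      have := X.charpoly_monic
      rw [Monic, leadingCoeff, X.charpoly_natDegree_eq_dim, Fintype.card_fin] at this
      exact this
    rw [hm, one_smul] at hC
    have h2 : X ^ j = - ∑ i ∈ Finset.range n, X.charpoly.coeff i • X ^ (i + (j - n)) := by
      have : X ^ j = X ^ n * X ^ (j - n) := by rw [← pow_add]; congr 1; omega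
      rw [this, eq_neg_of_add_eq_zero_right hC, neg_mul, Finset.sum_mul]
      simp [pow_add]
    rw [h2, Matrix.trace_neg, Matrix.trace_sum, Finset.sum_eq_zero, neg_zero]
    intro i hi
    rw [Finset.mem_range] at hi
    rw [Matrix.trace_smul, ih _ (by omega) (by omega), smul_zero]

theorem gt_nilpotent {F : Type*} [Field F] [CharZero F] {n : ℕ} (X : Matrix (Fin n) (Fin n) F)
    (h : ∀ j, 1 ≤ j → j ≤ n → (X ^ j).trace = 0) : IsNilpotent X := by
  have hall := gt_trace_all X h
  have hp0 : X.charpoly ≠ 0 := X.charpoly_monic.ne_zero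
  obtain ⟨q, hq, hnd⟩ := exists_eq_pow_rootMultiplicity_mul_and_not_dvd X.charpoly hp0 0
  rw [map_zero, sub_zero] at hq hnd
  set a := rootMultiplicity 0 X.charpoly
  have hcop : IsCoprime ((Polynomial.X : F[X]) ^ (a + 1)) q :=
    IsCoprime.pow_left ((Polynomial.irreducible_X).coprime_iff_not_dvd.2 hnd)
  obtain ⟨u, v, huv⟩ := hcop
  have hC := X.aeval_self_charpoly
  obtain ⟨g, hg⟩ : ∃ g : F[X], g = u * Polynomial.X ^ (a + 1) := ⟨_, rfl⟩
  have hE : IsIdempotentElem (aeval X g) := by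
    have : g = g * g + (u * Polynomial.X * v) * X.charpoly := by
      rw [hq, hg]
      linear_combination (-(u * Polynomial.X ^ (a + 1))) * huv
    unfold IsIdempotentElem
    conv_rhs => rw [this]
    rw [map_add, map_mul, map_mul _ _ X.charpoly, hC, mul_zero, add_zero]
  have htr : (aeval X g).trace = 0 := by
    have : g = Polynomial.X * (u * Polynomial.X ^ a) := by rw [hg]; ring
    rw [this, map_mul, aeval_X, aeval_eq_sum_range, Finset.mul_sum, Matrix.trace_sum]
    refine Finset.sum_eq_zero fun i _ => ?_
    rw [mul_smul_comm, ← pow_succ', Matrix.trace_smul, hall _ (by omega), smul_zero]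
  have hE0 : aeval X g = 0 := by
    have h1 : IsIdempotentElem (Matrix.toLinAlgEquiv' (aeval X g)) := by
      unfold IsIdempotentElem
      rw [← map_mul, hE.eq]
    have h2 : LinearMap.trace F _ (Matrix.toLinAlgEquiv' (aeval X g)) = 0 := by
      rw [← htr]; exact Matrix.trace_toLin'_eq _
    have h3 := LinearMap.IsIdempotentElem.eq_zero_of_trace_eq_zero h1 h2
    simpa using h3
  refine ⟨a, ?_⟩
  have : (Polynomial.X : F[X]) ^ a = g * Polynomial.X ^ a + v * X.charpoly := by
    rw [hq, hg]; linear_combination (-Polynomial.X ^ a) * huv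
  have h3 := congrArg (aeval X) this
  rw [map_add, map_mul, map_mul _ v, hC, hE0] at h3
  simpa using h3
theorem gt_decomp {F E : Type*} [Field F] [AddCommGroup E] [Module F E] [FiniteDimensional F E]
    (f : Module.End F E) (hf : IsNilpotent f) :
    ∃ (d : ℕ) (r : Fin d → ℕ),
      Nonempty (Module.AEval' f ≃ₗ[F[X]] ((i : Fin d) → F[X] ⧸ Ideal.span {(X : F[X]) ^ r i})) := by
  obtain ⟨s, hs⟩ := hf
  have hM : Module.IsTorsion' (Module.AEval' f) (Submonoid.powers (X : F[X])) := by
    intro x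
    refine ⟨⟨X ^ s, s, rfl⟩, ?_⟩
    obtain ⟨v, rfl⟩ := (Module.AEval'.of f).surjective x
    change (X : F[X]) ^ s • (Module.AEval'.of f v) = 0
    rw [Module.AEval'.X_pow_smul_of, hs]
    simp
  obtain ⟨d, r, ⟨φ⟩⟩ := Module.torsion_by_prime_power_decomposition
    (Polynomial.prime_X (R := F)).irreducible hM
  exact ⟨d, r, ⟨φ.trans (DirectSum.linearEquivFunOnFintype F[X] (Fin d) _)⟩⟩

/-- coefficientwise derivation -/
noncomputable def gtDp {k F : Type*} [Field k] [Field F] [Algebra k F] (D : Derivation k F F) :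
    Derivation k F[X] F[X] :=
  PolynomialModule.equivPolynomialSelf.compDer D.mapCoeffs

theorem gtDp_coeff {k F : Type*} [Field k] [Field F] [Algebra k F] (D : Derivation k F F)
    (p : F[X]) (i : ℕ) : (gtDp D p).coeff i = D (p.coeff i) := rfl

theorem gtDp_X {k F : Type*} [Field k] [Field F] [Algebra k F] (D : Derivation k F F) :
    gtDp D X = 0 := by
  ext i
  rw [gtDp_coeff, coeff_X]
  split_ifs <;> simp

theorem gtDp_C {k F : Type*} [Field k] [Field F] [Algebra k F] (D : Derivation k F F) (a : F) :
    gtDp D (C a) = C (D a) := by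
  ext i
  rw [gtDp_coeff, coeff_C, coeff_C]
  split_ifs <;> simp

theorem gtDp_X_pow_mul {k F : Type*} [Field k] [Field F] [Algebra k F] (D : Derivation k F F)
    (p : F[X]) (r : ℕ) : gtDp D (X ^ r * p) = X ^ r * gtDp D p := by
  rw [Derivation.leibniz, Derivation.leibniz_pow, gtDp_X]
  simp

theorem gt_poly_key {k F : Type*} [Field k] [Field F] [Algebra k F] (D : Derivation k F F)
    (p : F[X]) (r : ℕ) : ∃ c : F[X], X ^ r ∣ gtDp D p - c * p := by
  by_cases hp : p = 0
  · exact ⟨0, by simp [hp]⟩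
  obtain ⟨q, hq, hnd⟩ := exists_eq_pow_rootMultiplicity_mul_and_not_dvd p hp 0
  rw [C_0, sub_zero] at hq hnd
  have hcop : IsCoprime q (X ^ r) :=
    (((Polynomial.prime_X (R := F)).irreducible.coprime_iff_not_dvd).2 hnd).symm.pow_right
  obtain ⟨a, b, hab⟩ := hcop
  refine ⟨gtDp D q * a, X ^ (rootMultiplicity 0 p) * gtDp D q * b, ?_⟩
  generalize rootMultiplicity 0 p = o at hq
  subst hq
  rw [gtDp_X_pow_mul]
  linear_combination (- X ^ o * gtDp D q) * hab

theorem gt_quot_conn {k F : Type*} [Field k] [Field F] [Algebra k F] (D : Derivation k F F)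
    (r : ℕ) (q : F[X] ⧸ Ideal.span {(X : F[X]) ^ r}) :
    ∃ δ : (F[X] ⧸ Ideal.span {(X : F[X]) ^ r}) → (F[X] ⧸ Ideal.span {(X : F[X]) ^ r}),
      (∀ x y, δ (x + y) = δ x + δ y) ∧ (∀ (f : F[X]) x, δ (f • x) = gtDp D f • x + f • δ x) ∧
      δ q = 0 := by
  obtain ⟨p, rfl⟩ := Ideal.Quotient.mk_surjective q
  obtain ⟨c, hc⟩ := gt_poly_key D p r
  set N := Ideal.span {(X : F[X]) ^ r} with hN
  set σ := Function.surjInv (Ideal.Quotient.mk_surjective (I := N))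
  have hσ : ∀ x, Ideal.Quotient.mk N (σ x) = x := Function.surjInv_eq _
  set δ : (F[X] ⧸ N) → (F[X] ⧸ N) := fun x => Ideal.Quotient.mk N (gtDp D (σ x) - c * σ x)
  have hδ : ∀ u, δ (Ideal.Quotient.mk N u) = Ideal.Quotient.mk N (gtDp D u - c * u) := by
    intro u
    have h1 := hσ (Ideal.Quotient.mk N u)
    replace h1 := Ideal.mem_span_singleton.1 (Ideal.Quotient.eq.1 h1)
    obtain ⟨g, hg⟩ := h1
    have h2 : σ (Ideal.Quotient.mk N u) = X ^ r * g + u := by rw [← hg]; ring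
    simp only [δ]
    rw [h2, map_add, gtDp_X_pow_mul]
    refine Ideal.Quotient.eq.2 (Ideal.mem_span_singleton.2 ?_)
    exact ⟨gtDp D g - c * g, by ring⟩
  refine ⟨δ, ?_, ?_, ?_⟩
  · intro x y
    obtain ⟨x, rfl⟩ := Ideal.Quotient.mk_surjective x
    obtain ⟨y, rfl⟩ := Ideal.Quotient.mk_surjective y
    rw [← map_add, hδ, hδ, hδ, ← map_add, map_add]
    congr 1; ring
  · intro f x
    obtain ⟨x, rfl⟩ := Ideal.Quotient.mk_surjective x
    have hs : ∀ f u : F[X], f • Ideal.Quotient.mk N u = Ideal.Quotient.mk N (f * u) :=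
      fun f u => rfl
    rw [hs, hδ, hδ, hs, hs, ← map_add, Derivation.leibniz]
    congr 1; simp only [smul_eq_mul]; ring
  · rw [hδ, Ideal.Quotient.eq_zero_iff_mem, hN, Ideal.mem_span_singleton]
    exact hc

theorem gt_conn {k F E : Type*} [Field k] [Field F] [Algebra k F] [AddCommGroup E] [Module F E]
    [FiniteDimensional F E] (f : Module.End F E) (hf : IsNilpotent f) (D : Derivation k F F)
    (e : E) :
    ∃ δ : E → E, (∀ x y, δ (x + y) = δ x + δ y) ∧ (∀ (a : F) x, δ (a • x) = D a • x + a • δ x) ∧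
      (∀ x, δ (f x) = f (δ x)) ∧ δ e = 0 := by
  obtain ⟨d, r, ⟨φ⟩⟩ := gt_decomp f hf
  have := fun i => gt_quot_conn D (r i) (φ (Module.AEval'.of f e) i)
  choose δ h1 h2 h3 using this
  set ι := Module.AEval'.of f
  have hCs : ∀ (a : F) v, φ (ι (a • v)) = (C a : F[X]) • φ (ι v) := by
    intro a v
    rw [← map_smul φ, Module.AEval.C_smul, map_smul]
  have hCs' : ∀ (a : F) q, ι.symm (φ.symm ((C a : F[X]) • q)) = a • ι.symm (φ.symm q) := by
    intro a q
    rw [map_smul φ.symm, Module.AEval.C_smul, map_smul]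
  have hXs : ∀ v, φ (ι (f v)) = (X : F[X]) • φ (ι v) := by
    intro v
    rw [← map_smul φ, Module.AEval'.X_smul_of]
  have hXs' : ∀ q, ι.symm (φ.symm ((X : F[X]) • q)) = f (ι.symm (φ.symm q)) := by
    intro q
    apply ι.injective
    rw [map_smul φ.symm, LinearEquiv.apply_symm_apply, ← Module.AEval'.X_smul_of,
      LinearEquiv.apply_symm_apply]
  let Δ : ((i : Fin d) → F[X] ⧸ Ideal.span {(X : F[X]) ^ r i}) →
    ((i : Fin d) → F[X] ⧸ Ideal.span {(X : F[X]) ^ r i}) := fun q i => δ i (q i)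
  have hΔ1 : ∀ x y, Δ (x + y) = Δ x + Δ y := fun x y => funext fun i => h1 i _ _
  have hΔ2 : ∀ (g : F[X]) x, Δ (g • x) = gtDp D g • x + g • Δ x :=
    fun x y => funext fun i => h2 i _ _
  have hΔ3 : Δ (φ (ι e)) = 0 := funext fun i => h3 i
  refine ⟨fun x => ι.symm (φ.symm (Δ (φ (ι x)))), ?_, ?_, ?_, ?_⟩
  · intro x y
    simp only [map_add, hΔ1]
  · intro a x
    simp only [hCs, hΔ2, map_add φ.symm, map_add ι.symm, gtDp_C, hCs',
      LinearEquiv.symm_apply_apply]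
  · intro x
    have h0 : Δ (φ (ι (f x))) = (X : F[X]) • Δ (φ (ι x)) := by
      rw [hXs, hΔ2, gtDp_X]
      have : (0 : F[X]) • φ (ι x) = 0 := zero_smul F[X] (φ (ι x))
      rw [this, zero_add]
    simp only [h0, hXs']
  · simp only [hΔ3, map_zero]

theorem gt_lemJ {k F m : Type*} [Field k] [Field F] [Algebra k F] [Fintype m] [DecidableEq m]
    (X : Matrix m m F) (hX : IsNilpotent X) (e : m → F) (D : Derivation k F F) :
    ∃ A : Matrix m m F, X.map D = A * X - X * A ∧ (fun i => D (e i)) = A.mulVec e := by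
  obtain ⟨δ, h1, h2, h3, h4⟩ := gt_conn (Matrix.toLinAlgEquiv' X) (hX.map _) D e
  let L : (m → F) →ₗ[F] (m → F) :=
    { toFun := fun v => (fun i => D (v i)) - δ v
      map_add' := by
        intro x y
        rw [h1]
        ext i
        simp; ring
      map_smul' := by
        intro a x
        rw [h2]
        ext i
        simp; ring }
  have hL : ∀ v, L v = (fun i => D (v i)) - δ v := fun _ => rfl
  have hA : ∀ v, (LinearMap.toMatrix' L).mulVec v = (fun i => D (v i)) - δ v := by
    intro v
    rw [← Matrix.toLin'_apply, Matrix.toLin'_toMatrix', hL]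
  refine ⟨LinearMap.toMatrix' L, ?_, ?_⟩
  · rw [← Matrix.mulVec_injective.eq_iff]
    ext v i
    rw [Matrix.sub_mulVec, ← Matrix.mulVec_mulVec, ← Matrix.mulVec_mulVec, hA, hA, Matrix.mulVec_sub]
    have := h3 v
    simp only [Matrix.toLinAlgEquiv'_apply] at this
    rw [this]
    simp [Matrix.mulVec, dotProduct, Derivation.leibniz, Finset.sum_add_distrib, mul_comm]
  · rw [hA, h4, sub_zero]

theorem gt_centralizer {F m : Type*} [Field F] [Fintype m] [DecidableEq m]
    (X : Matrix m m F) (hX : IsNilpotent X) :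
    Fintype.card m ≤ Module.finrank F (LinearMap.ker
      (LinearMap.mulRight F X - LinearMap.mulLeft F X : Matrix m m F →ₗ[F] Matrix m m F)) := by
  set f := Matrix.toLinAlgEquiv' X with hf
  obtain ⟨d, r, ⟨φ⟩⟩ := gt_decomp f (hX.map Matrix.toLinAlgEquiv')
  set ι := Module.AEval'.of f
  have hCs : ∀ (a : F) v, φ (ι (a • v)) = (C a : F[X]) • φ (ι v) := by
    intro a v
    rw [← map_smul φ, Module.AEval.C_smul, map_smul]
  have hCs' : ∀ (a : F) q, ι.symm (φ.symm ((C a : F[X]) • q)) = a • ι.symm (φ.symm q) := by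
    intro a q
    rw [map_smul φ.symm, Module.AEval.C_smul, map_smul]
  let Ψ : (m → F) →ₗ[F] Module.End F (m → F) :=
    LinearMap.mk₂ F (fun x y => ι.symm (φ.symm (φ (ι x) * φ (ι y))))
      (by intro a b c; simp [add_mul])
      (by intro a b c; rw [hCs, smul_mul_assoc, hCs'])
      (by intro a b c; simp [mul_add])
      (by intro a b c; rw [hCs, mul_smul_comm, hCs'])
  have hΨ : ∀ x y, Ψ x y = ι.symm (φ.symm (φ (ι x) * φ (ι y))) := fun _ _ => rfl
  have hinj : Function.Injective Ψ := by
    rw [← LinearMap.ker_eq_bot, LinearMap.ker_eq_bot']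
    intro x hx
    have := LinearMap.congr_fun hx (ι.symm (φ.symm 1))
    rw [hΨ] at this
    simpa using this
  have hcomm : ∀ x, Ψ x * f = f * Ψ x := by
    intro x
    refine LinearMap.ext fun y => ?_
    change Ψ x (f y) = f (Ψ x y)
    apply ι.injective
    rw [hΨ, hΨ, LinearEquiv.apply_symm_apply, ← Module.AEval'.X_smul_of,
      ← Module.AEval'.X_smul_of, LinearEquiv.apply_symm_apply, map_smul, mul_smul_comm, map_smul]
  let G : (m → F) →ₗ[F] Matrix m m F :=
    (Matrix.toLinAlgEquiv' (R := F) (n := m)).symm.toLinearMap ∘ₗ Ψ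
  have hG : Function.Injective G := by
    intro a b hab
    exact hinj ((Matrix.toLinAlgEquiv' (R := F) (n := m)).symm.injective hab)
  let G' := LinearMap.codRestrict (LinearMap.ker
      (LinearMap.mulRight F X - LinearMap.mulLeft F X : Matrix m m F →ₗ[F] Matrix m m F)) G (by
    intro x
    rw [LinearMap.mem_ker]
    apply (Matrix.toLinAlgEquiv' (R := F) (n := m)).injective
    have := hcomm x
    simp only [LinearMap.sub_apply, LinearMap.mulRight_apply, LinearMap.mulLeft_apply, map_sub,
      map_mul, map_zero, G, LinearMap.comp_apply, AlgEquiv.toLinearMap_apply,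
      AlgEquiv.apply_symm_apply]
    rw [this, hf, sub_self])
  have := LinearMap.finrank_le_finrank_of_injective (f := G') (by
    intro a b hab
    exact hG (congrArg Subtype.val hab))
  simpa using this
def GTIso (k : Type*) {F m : Type*} [Field k] [Field F] [Algebra k F] [Fintype m]
    (X : Matrix m m F) : Prop :=
  ∀ (D₁ D₂ : Derivation k F F) (A : Matrix m m F), X.map D₂ = A * X - X * A →
    (X.map D₁ * A).trace = 0

theorem gt_iso_reindex {k F m m' : Type*} [Field k] [Field F] [Algebra k F] [Fintype m]
    [Fintype m'] (X : Matrix m m F) (e : m' ≃ m) (h : GTIso k (X.submatrix e e)) :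
    GTIso k X := by
  intro D₁ D₂ A hA
  have := h D₁ D₂ (A.submatrix e e) (by
    rw [← Matrix.submatrix_map, hA]
    rw [Matrix.submatrix_mul_equiv, Matrix.submatrix_mul_equiv]
    rfl)
  rw [← Matrix.submatrix_map, Matrix.submatrix_mul_equiv] at this
  rw [← this, Matrix.trace, Matrix.trace]
  exact (Equiv.sum_comp e _).symm

theorem gt_trace_fromBlocks {F m m' : Type*} [Field F] [Fintype m] [Fintype m']
    (a : Matrix m m F) (b : Matrix m m' F) (c : Matrix m' m F) (d : Matrix m' m' F) :
    (Matrix.fromBlocks a b c d).trace = a.trace + d.trace := by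
  simp [Matrix.trace, Fintype.sum_sum_type]

theorem gt_iso_step {k F m : Type*} [Field k] [Field F] [Algebra k F] [Fintype m]
    [DecidableEq m] (y : Matrix m m F) (v : Matrix m Unit F) (w : Matrix Unit m F)
    (z : Matrix Unit Unit F) (hy : IsNilpotent y) (hX : IsNilpotent (Matrix.fromBlocks y v w z))
    (h : GTIso k y) : GTIso k (Matrix.fromBlocks y v w z) := by
  intro D₁ D₂ A hA
  set X := Matrix.fromBlocks y v w z with hXdef
  obtain ⟨a₁, ha₁, hv₁⟩ := gt_lemJ y hy (fun i => v i ()) D₁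
  obtain ⟨a₂, ha₂, -⟩ := gt_lemJ y hy (fun i => v i ()) D₂
  obtain ⟨A₁, hA₁, -⟩ := gt_lemJ X hX (Sum.elim 0 1) D₁
  obtain ⟨A₂, hA₂, he₂⟩ := gt_lemJ X hX (Sum.elim 0 1) D₂
  have hv : v.map D₁ = a₁ * v := by
    ext i j
    have := congrFun hv₁ i
    simpa [Matrix.mulVec, dotProduct, Matrix.mul_apply] using this
  have hA₂' : A₂ = Matrix.fromBlocks A₂.toBlocks₁₁ 0 A₂.toBlocks₂₁ 0 := by
    ext i j
    rcases j with j | j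
    · rcases i with i | i <;> rfl
    · have := congrFun he₂ i
      rcases i with i | i <;> simpa [Matrix.mulVec, dotProduct, Fintype.sum_sum_type] using this.symm
  -- replace A by A₂
  have hrep : (X.map D₁ * A).trace = (X.map D₁ * A₂).trace := by
    have hc : (A - A₂) * X = X * (A - A₂) := by
      have := hA.symm.trans hA₂
      rw [sub_mul, mul_sub]
      rw [sub_eq_sub_iff_add_eq_add] at this
      rw [sub_eq_sub_iff_add_eq_add, this]
      abel
    rw [← sub_eq_zero, ← Matrix.trace_sub, ← mul_sub, hA₁, sub_mul, Matrix.trace_sub,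
      mul_assoc, mul_assoc, ← hc, Matrix.trace_mul_comm X, mul_assoc, sub_self]
  rw [hrep]
  set â : Matrix (m ⊕ Unit) (m ⊕ Unit) F := Matrix.fromBlocks a₁ 0 0 0 with hâ
  have hD : X.map D₁ = (â * X - X * â) + Matrix.fromBlocks 0 0 (w.map D₁ + w * a₁) (z.map D₁) := by
    rw [hXdef, hâ, Matrix.fromBlocks_map, Matrix.fromBlocks_multiply, Matrix.fromBlocks_multiply,
      sub_eq_add_neg, Matrix.fromBlocks_neg, Matrix.fromBlocks_add, Matrix.fromBlocks_add, ha₁, hv]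
    simp [sub_eq_add_neg]
  have hE : (Matrix.fromBlocks 0 0 (w.map D₁ + w * a₁) (z.map D₁) * A₂ :
      Matrix (m ⊕ Unit) (m ⊕ Unit) F).trace = 0 := by
    rw [hA₂', Matrix.fromBlocks_multiply, gt_trace_fromBlocks]
    simp
  have h1 : ((â * X - X * â) * A₂).trace = - (a₁ * y.map D₂).trace := by
    have : ((â * X - X * â) * A₂).trace = - (â * X.map D₂).trace := by
      rw [hA₂, sub_mul, mul_sub, Matrix.trace_sub, Matrix.trace_sub, mul_assoc X,
        Matrix.trace_mul_comm X, mul_assoc, mul_assoc]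
      ring
    rw [this, hâ, hXdef, Matrix.fromBlocks_map, Matrix.fromBlocks_multiply, gt_trace_fromBlocks]
    simp
  have h2 : (y.map D₁ * a₂).trace = - (a₁ * y.map D₂).trace := by
    rw [ha₁, ha₂, sub_mul, mul_sub, Matrix.trace_sub, Matrix.trace_sub, mul_assoc y,
        Matrix.trace_mul_comm y, mul_assoc, mul_assoc]
    ring
  rw [hD, add_mul, Matrix.trace_add, hE, add_zero, h1, ← h2]
  exact h D₁ D₂ a₂ ha₂

theorem gt_iso {k F : Type*} [Field k] [Field F] [Algebra k F] (x : ℕ → ℕ → F) (n : ℕ)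
    (h : ∀ i, i ≤ n → IsNilpotent (Matrix.of fun a b : Fin i => x a b)) :
    GTIso k (Matrix.of fun a b : Fin n => x a b) := by
  induction n with
  | zero => intro D₁ D₂ A _; simp [Matrix.trace]
  | succ n ih =>
    have e : Fin n ⊕ Unit ≃ Fin (n + 1) :=
      (Equiv.optionEquivSumPUnit.{0} (Fin n)).symm.trans (finSuccEquivLast (n := n)).symm
    let e : Fin n ⊕ Unit ≃ Fin (n + 1) :=
      (Equiv.optionEquivSumPUnit.{0} (Fin n)).symm.trans (finSuccEquivLast (n := n)).symm
    apply gt_iso_reindex _ e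
    set X := (Matrix.of fun a b : Fin (n + 1) => x a b).submatrix e e with hX
    have h11 : X.toBlocks₁₁ = Matrix.of fun a b : Fin n => x a b := by
      ext a b
      simp [hX, e, Matrix.toBlocks₁₁]
    rw [← X.fromBlocks_toBlocks]
    apply gt_iso_step
    · rw [h11]; exact h n (by omega)
    · rw [X.fromBlocks_toBlocks]
      obtain ⟨r, hr⟩ := h (n + 1) le_rfl
      refine ⟨r, ?_⟩
      have : X = (Matrix.reindexAlgEquiv F F e.symm) (Matrix.of fun a b : Fin (n + 1) => x a b) := by
        rfl
      rw [this, ← map_pow, hr, map_zero]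
    · rw [h11]; exact ih fun i hi => h i (by omega)

theorem gt_dim_bound {k F m : Type*} [Field k] [Field F] [Algebra k F] [Fintype m]
    [DecidableEq m] (X : Matrix m m F) (hX : IsNilpotent X) (hI : GTIso k X)
    (T : Submodule F (Matrix m m F)) (hT : ∀ t ∈ T, ∃ D : Derivation k F F, t = X.map D) :
    2 * Module.finrank F T + Fintype.card m ≤ Fintype.card m * Fintype.card m := by
  set ad : Matrix m m F →ₗ[F] Matrix m m F :=
    LinearMap.mulRight F X - LinearMap.mulLeft F X with had
  have had' : ∀ A, ad A = A * X - X * A := fun A => by simp [had]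
  have hc := gt_centralizer X hX
  rw [← had] at hc
  have hTr : T ≤ LinearMap.range ad := by
    intro t ht
    obtain ⟨D, rfl⟩ := hT t ht
    obtain ⟨A, hA, -⟩ := gt_lemJ X hX 0 D
    exact ⟨A, by rw [had', hA]⟩
  -- finrank of the preimage
  have hcm : Module.finrank F (T.comap ad) = Module.finrank F T +
      Module.finrank F (LinearMap.ker ad) := by
    have := LinearMap.finrank_range_add_finrank_ker (ad.domRestrict (T.comap ad))
    rw [← this]
    congr 1
    · rw [LinearMap.range_domRestrict, Submodule.map_comap_eq, inf_eq_right.2 hTr]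
    · rw [LinearMap.ker_domRestrict]
      have hle : LinearMap.ker ad ≤ T.comap ad := ?_
      · exact (Submodule.comapSubtypeEquivOfLe hle).finrank_eq
      intro a ha
      rw [Submodule.mem_comap, LinearMap.mem_ker.1 ha]
      exact T.zero_mem
  let Φ : Matrix m m F →ₗ[F] Module.Dual F (Matrix m m F) :=
    LinearMap.mk₂ F (fun A B => (B * A).trace)
      (by intros; simp [mul_add]) (by intros; simp)
      (by intros; simp [add_mul]) (by intros; simp)
  have hΦ : Function.Injective Φ := by
    rw [← LinearMap.ker_eq_bot, LinearMap.ker_eq_bot']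
    intro A hA
    ext i j
    have := LinearMap.congr_fun hA (Matrix.single j i 1)
    simpa [Φ, Matrix.trace_single_mul] using this
  have hle : (T.comap ad).map Φ ≤ T.dualAnnihilator := by
    rintro _ ⟨A, hA, rfl⟩
    rw [Submodule.mem_dualAnnihilator]
    intro t ht
    obtain ⟨D₁, rfl⟩ := hT t ht
    obtain ⟨D₂, hD₂⟩ := hT _ hA
    exact hI D₁ D₂ A (by rw [← hD₂, had'])
  have h1 := Submodule.finrank_mono hle
  rw [← (Submodule.equivMapOfInjective Φ hΦ _).finrank_eq] at h1
  have h2 := Subspace.finrank_add_finrank_dualAnnihilator_eq T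
  rw [Module.finrank_matrix] at h2
  simp at h2
  omega
theorem gt_krull_integral {A B : Type*} [CommRing A] [CommRing B] [Algebra A B]
    [Algebra.IsIntegral A B] : ringKrullDim B ≤ ringKrullDim A := by
  refine Order.krullDim_le_of_strictMono (PrimeSpectrum.comap (algebraMap A B)) ?_
  intro p q hpq
  have h : p.asIdeal < q.asIdeal := hpq
  have := Ideal.IsIntegral.comap_lt_comap (R := A) h
  exact this

theorem gt_noether {k B F : Type*} [Field k] [CharZero k] [CommRing B] [IsDomain B] [Algebra k B]
    [Algebra.FiniteType k B] [Field F] [Algebra B F] [IsFractionRing B F] [Algebra k F]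
    [IsScalarTower k B F] :
    FiniteDimensional F (Derivation k F F) ∧
    ringKrullDim B ≤ (Module.finrank F (Derivation k F F) : ℕ) := by
  obtain ⟨s, g, hg, hgi⟩ := exists_integral_inj_algHom_of_fg k B
  set A := MvPolynomial (Fin s) k with hA
  let : Algebra A B := g.toRingHom.toAlgebra
  have : IsScalarTower k A B := IsScalarTower.of_algebraMap_eq' (g.comp_algebraMap).symm
  have : Algebra.IsIntegral A B := ⟨hgi⟩
  let : Algebra A F := ((algebraMap B F).comp g.toRingHom).toAlgebra
  have : IsScalarTower A B F := IsScalarTower.of_algebraMap_eq' rfl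
  have : IsScalarTower k A F := IsScalarTower.of_algebraMap_eq' (by
    rw [IsScalarTower.algebraMap_eq A B F, RingHom.comp_assoc, ← IsScalarTower.algebraMap_eq k A B,
      ← IsScalarTower.algebraMap_eq k B F])
  have hAF : Function.Injective (algebraMap A F) := by
    rw [IsScalarTower.algebraMap_eq A B F]
    exact (IsFractionRing.injective B F).comp hg
  have : FaithfulSMul A F := (faithfulSMul_iff_algebraMap_injective A F).2 hAF
  have : FaithfulSMul A B := (faithfulSMul_iff_algebraMap_injective A B).2 hg
  let K := FractionRing A
  let : Algebra K F := FractionRing.liftAlgebra A F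
  have : IsScalarTower A K F := FractionRing.isScalarTower_liftAlgebra A F
  have : CharZero F := charZero_of_injective_algebraMap (algebraMap k F).injective
  have : CharZero K := charZero_of_injective_algebraMap (algebraMap k K).injective
  have : Algebra.IsAlgebraic A F := (IsFractionRing.isAlgebraic_iff' A B F).1 inferInstance
  have : Algebra.IsAlgebraic K F := (IsFractionRing.comap_isAlgebraic_iff (A := A)).1 inferInstance
  have : Algebra.FormallyEtale K F := Algebra.FormallyEtale.of_isSeparable K F
  have : Algebra.FormallyEtale A K := Algebra.FormallyEtale.of_isLocalization (nonZeroDivisors A)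
  have : Algebra.FormallyEtale A F := Algebra.FormallyEtale.comp A K F
  let b := ((KaehlerDifferential.mvPolynomialBasis k (Fin s)).baseChange F).map
    (KaehlerDifferential.tensorKaehlerEquivOfFormallyEtale k A F)
  have : FiniteDimensional F (Ω[F⁄k]) := b.finiteDimensional_of_finite
  have hr : Module.finrank F (Ω[F⁄k]) = s := by
    rw [Module.finrank_eq_card_basis b, Fintype.card_fin]
  let e := KaehlerDifferential.linearMapEquivDerivation k F (M := F)
  refine ⟨e.finiteDimensional, ?_⟩
  rw [← e.finrank_eq]
  have : Module.finrank F (Ω[F⁄k] →ₗ[F] F) = s := by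
    rw [← hr]; exact Subspace.dual_finrank_eq
  rw [this]
  refine (gt_krull_integral (A := A)).trans ?_
  change ringKrullDim (MvPolynomial (Fin s) k) ≤ _
  rw [MvPolynomial.ringKrullDim_of_isNoetherianRing, ringKrullDim_eq_zero_of_field]
  simp

noncomputable def gtGen (k : Type*) [Field k] (n i : ℕ) (hi : i ≤ n) (j : ℕ) :
    MvPolynomial (Fin n × Fin n) k :=
  Matrix.trace ((Matrix.of fun a b : Fin i =>
    (MvPolynomial.X (Fin.castLE hi a, Fin.castLE hi b) : MvPolynomial (Fin n × Fin n) k)) ^ j)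

theorem gtGen_map {k S : Type*} [Field k] [CommRing S] (n i : ℕ) (hi : i ≤ n) (j : ℕ)
    (π : MvPolynomial (Fin n × Fin n) k →+* S) :
    π (gtGen k n i hi j) = Matrix.trace ((Matrix.of fun a b : Fin i =>
      π (MvPolynomial.X (Fin.castLE hi a, Fin.castLE hi b))) ^ j) := by
  have h : (Matrix.of fun a b : Fin i =>
      π (MvPolynomial.X (Fin.castLE hi a, Fin.castLE hi b))) =
      π.mapMatrix (Matrix.of fun a b : Fin i =>
    (MvPolynomial.X (Fin.castLE hi a, Fin.castLE hi b) : MvPolynomial (Fin n × Fin n) k)) := by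
    ext; simp
  rw [h, ← map_pow, gtGen]
  exact AddMonoidHom.map_trace π _

theorem gt_upper {k : Type*} [Field k] [CharZero k] (n : ℕ)
    (p : Ideal (MvPolynomial (Fin n × Fin n) k)) [hp : p.IsPrime]
    (h : ∀ i hi j, 1 ≤ j → j ≤ i → gtGen k n i hi j ∈ p) :
    ringKrullDim (MvPolynomial (Fin n × Fin n) k ⧸ p) ≤ (n * (n - 1) / 2 : ℕ) := by
  let B := MvPolynomial (Fin n × Fin n) k ⧸ p
  let F := FractionRing B
  obtain ⟨hfd, hle⟩ := gt_noether (k := k) (B := B) (F := F)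
  have : CharZero F := charZero_of_injective_algebraMap (algebraMap k F).injective
  let π : MvPolynomial (Fin n × Fin n) k →+* F := (algebraMap B F).comp (Ideal.Quotient.mk p)
  have hC : ∀ c, π (MvPolynomial.C c) = algebraMap k F c := fun c => rfl
  let x : ℕ → ℕ → F := fun a b =>
    if h : a < n ∧ b < n then π (MvPolynomial.X (⟨a, h.1⟩, ⟨b, h.2⟩)) else 0
  have hnil : ∀ i, i ≤ n → IsNilpotent (Matrix.of fun a b : Fin i => x a b) := by
    intro i hi
    apply gt_nilpotent
    intro j hj hji
    have h1 : (Matrix.of fun a b : Fin i => x a b) = (Matrix.of fun a b : Fin i =>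
      π (MvPolynomial.X (Fin.castLE hi a, Fin.castLE hi b))) := by
      ext a b
      have : (a : ℕ) < n ∧ (b : ℕ) < n := ⟨by omega, by omega⟩
      simp only [Matrix.of_apply, x, dif_pos this]
      rfl
    rw [h1, ← gtGen_map]
    change algebraMap B F (Ideal.Quotient.mk p _) = 0
    rw [Ideal.Quotient.eq_zero_iff_mem.2 (h i hi j hj hji), map_zero]
  set X : Matrix (Fin n) (Fin n) F := Matrix.of fun a b : Fin n => x a b with hX
  have hXe : ∀ a b, X a b = π (MvPolynomial.X (a, b)) := by
    intro a b
    have : (a : ℕ) < n ∧ (b : ℕ) < n := ⟨by omega, by omega⟩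
    simp only [hX, Matrix.of_apply, x, dif_pos this]
  let L : Derivation k F F →ₗ[F] Matrix (Fin n) (Fin n) F :=
    { toFun := fun D => X.map D
      map_add' := by intro a b; ext; simp
      map_smul' := by intro a b; ext; simp }
  have hL : Function.Injective L := by
    rw [← LinearMap.ker_eq_bot, LinearMap.ker_eq_bot']
    intro D hD
    have h0 : ∀ f, D (π f) = 0 := by
      intro f
      induction f using MvPolynomial.induction_on with
      | C c => rw [hC]; simp
      | add f g hf hg => rw [map_add, map_add, hf, hg, add_zero]
      | mul_X f i hf =>
        have : D (X i.1 i.2) = 0 := congrFun (congrFun hD i.1) i.2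
        rw [hXe] at this
        rw [map_mul, Derivation.leibniz, hf, this]
        simp
    ext z
    obtain ⟨a, b, hb, rfl⟩ := IsFractionRing.div_surjective (A := B) z
    obtain ⟨a, rfl⟩ := Ideal.Quotient.mk_surjective a
    obtain ⟨b, rfl⟩ := Ideal.Quotient.mk_surjective b
    have hb0 : π b ≠ 0 := by
      intro h
      exact nonZeroDivisors.ne_zero hb ((map_eq_zero_iff _ (IsFractionRing.injective B F)).1 h)
    have h1 : D (π a / π b * π b) = 0 := by rw [div_mul_cancel₀ _ hb0, h0]
    rw [Derivation.leibniz, h0 b, smul_zero, zero_add, smul_eq_mul, mul_eq_zero] at h1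
    exact h1.resolve_left hb0
  have hb := gt_dim_bound (k := k) X (hnil n le_rfl) (gt_iso x n hnil) (LinearMap.range L) (by
    rintro _ ⟨D, rfl⟩
    exact ⟨D, rfl⟩)
  rw [LinearMap.finrank_range_of_inj hL, Fintype.card_fin] at hb
  refine hle.trans ?_
  norm_cast
  rw [Nat.le_div_iff_mul_le two_pos, Nat.mul_sub, mul_one]
  omega

end GTAlg

open Classical in
theorem gt_height_point {k σ : Type*} [Field k] [Fintype σ] (x : σ → k) :
    (Fintype.card σ : ℕ∞) ≤ (RingHom.ker (MvPolynomial.eval x)).height := by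
  let P : Finset σ → Ideal (MvPolynomial σ k) := fun S => RingHom.ker
    (MvPolynomial.aeval (fun i => if i ∈ S then MvPolynomial.C (x i) else MvPolynomial.X i) :
      MvPolynomial σ k →ₐ[k] MvPolynomial σ k)
  have hP : ∀ S, (P S).IsPrime := fun S => RingHom.ker_isPrime _
  have hS : ∀ S : Finset σ, (S.card : ℕ∞) ≤ (P S).height := by
    intro S
    induction S using Finset.induction_on with
    | empty => simp
    | insert a S ha ih =>
      have hlt : P S < P (insert a S) := by
        refine lt_of_le_of_ne ?_ ?_
        · have : (MvPolynomial.aeval (fun i => if i ∈ insert a S then MvPolynomial.C (x i)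
              else MvPolynomial.X i) : MvPolynomial σ k →ₐ[k] MvPolynomial σ k) =
            (MvPolynomial.aeval (fun i => if i = a then MvPolynomial.C (x i)
              else MvPolynomial.X i) : MvPolynomial σ k →ₐ[k] MvPolynomial σ k).comp
            (MvPolynomial.aeval (fun i => if i ∈ S then MvPolynomial.C (x i)
              else MvPolynomial.X i)) := by
            apply MvPolynomial.algHom_ext
            intro i
            by_cases hi : i ∈ S
            · simp [hi, MvPolynomial.algebraMap_eq]
            · simp [hi]
          intro f hf
          have hf' := RingHom.mem_ker.1 hf
          apply RingHom.mem_ker.2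
          rw [this]
          change _ = 0 at hf'
          rw [AlgHom.comp_apply]
          erw [hf']
          simp
        · intro h
          have h1 : (MvPolynomial.X a - MvPolynomial.C (x a) : MvPolynomial σ k) ∈
              P (insert a S) := by
            apply RingHom.mem_ker.2
            simp [MvPolynomial.algebraMap_eq]
          rw [← h] at h1
          have h2 := RingHom.mem_ker.1 h1
          simp only [map_sub, MvPolynomial.aeval_X, ha, if_false, MvPolynomial.aeval_C,
            MvPolynomial.algebraMap_eq] at h2
          have h3 := congrArg (MvPolynomial.eval (fun _ => x a + 1)) h2
          simp at h3
      have := Ideal.height_add_one_le_of_lt_of_isPrime hlt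
      rw [Finset.card_insert_of_notMem ha]
      push_cast
      exact (by gcongr : (S.card : ℕ∞) + 1 ≤ _).trans this
  refine (hS Finset.univ).trans (Ideal.height_mono ?_)
  intro f hf
  have hf' := RingHom.mem_ker.1 hf
  apply RingHom.mem_ker.2
  have := congrArg (MvPolynomial.eval x) hf'
  have hh : (MvPolynomial.aeval (R := k) x).comp (MvPolynomial.aeval
      (fun i => if i ∈ Finset.univ then MvPolynomial.C (x i) else MvPolynomial.X i) :
      MvPolynomial σ k →ₐ[k] MvPolynomial σ k) = MvPolynomial.aeval x := by
    apply MvPolynomial.algHom_ext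
    intro i
    simp
  have h2 := AlgHom.congr_fun hh f
  rw [MvPolynomial.aeval_eq_eval] at h2
  exact h2.symm.trans this

open Classical in
theorem gt_lower {k σ : Type*} [Field k] [IsAlgClosed k] [Fintype σ]
    (s : Finset (MvPolynomial σ k)) (p : Ideal (MvPolynomial σ k))
    (hp : p ∈ (Ideal.span (s : Set (MvPolynomial σ k))).minimalPrimes) :
    (Fintype.card σ : WithBot ℕ∞) ≤ ringKrullDim (MvPolynomial σ k ⧸ p) + s.card := by
  have hpp : p.IsPrime := hp.1.1
  set I := Ideal.span (s : Set (MvPolynomial σ k)) with hI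
  have hfin := Ideal.finite_minimalPrimes_of_isNoetherianRing (MvPolynomial σ k) I
  obtain ⟨f, hf, hfp⟩ : ∃ f, (∀ q ∈ I.minimalPrimes, q ≠ p → f ∈ q) ∧ f ∉ p := by
    by_contra! hcon
    have hle : (hfin.toFinset.erase p).inf id ≤ p := by
      intro f hf
      apply hcon f
      intro q hq hqp
      rw [Submodule.mem_finsetInf] at hf
      exact hf q (by simp [hq, hqp])
    obtain ⟨q, hq, hqp⟩ := (Ideal.IsPrime.inf_le' hpp).1 hle
    simp only [Finset.mem_erase, Set.Finite.mem_toFinset] at hq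
    exact hq.1 (le_antisymm hqp (hp.2 hq.2.1 hqp))
  obtain ⟨x, hx, hfx⟩ : ∃ x ∈ MvPolynomial.zeroLocus k p, MvPolynomial.eval x f ≠ 0 := by
    by_contra! hcon
    apply hfp
    rw [← MvPolynomial.IsPrime.vanishingIdeal_zeroLocus (K := k) p]
    intro x hx
    rw [MvPolynomial.aeval_eq_eval]
    exact hcon x hx
  set m := RingHom.ker (MvPolynomial.eval x) with hm
  have hmp : m.IsPrime := RingHom.ker_isPrime _
  have hpm : p ≤ m := by
    intro g hg
    rw [hm, RingHom.mem_ker]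
    have := hx g hg
    rwa [MvPolynomial.aeval_eq_eval] at this
  let m' := m.map (Ideal.Quotient.mk p)
  have hm' : m'.IsPrime := Ideal.isPrime_map_quotientMk_of_isPrime hpm
  obtain ⟨t, hmt, ht⟩ := Ideal.exists_finset_card_eq_height_of_isNoetherianRing m'
  have hcm : m'.comap (Ideal.Quotient.mk p) = m := by
    rw [Ideal.comap_map_of_surjective _ Ideal.Quotient.mk_surjective, ← RingHom.ker_eq_comap_bot,
      Ideal.mk_ker, sup_of_le_left hpm]
  have hsurj : Set.SurjOn (Ideal.Quotient.mk p) m t := by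
    intro y hy
    have hy' : y ∈ m' := hmt.1.2 (Ideal.subset_span hy)
    obtain ⟨y, rfl⟩ := Ideal.Quotient.mk_surjective y
    exact ⟨y, by rw [← hcm]; exact hy', rfl⟩
  obtain ⟨o, hom, hoinj, hoimg⟩ := t.exists_subset_injOn_image_eq_of_surjOn _ hsurj
  have hcard : o.card = t.card := by
    rw [← hoimg, Finset.card_image_of_injOn hoinj]
  have hmin : m ∈ (Ideal.span ((o ∪ s : Finset _) : Set (MvPolynomial σ k))).minimalPrimes := by
    refine ⟨⟨hmp, ?_⟩, ?_⟩
    · rw [Ideal.span_le, Finset.coe_union, Set.union_subset_iff]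
      exact ⟨hom, fun g hg => hpm (hp.1.2 (Ideal.subset_span hg))⟩
    · rintro q ⟨hq, hqs⟩ hqm
      rw [Ideal.span_le, Finset.coe_union, Set.union_subset_iff] at hqs
      obtain ⟨p', hp', hp'q⟩ := Ideal.exists_minimalPrimes_le (I := I) (J := q)
        (Ideal.span_le.2 hqs.2)
      have hpp' : p' = p := by
        by_contra hne
        exact hfx (hqm (hp'q (hf p' hp' hne)))
      subst hpp'
      have hq' : (q.map (Ideal.Quotient.mk p')).IsPrime :=
        Ideal.isPrime_map_quotientMk_of_isPrime hp'q
      have h1 := hmt.2 (y := q.map (Ideal.Quotient.mk p')) ⟨hq', by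
        rw [Ideal.span_le, ← hoimg, Finset.coe_image]
        rintro _ ⟨y, hy, rfl⟩
        exact Ideal.mem_map_of_mem _ (hqs.1 hy)⟩ (Ideal.map_mono hqm)
      have h2 := Ideal.comap_mono (f := Ideal.Quotient.mk p') h1
      rw [hcm, Ideal.comap_map_of_surjective _ Ideal.Quotient.mk_surjective,
        ← RingHom.ker_eq_comap_bot, Ideal.mk_ker, sup_of_le_left hp'q] at h2
      exact h2
  have h1 := Ideal.height_le_card_of_mem_minimalPrimes_span_finset hmin
  have h2 : (Fintype.card σ : ℕ∞) ≤ m'.height + s.card := by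
    refine (gt_height_point x).trans (h1.trans ?_)
    rw [← ht, ← hcard]
    exact_mod_cast Finset.card_union_le o s
  have h3 : (m'.height : WithBot ℕ∞) ≤ ringKrullDim (MvPolynomial σ k ⧸ p) :=
    Ideal.height_le_ringKrullDim_of_ne_top hm'.ne_top
  have h4 : (Fintype.card σ : WithBot ℕ∞) ≤ (m'.height : WithBot ℕ∞) + s.card := by
    exact_mod_cast h2
  exact h4.trans (by gcongr)

theorem gt_zariski_isClosed {k σ Y : Type*} [Field k] (g : Y → (σ → k)) (Z : Set Y) :
    @IsClosed Y (TopologicalSpace.induced g (zariskiTopology k σ)) Z ↔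
      ∃ J : Set (MvPolynomial σ k), Z = {y | ∀ f ∈ J, MvPolynomial.eval (g y) f = 0} := by
  have h1 : zariskiTopology k σ = TopologicalSpace.induced
      (MvPolynomial.pointToPoint (k := k) (K := k) (σ := σ)) inferInstance := by
    rw [PrimeSpectrum.isTopologicalBasis_basic_opens.eq_generateFrom, induced_generateFrom_eq,
      zariskiTopology]
    congr 1
    ext U
    constructor
    · rintro ⟨f, rfl⟩
      refine ⟨_, ⟨f, rfl⟩, ?_⟩
      ext x
      simp [MvPolynomial.pointToPoint, MvPolynomial.aeval_eq_eval]
    · rintro ⟨_, ⟨f, rfl⟩, rfl⟩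
      refine ⟨f, ?_⟩
      ext x
      simp [MvPolynomial.pointToPoint, MvPolynomial.aeval_eq_eval]
  rw [h1, induced_compose, isClosed_induced_iff]
  have hmem : ∀ (J : Set (MvPolynomial σ k)), (MvPolynomial.pointToPoint (k := k) ∘ g) ⁻¹'
      PrimeSpectrum.zeroLocus J = {y | ∀ f ∈ J, MvPolynomial.eval (g y) f = 0} := by
    intro J
    ext y
    simp [MvPolynomial.pointToPoint, MvPolynomial.aeval_eq_eval, Set.subset_def]
  constructor
  · rintro ⟨t, ht, rfl⟩
    obtain ⟨J, rfl⟩ := (PrimeSpectrum.isClosed_iff_zeroLocus t).1 ht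
    exact ⟨J, hmem J⟩
  · rintro ⟨J, rfl⟩
    exact ⟨_, PrimeSpectrum.isClosed_zeroLocus J, hmem J⟩

/-- The closed sets of the topology on `Y` are the zero sets of polynomials through `g`. -/
def GTClosed {k σ Y : Type*} [Field k] [TopologicalSpace Y] (g : Y → (σ → k)) : Prop :=
  ∀ Z : Set Y, IsClosed Z ↔
    ∃ J : Set (MvPolynomial σ k), Z = {y | ∀ f ∈ J, MvPolynomial.eval (g y) f = 0}

def gtI {k σ Y : Type*} [Field k] (g : Y → (σ → k)) (Z : Set Y) : Ideal (MvPolynomial σ k) :=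
  MvPolynomial.vanishingIdeal k (g '' Z)

theorem gtI_mem {k σ Y : Type*} [Field k] (g : Y → (σ → k)) (Z : Set Y) (f : MvPolynomial σ k) :
    f ∈ gtI g Z ↔ ∀ y ∈ Z, MvPolynomial.eval (g y) f = 0 := by
  simp [gtI, MvPolynomial.aeval_eq_eval]

theorem gt_irr {k σ Y : Type*} [Field k] [TopologicalSpace Y] (g : Y → (σ → k)) (hg : GTClosed g)
    (Z : Set Y) : IsIrreducible Z ↔ (gtI g Z).IsPrime := by
  constructor
  · rintro ⟨⟨y, hy⟩, hZ⟩
    rw [isPreirreducible_iff_isClosed_union_isClosed] at hZ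
    refine ⟨?_, ?_⟩
    · intro h
      have h1 := (gtI_mem g Z 1).1 (h ▸ Submodule.mem_top) y hy
      simp at h1
    · intro a b hab
      rw [gtI_mem] at hab
      have := hZ {y | ∀ f ∈ ({a} : Set _), MvPolynomial.eval (g y) f = 0}
        {y | ∀ f ∈ ({b} : Set _), MvPolynomial.eval (g y) f = 0}
        ((hg _).2 ⟨_, rfl⟩) ((hg _).2 ⟨_, rfl⟩) (by
          intro y hy
          have := hab y hy
          rw [map_mul, mul_eq_zero] at this
          simpa using this)
      rw [gtI_mem, gtI_mem]
      refine this.imp ?_ ?_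
      · intro h y hy
        exact h hy a rfl
      · intro h y hy
        exact h hy b rfl
  · intro h
    refine ⟨?_, ?_⟩
    · by_contra hne
      rw [Set.not_nonempty_iff_eq_empty] at hne
      apply h.ne_top
      rw [Ideal.eq_top_iff_one, gtI_mem, hne]
      simp
    · rw [isPreirreducible_iff_isClosed_union_isClosed]
      intro A B hA hB hAB
      obtain ⟨J₁, rfl⟩ := (hg _).1 hA
      obtain ⟨J₂, rfl⟩ := (hg _).1 hB
      by_contra! hcon
      obtain ⟨h1, h2⟩ := hcon
      rw [Set.not_subset] at h1 h2
      obtain ⟨y₁, hy₁, h1⟩ := h1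
      obtain ⟨y₂, hy₂, h2⟩ := h2
      simp only [Set.mem_setOf_eq, not_forall] at h1 h2
      obtain ⟨f₁, hf₁, h1⟩ := h1
      obtain ⟨f₂, hf₂, h2⟩ := h2
      have : f₁ * f₂ ∈ gtI g Z := by
        rw [gtI_mem]
        intro y hy
        rw [map_mul, mul_eq_zero]
        exact (hAB hy).imp (fun h => h f₁ hf₁) (fun h => h f₂ hf₂)
      rcases h.mem_or_mem this with h | h
      · exact h1 ((gtI_mem _ _ _).1 h y₁ hy₁)
      · exact h2 ((gtI_mem _ _ _).1 h y₂ hy₂)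

/-- Nullstellensatz on `Y`. -/
theorem gt_null {k σ Y : Type*} [Field k] [IsAlgClosed k] [Finite σ] (g : Y → (σ → k))
    (q : Ideal (MvPolynomial σ k)) [q.IsPrime] (hq : MvPolynomial.zeroLocus k q ⊆ Set.range g) :
    gtI g {y | ∀ f ∈ q, MvPolynomial.eval (g y) f = 0} = q := by
  conv_rhs => rw [← MvPolynomial.IsPrime.vanishingIdeal_zeroLocus (K := k) q]
  rw [gtI]
  congr 1
  ext x
  constructor
  · rintro ⟨y, hy, rfl⟩
    intro f hf
    rw [MvPolynomial.aeval_eq_eval]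
    exact hy f hf
  · intro hx
    obtain ⟨y, rfl⟩ := hq hx
    refine ⟨y, ?_, rfl⟩
    intro f hf
    have := hx f hf
    rwa [MvPolynomial.aeval_eq_eval] at this

theorem gt_closed_eq {k σ Y : Type*} [Field k] [TopologicalSpace Y] (g : Y → (σ → k))
    (hg : GTClosed g) (Z : Set Y) (hZ : IsClosed Z) :
    {y | ∀ f ∈ gtI g Z, MvPolynomial.eval (g y) f = 0} = Z := by
  obtain ⟨J, rfl⟩ := (hg Z).1 hZ
  ext y
  constructor
  · intro h f hf
    exact h f ((gtI_mem _ _ _).2 fun y hy => hy f hf)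
  · intro h f hf
    exact (gtI_mem _ _ _).1 hf y h

theorem gtI_anti {k σ Y : Type*} [Field k] (g : Y → (σ → k)) {Z Z' : Set Y} (h : Z ⊆ Z') :
    gtI g Z' ≤ gtI g Z := by
  intro f hf
  rw [gtI_mem] at hf ⊢
  exact fun y hy => hf y (h hy)

theorem gt_topdim {k σ Y : Type*} [Field k] [IsAlgClosed k] [Finite σ] [TopologicalSpace Y]
    (g : Y → (σ → k)) (hg : GTClosed g) (p : Ideal (MvPolynomial σ k))
    (hp : MvPolynomial.zeroLocus k p = Set.range g) (hpr : p.IsPrime) :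
    topologicalKrullDim Y = ringKrullDim (MvPolynomial σ k ⧸ p) := by
  have hpI : ∀ Z, p ≤ gtI g Z := by
    intro Z f hf
    rw [gtI_mem]
    intro y _
    have : g y ∈ MvPolynomial.zeroLocus k p := by rw [hp]; exact ⟨y, rfl⟩
    have := this f hf
    rwa [MvPolynomial.aeval_eq_eval] at this
  have hnull : ∀ q : PrimeSpectrum.zeroLocus (p : Set (MvPolynomial σ k)),
      gtI g {y | ∀ f ∈ q.1.asIdeal, MvPolynomial.eval (g y) f = 0} = q.1.asIdeal := by
    intro q
    have := q.1.2
    apply gt_null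
    rw [← hp]
    exact MvPolynomial.zeroLocus_anti_mono q.2
  let e : TopologicalSpace.IrreducibleCloseds Y ≃o
      (PrimeSpectrum.zeroLocus (p : Set (MvPolynomial σ k)))ᵒᵈ :=
    { toFun := fun Z => OrderDual.toDual ⟨⟨gtI g Z, (gt_irr g hg _).1 Z.2⟩, hpI _⟩
      invFun := fun q => ⟨{y | ∀ f ∈ (OrderDual.ofDual q).1.asIdeal,
          MvPolynomial.eval (g y) f = 0}, by
        rw [gt_irr g hg, hnull]
        exact (OrderDual.ofDual q).1.2, (hg _).2 ⟨_, rfl⟩⟩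
      left_inv := by
        intro Z
        ext1
        exact gt_closed_eq g hg Z Z.3
      right_inv := by
        intro q
        apply OrderDual.ofDual.injective
        apply Subtype.ext
        apply PrimeSpectrum.ext
        exact hnull _
      map_rel_iff' := by
        intro Z Z'
        constructor
        · intro h
          have h' : gtI g Z' ≤ gtI g Z := h
          change (Z : Set Y) ⊆ Z'
          rw [← gt_closed_eq g hg Z' Z'.3]
          intro y hy f hf
          exact (gtI_mem _ _ _).1 (h' hf) y hy
        · intro h
          exact gtI_anti g h }
  rw [topologicalKrullDim, Order.krullDim_eq_of_orderIso e, Order.krullDim_orderDual,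
    ringKrullDim_quotient]

theorem gt_component {k σ : Type*} [Field k] [IsAlgClosed k] [Finite σ]
    (I : Ideal (MvPolynomial σ k)) (V : Set (σ → k)) (hV : MvPolynomial.zeroLocus k I = V)
    (C : Set V) (hC : C ∈ zComponents k σ V) :
    ∃ p ∈ I.minimalPrimes, zKrullDimSub k σ C = ringKrullDim (MvPolynomial σ k ⧸ p) := by
  let τ : TopologicalSpace V := TopologicalSpace.induced Subtype.val (zariskiTopology k σ)
  have hg : GTClosed (Y := V) (Subtype.val : V → (σ → k)) := fun Z => gt_zariski_isClosed _ Z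
  have hC' : C ∈ irreducibleComponents V := hC
  have hCc : IsClosed C := isClosed_of_mem_irreducibleComponents C hC'
  have hprime := (gt_irr _ hg C).1 hC'.1
  have hIle : ∀ Z : Set V, I ≤ gtI (Subtype.val : V → (σ → k)) Z := by
    intro Z f hf
    rw [gtI_mem]
    intro y _
    have : (y : σ → k) ∈ MvPolynomial.zeroLocus k I := by rw [hV]; exact y.2
    have := this f hf
    rwa [MvPolynomial.aeval_eq_eval] at this
  have hsub : ∀ q : Ideal (MvPolynomial σ k), I ≤ q →
      MvPolynomial.zeroLocus k q ⊆ Set.range (Subtype.val : V → (σ → k)) := by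
    intro q hq
    rw [Subtype.range_coe, ← hV]
    exact MvPolynomial.zeroLocus_anti_mono hq
  refine ⟨gtI Subtype.val C, ⟨⟨hprime, hIle _⟩, ?_⟩, ?_⟩
  · rintro q ⟨hq, hIq⟩ hqp
    have hnull := gt_null (Subtype.val : V → (σ → k)) q (hsub q hIq)
    have hW := (gt_irr _ hg {y : V | ∀ f ∈ q, MvPolynomial.eval (y : σ → k) f = 0}).2
      (by rw [hnull]; exact hq)
    have := hC'.2 hW (by
      intro y hy f hf
      exact (gtI_mem _ _ _).1 (hqp hf) y hy)
    rw [← hnull]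
    exact gtI_anti _ this
  · rw [zKrullDimSub]
    rw [induced_compose]
    let τ' : TopologicalSpace C := TopologicalSpace.induced
      ((Subtype.val : V → (σ → k)) ∘ (Subtype.val : C → V)) (zariskiTopology k σ)
    refine gt_topdim (Y := C) ((Subtype.val : V → (σ → k)) ∘ (Subtype.val : C → V))
      (fun Z => gt_zariski_isClosed _ Z) _ ?_ hprime
    rw [Set.range_comp, Subtype.range_coe]
    ext x
    constructor
    · intro hx
      obtain ⟨y, rfl⟩ := hsub _ (hIle C) hx
      refine ⟨y, ?_, rfl⟩
      rw [← gt_closed_eq _ hg C hCc]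
      intro f hf
      have := hx f hf
      rwa [MvPolynomial.aeval_eq_eval] at this
    · rintro ⟨y, hy, rfl⟩ f hf
      rw [MvPolynomial.aeval_eq_eval]
      exact (gtI_mem _ _ _).1 hf y hy

theorem gt_final_arith (n : ℕ) (d : WithBot ℕ∞) (c : ℕ) (hc : 2 * c ≤ n * (n + 1))
    (h1 : d ≤ (n * (n - 1) / 2 : ℕ)) (h2 : ((n * n : ℕ) : WithBot ℕ∞) ≤ d + c) :
    d = ((n * (n - 1) / 2 : ℕ) : WithBot ℕ∞) := by
  refine le_antisymm h1 ?_
  induction d with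
  | bot =>
    rw [WithBot.bot_add, le_bot_iff] at h2
    exact absurd h2 (WithBot.coe_ne_bot (a := ((n * n : ℕ) : ℕ∞)))
  | coe d =>
    have h1' : d ≤ ((n * (n - 1) / 2 : ℕ) : ℕ∞) := by exact_mod_cast h1
    obtain ⟨m, rfl⟩ := ENat.ne_top_iff_exists.1
      (ne_top_of_le_ne_top (ENat.coe_ne_top _) h1')
    have h2' : n * n ≤ m + c := by exact_mod_cast h2
    have h3 : n * (n - 1) / 2 ≤ m := by
      rw [Nat.mul_sub, mul_one]
      have h4 : n * (n + 1) = n * n + n := by ring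
      rw [h4] at hc
      omega
    exact_mod_cast h3

theorem gt_card (n : ℕ) : 2 * Fintype.card ((i : Fin (n + 1)) × Fin i) ≤ n * (n + 1) := by
  rw [Fintype.card_sigma]
  simp only [Fintype.card_fin]
  rw [Fin.sum_univ_eq_sum_range (fun i => i) (n + 1), mul_comm 2, Finset.sum_range_id_mul_two]
  simp [mul_comm]

/-- **Ovsienko's Theorem.** The Gelfand–Tsetlin variety for `gl_n` is equidimensional of
dimension `n(n-1)/2`. -/
theorem ovsienko_theorem (k : Type*) [Field k] [IsAlgClosed k] [CharZero k]
    (n : ℕ) (hn : 1 ≤ n) :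
    IsEquidimOfDim k (Fin n × Fin n) (GTgl k n) (n * (n - 1) / 2) := by
  intro C hC
  let G : ((i : Fin (n + 1)) × Fin i) → MvPolynomial (Fin n × Fin n) k :=
    fun t => gtGen k n t.1 (Nat.lt_succ_iff.1 t.1.2) (t.2 + 1)
  let s : Finset (MvPolynomial (Fin n × Fin n) k) := Finset.univ.image G
  have hGs : ∀ i hi j, 1 ≤ j → j ≤ i → gtGen k n i hi j ∈ s := by
    intro i hi j hj hji
    rw [Finset.mem_image]
    refine ⟨⟨⟨i, by omega⟩, ⟨j - 1, by simp only; omega⟩⟩, Finset.mem_univ _, ?_⟩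
    simp only [G]
    congr 1
    omega
  have hV : MvPolynomial.zeroLocus k (Ideal.span (s : Set (MvPolynomial (Fin n × Fin n) k))) =
      GTgl k n := by
    have hev : ∀ (x : Fin n × Fin n → k) i hi j,
        MvPolynomial.aeval x (gtGen k n i hi j) = Matrix.trace ((Matrix.of fun a b : Fin i =>
          x (Fin.castLE hi a, Fin.castLE hi b)) ^ j) := by
      intro x i hi j
      have := gtGen_map n i hi j (MvPolynomial.eval x)
      rw [MvPolynomial.aeval_eq_eval]
      simpa using this
    rw [MvPolynomial.zeroLocus_span]
    ext x
    constructor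
    · intro hx i hi j hj hji
      rw [← hev]
      exact hx _ (hGs i hi j hj hji)
    · intro hx f hf
      obtain ⟨t, -, rfl⟩ := Finset.mem_image.1 (Finset.mem_coe.1 hf)
      simp only [G]
      rw [hev]
      exact hx _ _ _ (by omega) (by omega)
  obtain ⟨p, hp, hdim⟩ := gt_component _ _ hV C hC
  have hpp : p.IsPrime := hp.1.1
  rw [hdim]
  refine gt_final_arith n _ s.card ?_ ?_ ?_
  · refine le_trans ?_ (gt_card n)
    have := Finset.card_image_le (s := Finset.univ) (f := G)
    rw [Finset.card_univ] at this
    exact Nat.mul_le_mul_left 2 this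
  · exact gt_upper n p fun i hi j hj hji => hp.1.2 (Ideal.subset_span (hGs i hi j hj hji))
  · have := gt_lower s p hp
    simpa using this

end
end

section
/- For every integer n ≥ 1, the variety V_n, defined as the common zero set of the polynomials σ_{n2}, σ_{n3}, …, σ_{nn} in affine space k^{(n+2)(n−1)/2}, is equidimensional of dimension n(n−1)/2, i.e., every irreducible component of V_n has Krull dimension n(n−1)/2. -/
open scoped Classical

noncomputable section

/-- The index set of the `(n+2)(n-1)/2` variables `X_{st}` (`n ≥ s > t ≥ 1`) together with
`X_{tn}` (`1 ≤ t ≤ n-1`); here indices are `0`-based, so `(a, b)` records the variable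
`X_{a+1, b+1}` and the second alternative `a < b ∧ b = n-1` records the variables `X_{t n}`. -/
def LowIdx (n : ℕ) : Type := {q : Fin n × Fin n // q.2 < q.1 ∨ (q.1 < q.2 ∧ (q.2 : ℕ) = n - 1)}

/-- Extension by zero of a point of the affine space indexed by `LowIdx n` to a full
`n × n` array of coordinates. -/
def extendPt {k : Type*} [CommRing k] (n : ℕ) (x : LowIdx n → k) (a b : Fin n) : k :=
  if h : b < a ∨ (a < b ∧ (b : ℕ) = n - 1) then x ⟨(a, b), h⟩ else 0

/-- The variety `V_n`: the common zero set of the polynomials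
`σ_{nj} = Σ_{n > t₁ > ⋯ > t_{j-1} ≥ 1} X_{n t₁} X_{t₁ t₂} ⋯ X_{t_{j-2} t_{j-1}} X_{t_{j-1} n}`
for `j = 2, …, n`.  Here the chain `t` is encoded (0-based) as a strictly decreasing function
`Fin (j-1) → Fin n` avoiding the last index. -/
def Vweak (k : Type*) [CommRing k] (n : ℕ) : Set (LowIdx n → k) :=
  {x | ∀ (j : ℕ) (hj2 : 2 ≤ j) (hjn : j ≤ n),
    (∑ t : Fin (j - 1) → Fin n,
      if StrictAnti t ∧ ∀ l, (t l : ℕ) < n - 1 then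
        extendPt n x ⟨n - 1, by omega⟩ (t ⟨0, by omega⟩) *
        (∏ l ∈ Finset.range (j - 2),
          extendPt n x (t ⟨l % (j - 1), Nat.mod_lt _ (by omega)⟩)
            (t ⟨(l + 1) % (j - 1), Nat.mod_lt _ (by omega)⟩)) *
        extendPt n x (t ⟨j - 2, by omega⟩) ⟨n - 1, by omega⟩
      else 0) = 0}

theorem dim_integral (R S : Type*) [CommRing R] [CommRing S] [Algebra R S]
    [Algebra.IsIntegral R S] [FaithfulSMul R S] : ringKrullDim S = ringKrullDim R := by
  apply le_antisymm
  · refine Order.krullDim_le_of_strictMono (PrimeSpectrum.comap (algebraMap R S)) ?_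
    intro I J h
    exact Ideal.IsIntegral.comap_lt_comap (R := R) (I := I.asIdeal) (J := J.asIdeal) h
  · refine iSup_le fun l => ?_
    obtain ⟨⟨Q, hQ1, hQ2⟩⟩ := Ideal.nonempty_primesOver (S := S) (RelSeries.head l).asIdeal
    obtain ⟨M, h1, -, -⟩ := Ideal.exists_ltSeries_of_hasGoingUp (S := S) l Q
    rw [← h1]
    exact le_iSup (fun p : LTSeries (PrimeSpectrum S) => ((p.length : ℕ∞) : WithBot ℕ∞)) M

theorem dim_trdeg (k A : Type*) [Field k] [CommRing A] [IsDomain A] [Algebra k A]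
    [Algebra.FiniteType k A] (d : ℕ) (h : Algebra.trdeg k A = d) : ringKrullDim A = d := by
  obtain ⟨s, g, hg, hi⟩ := exists_integral_inj_algHom_of_fg k A
  algebraize [g.toRingHom]
  have hinj : Function.Injective (algebraMap (MvPolynomial (Fin s) k) A) := hg
  have : FaithfulSMul (MvPolynomial (Fin s) k) A :=
    (faithfulSMul_iff_algebraMap_injective _ _).2 hinj
  have : Algebra.IsIntegral (MvPolynomial (Fin s) k) A := ⟨hi⟩
  rw [dim_integral (MvPolynomial (Fin s) k) A]
  have : IsScalarTower k (MvPolynomial (Fin s) k) A :=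
    IsScalarTower.of_algebraMap_eq' (by ext x; exact (g.commutes x).symm)
  have key := lift_trdeg_add_eq k (MvPolynomial (Fin s) k) A
  rw [trdeg_eq_zero (R := MvPolynomial (Fin s) k) (A := A), h] at key
  simp at key
  have hs : s = d := by exact_mod_cast key
  simp [hs]

theorem dim_range {k σ τ : Type*} [Field k] [Finite σ] [Fintype τ]
    (φ : MvPolynomial σ k →ₐ[k] MvPolynomial τ k)
    [Algebra.IsAlgebraic φ.range (MvPolynomial τ k)] :
    ringKrullDim (MvPolynomial σ k ⧸ RingHom.ker φ) = Fintype.card τ := by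
  have e := Ideal.quotientKerEquivRange φ
  rw [ringKrullDim_eq_of_ringEquiv e.toRingEquiv]
  have : Algebra.FiniteType k φ.range :=
    Algebra.FiniteType.of_surjective φ.rangeRestrict φ.rangeRestrict_surjective
  apply dim_trdeg k
  have key := lift_trdeg_add_eq k φ.range (MvPolynomial τ k)
  rw [trdeg_eq_zero (R := φ.range)] at key
  simpa using key

theorem irr_preimage {X Y : Type*} [TopologicalSpace X] [TopologicalSpace Y] [JacobsonSpace X]
    (g : Y → X) (hc : closedPoints X ⊆ Set.range g)
    (c : Set X) (h1 : IsClosed c) :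
    closure (g '' (g ⁻¹' c)) = c := by
  apply subset_antisymm
  · exact closure_minimal (Set.image_preimage_subset _ _) h1
  · conv_lhs => rw [← JacobsonSpace.closure_inter_closedPoints h1]
    apply closure_mono
    rw [Set.image_preimage_eq_inter_range]
    exact Set.inter_subset_inter_right _ hc

theorem irr_preimage' {X Y : Type*} [TopologicalSpace X] [TopologicalSpace Y] [JacobsonSpace X]
    (g : Y → X) (hg : Topology.IsInducing g) (hc : closedPoints X ⊆ Set.range g)
    (c : Set X) (h1 : IsClosed c) (h2 : IsIrreducible c) :
    IsIrreducible (g ⁻¹' c) := by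
  rw [← irr_preimage g hc c h1, isIrreducible_iff_closure] at h2
  refine ⟨h2.1.of_image, ?_⟩
  intro u v hu hv
  obtain ⟨u', hu', rfl⟩ := hg.isOpen_iff.1 hu
  obtain ⟨v', hv', rfl⟩ := hg.isOpen_iff.1 hv
  rintro ⟨x, hx, hxu⟩ ⟨y, hy, hyv⟩
  obtain ⟨_, ⟨z, hz, rfl⟩, hzz⟩ := h2.2 u' v' hu' hv' ⟨g x, ⟨x, hx, rfl⟩, hxu⟩ ⟨g y, ⟨y, hy, rfl⟩, hyv⟩
  exact ⟨z, hz, hzz⟩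

theorem dim_jacobson {X Y : Type*} [TopologicalSpace X] [TopologicalSpace Y] [JacobsonSpace X]
    (g : Y → X) (hg : Topology.IsInducing g) (hc : closedPoints X ⊆ Set.range g) :
    topologicalKrullDim Y = topologicalKrullDim X := by
  apply le_antisymm hg.topologicalKrullDim_le
  refine Order.krullDim_le_of_strictMono (fun c => ⟨g ⁻¹' c,
    irr_preimage' g hg hc c c.isClosed c.isIrreducible, c.isClosed.preimage hg.continuous⟩) ?_
  refine Monotone.strictMono_of_injective (fun a b h x hx => h hx) ?_
  intro a b h
  have h' : g ⁻¹' (a : Set X) = g ⁻¹' (b : Set X) :=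
    congrArg (fun c : TopologicalSpace.IrreducibleCloseds Y => (c : Set Y)) h
  apply SetLike.coe_injective
  rw [← irr_preimage g hc a a.isClosed, h', irr_preimage g hc b b.isClosed]

theorem zariski_eq (k σ : Type*) [Field k] :
    zariskiTopology k σ = TopologicalSpace.induced
      (MvPolynomial.pointToPoint (k := k) (K := k) (σ := σ)) inferInstance := by
  rw [PrimeSpectrum.isTopologicalBasis_basic_opens.eq_generateFrom, induced_generateFrom_eq]
  unfold zariskiTopology
  congr 1
  ext U
  simp only [Set.mem_ofPred_eq, Set.mem_image, Set.mem_range, exists_exists_eq_and]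
  constructor
  · rintro ⟨f, rfl⟩
    refine ⟨f, ?_⟩
    ext x
    simp [MvPolynomial.pointToPoint, MvPolynomial.aeval_eq_eval]
  · rintro ⟨f, rfl⟩
    refine ⟨f, ?_⟩
    ext x
    simp [MvPolynomial.pointToPoint, MvPolynomial.aeval_eq_eval]

/-- the space C -> Spec (R/P). -/
def specMap {k σ : Type*} [Field k] (P : Ideal (MvPolynomial σ k))
    (x : σ → k) (hx : x ∈ MvPolynomial.zeroLocus k P) :
    PrimeSpectrum (MvPolynomial σ k ⧸ P) :=
  ⟨RingHom.ker (Ideal.Quotient.lift P (MvPolynomial.eval x)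
    (fun p hp => by simpa [MvPolynomial.aeval_eq_eval] using hx p hp)), RingHom.ker_isPrime _⟩

theorem comap_specMap {k σ : Type*} [Field k] (P : Ideal (MvPolynomial σ k))
    (x : σ → k) (hx : x ∈ MvPolynomial.zeroLocus k P) :
    PrimeSpectrum.comap (Ideal.Quotient.mk P) (specMap P x hx) = MvPolynomial.pointToPoint x := by
  ext p
  simp [specMap, MvPolynomial.pointToPoint, MvPolynomial.aeval_eq_eval, RingHom.mem_ker]
  rfl

theorem specMap_range {k σ : Type*} [Field k] [IsAlgClosed k] [Finite σ]
    (P : Ideal (MvPolynomial σ k)) (q : PrimeSpectrum (MvPolynomial σ k ⧸ P))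
    (hq : q ∈ closedPoints _) : ∃ x hx, specMap P x hx = q := by
  rw [mem_closedPoints_iff, PrimeSpectrum.isClosed_singleton_iff_isMaximal] at hq
  have hm : (q.asIdeal.comap (Ideal.Quotient.mk P)).IsMaximal :=
    Ideal.comap_isMaximal_of_surjective _ Ideal.Quotient.mk_surjective
  obtain ⟨x, hx⟩ := MvPolynomial.isMaximal_iff_eq_vanishingIdeal_singleton.1 hm
  have hxP : x ∈ MvPolynomial.zeroLocus k P := by
    intro p hp
    rw [← MvPolynomial.mem_vanishingIdeal_singleton_iff, ← hx, Ideal.mem_comap,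
      Ideal.Quotient.eq_zero_iff_mem.2 hp]
    exact zero_mem _
  refine ⟨x, hxP, ?_⟩
  apply PrimeSpectrum.comap_injective_of_surjective _ (Ideal.Quotient.mk_surjective (I := P))
  rw [comap_specMap]
  ext1
  exact hx.symm

theorem specMap_inducing {k σ : Type*} [Field k] (P : Ideal (MvPolynomial σ k))
    {Y : Type*} [t : TopologicalSpace Y] (e : Y → σ → k)
    (he : t = TopologicalSpace.induced e (zariskiTopology k σ))
    (hY : ∀ y, e y ∈ MvPolynomial.zeroLocus k P) :
    Topology.IsInducing (fun y => specMap P (e y) (hY y)) := by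
  have h1 := (PrimeSpectrum.isClosedEmbedding_comap_of_surjective _ (Ideal.Quotient.mk P)
    Ideal.Quotient.mk_surjective).isInducing
  rw [← h1.of_comp_iff]
  refine ⟨?_⟩
  rw [he, zariski_eq, induced_compose]
  congr 1
  ext1 y
  exact (comap_specMap P _ _).symm

theorem equidim_of_cover {k σ : Type*} [Field k] [IsAlgClosed k] [Finite σ]
    (V : Set (σ → k)) (d : ℕ) (hV : ∃ I : Ideal (MvPolynomial σ k), V = MvPolynomial.zeroLocus k I)
    {ι : Type} [Finite ι] {τ : Type} [Fintype τ] (hd : Fintype.card τ = d)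
    (φ : ι → MvPolynomial σ k →ₐ[k] MvPolynomial τ k)
    (ha : ∀ s, Algebra.IsAlgebraic (φ s).range (MvPolynomial τ k))
    (hc : ∀ x, x ∈ V ↔ ∃ s, ∃ y : τ → k, ∀ i, x i = MvPolynomial.eval y (φ s (MvPolynomial.X i))) :
    IsEquidimOfDim k σ V d := by
  intro C hC
  unfold zComponents at hC
  unfold zKrullDimSub
  letI tV : TopologicalSpace V := TopologicalSpace.induced Subtype.val (zariskiTopology k σ)
  let P : ι → Ideal (MvPolynomial σ k) := fun s => RingHom.ker (φ s)
  have hPp : ∀ s, (P s).IsPrime := fun s => RingHom.ker_isPrime _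
  have hev : ∀ s (y : τ → k) (x : σ → k), (∀ i, x i = MvPolynomial.eval y (φ s (MvPolynomial.X i))) →
      ∀ p, MvPolynomial.eval x p = MvPolynomial.eval y (φ s p) := by
    intro s y x h p
    have : (MvPolynomial.aeval x : MvPolynomial σ k →ₐ[k] k) = (MvPolynomial.aeval y).comp (φ s) := by
      ext i
      simp [h, MvPolynomial.aeval_eq_eval]
    have := DFunLike.congr_fun this p
    simpa [MvPolynomial.aeval_eq_eval] using this
  have hZV : ∀ s, MvPolynomial.zeroLocus k (P s) ⊆ V := by
    obtain ⟨I, rfl⟩ := hV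
    intro s
    apply MvPolynomial.zeroLocus_anti_mono
    intro p hp
    change φ s p = 0
    apply MvPolynomial.funext
    intro y
    rw [map_zero, ← hev s y (fun i => MvPolynomial.eval y (φ s (MvPolynomial.X i))) (fun _ => rfl)]
    have := (hc (fun i => MvPolynomial.eval y (φ s (MvPolynomial.X i)))).2 ⟨s, y, fun _ => rfl⟩
    simpa [MvPolynomial.aeval_eq_eval] using this p hp
  let T : ι → Set V := fun s => {x | x.1 ∈ MvPolynomial.zeroLocus k (P s)}
  have hind : ∀ s, Topology.IsInducing (fun y : T s => specMap (P s) y.1.1 y.2) := fun s =>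
    specMap_inducing (P s) (fun y : T s => y.1.1) (induced_compose (f := (Subtype.val : T s → V)) (g := (Subtype.val : V → σ → k))) _
  have hcl : ∀ s, closedPoints (PrimeSpectrum (MvPolynomial σ k ⧸ P s)) ⊆
      Set.range (fun y : T s => specMap (P s) y.1.1 y.2) := by
    intro s q hq
    obtain ⟨x, hx, rfl⟩ := specMap_range (P s) q hq
    exact ⟨⟨⟨x, hZV s hx⟩, hx⟩, rfl⟩
  have hirr : ∀ s, IsIrreducible (T s) := by
    intro s
    have h1 := irr_preimage' _ (hind s) (hcl s) Set.univ isClosed_univ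
      (IrreducibleSpace.isIrreducible_univ _)
    have h2 := h1.image (Subtype.val : T s → V) continuous_subtype_val.continuousOn
    simpa using h2
  have hclosed : ∀ s, IsClosed (T s) := by
    intro s
    have : T s = (fun x : V => (MvPolynomial.pointToPoint x.1 : PrimeSpectrum (MvPolynomial σ k))) ⁻¹'
        (PrimeSpectrum.zeroLocus (P s)) := by
      ext x
      simp only [T, Set.mem_ofPred_eq, Set.mem_preimage, PrimeSpectrum.mem_zeroLocus,
        MvPolynomial.mem_zeroLocus_iff, MvPolynomial.pointToPoint]
      constructor
      · intro h p hp
        exact (MvPolynomial.mem_vanishingIdeal_singleton_iff _ _).2 (h p hp)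
      · intro h p hp
        exact (MvPolynomial.mem_vanishingIdeal_singleton_iff _ _).1 (h hp)
    rw [this]
    apply (PrimeSpectrum.isClosed_zeroLocus _).preimage
    have : Topology.IsInducing (fun x : V =>
        (MvPolynomial.pointToPoint x.1 : PrimeSpectrum (MvPolynomial σ k))) := by
      refine ⟨?_⟩
      change TopologicalSpace.induced Subtype.val (zariskiTopology k σ) = _
      rw [zariski_eq, induced_compose]
      rfl
    exact this.continuous
  have hcov : C ⊆ ⋃₀ (Set.range T) := by
    intro x _
    obtain ⟨s, y, h⟩ := (hc x.1).1 x.2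
    refine ⟨T s, ⟨s, rfl⟩, ?_⟩
    intro p hp
    rw [MvPolynomial.aeval_eq_eval]
    change MvPolynomial.eval _ _ = 0
    rw [hev s y x.1 h p, show φ s p = 0 from hp, map_zero]
  have hCi : IsIrreducible C := hC.1
  obtain ⟨_, hs, hCT⟩ := isIrreducible_iff_sUnion_isClosed.1 hCi
    (Set.finite_range T).toFinset (by simpa using hclosed) (by simpa using hcov)
  obtain ⟨s, rfl⟩ : ∃ s, T s = _ := by simpa using hs
  have hCe : C = T s := subset_antisymm hCT (hC.2 (hirr s) hCT)
  subst hCe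
  have := ha s
  rw [← hd]
  exact (dim_jacobson _ (hind s) (hcl s)).trans
    ((PrimeSpectrum.topologicalKrullDim_eq_ringKrullDim _).trans (dim_range (φ s)))

/-- The variety in matrix form. -/
def isV {A : Type*} [CommRing A] {m : ℕ} (L : Matrix (Fin m) (Fin m) A) (u v : Fin m → A) : Prop :=
  (∀ i j, i ≤ j → L i j = 0) ∧ ∀ r : ℕ, u ⬝ᵥ ((L ^ r).mulVec v) = 0

/-- Lower triangular block extension. -/
def blkL {A : Type*} [CommRing A] {m : ℕ} (c : Fin m → A) (L : Matrix (Fin m) (Fin m) A) :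
    Matrix (Fin (m + 1)) (Fin (m + 1)) A :=
  fun i j => Fin.cases 0 (fun i' => Fin.cases (c i') (fun j' => L i' j') j) i

theorem blkL_zero {A : Type*} [CommRing A] {m : ℕ} (c : Fin m → A) (L : Matrix (Fin m) (Fin m) A) (j) :
    blkL c L 0 j = 0 := rfl

theorem blkL_succ_zero {A : Type*} [CommRing A] {m : ℕ} (c : Fin m → A)
    (L : Matrix (Fin m) (Fin m) A) (i : Fin m) :
    blkL c L i.succ 0 = c i := rfl

theorem blkL_succ_succ {A : Type*} [CommRing A] {m : ℕ} (c : Fin m → A)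
    (L : Matrix (Fin m) (Fin m) A) (i j : Fin m) :
    blkL c L i.succ j.succ = L i j := rfl

theorem blkL_mulVec {A : Type*} [CommRing A] {m : ℕ} (c : Fin m → A)
    (L : Matrix (Fin m) (Fin m) A) (a : A) (v : Fin m → A) :
    (blkL c L).mulVec (Fin.cons a v) = Fin.cons 0 (a • c + L.mulVec v) := by
  ext i
  refine Fin.cases ?_ (fun i => ?_) i
  · simp [Matrix.mulVec, dotProduct, blkL_zero]
  · simp [Matrix.mulVec, dotProduct, blkL_succ_zero, blkL_succ_succ, Fin.sum_univ_succ, mul_comm]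

theorem blkL_pow_mulVec {A : Type*} [CommRing A] {m : ℕ} (c : Fin m → A)
    (L : Matrix (Fin m) (Fin m) A) (v : Fin m → A) (r : ℕ) :
    ((blkL c L) ^ r).mulVec (Fin.cons 0 v : Fin (m + 1) → A) = Fin.cons 0 ((L ^ r).mulVec v) := by
  induction r with
  | zero => simp
  | succ r ih =>
    rw [pow_succ', ← Matrix.mulVec_mulVec, ih, blkL_mulVec, pow_succ', ← Matrix.mulVec_mulVec]
    simp

theorem cons_dot {A : Type*} [CommRing A] {m : ℕ} (p a : A) (u v : Fin m → A) :
    (Fin.cons p u : Fin (m + 1) → A) ⬝ᵥ (Fin.cons a v : Fin (m + 1) → A) = p * a + u ⬝ᵥ v := by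
  simp [dotProduct, Fin.sum_univ_succ]

theorem isV_blk {A : Type*} [CommRing A] {m : ℕ} (c : Fin m → A)
    (L : Matrix (Fin m) (Fin m) A) (p a : A) (u v : Fin m → A) :
    isV (blkL c L) (Fin.cons p u) (Fin.cons a v) ↔ (∀ i j, i ≤ j → L i j = 0) ∧
      p * a + u ⬝ᵥ v = 0 ∧ ∀ r : ℕ, u ⬝ᵥ ((L ^ r).mulVec (a • c + L.mulVec v)) = 0 := by
  have h : ∀ r : ℕ, (Fin.cons p u : Fin (m + 1) → A) ⬝ᵥ
      (((blkL c L) ^ (r + 1)).mulVec (Fin.cons a v : Fin (m + 1) → A)) =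
      u ⬝ᵥ ((L ^ r).mulVec (a • c + L.mulVec v)) := by
    intro r
    rw [pow_succ, ← Matrix.mulVec_mulVec, blkL_mulVec, blkL_pow_mulVec, cons_dot]
    simp
  constructor
  · rintro ⟨h1, h2⟩
    refine ⟨fun i j hij => ?_, ?_, fun r => ?_⟩
    · exact h1 i.succ j.succ (by simpa using hij)
    · simpa [cons_dot] using h2 0
    · rw [← h]; exact h2 (r + 1)
  · rintro ⟨h1, h2, h3⟩
    refine ⟨fun i j => ?_, fun r => ?_⟩
    · refine Fin.cases (fun _ => rfl) (fun i => ?_) i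
      refine Fin.cases (fun h => ?_) (fun j h => ?_) j
      · simp at h
      · exact h1 i j (by simpa using h)
    · cases r with
      | zero => simpa [cons_dot] using h2
      | succ r => rw [h]; exact h3 r

theorem isV_step {k : Type*} [Field k] {m : ℕ} (L0 : Matrix (Fin (m + 1)) (Fin (m + 1)) k)
    (u0 v0 : Fin (m + 1) → k) :
    isV L0 u0 v0 ↔
    (∃ p c L u v, isV (m := m) L u v ∧ L0 = blkL c L ∧ u0 = Fin.cons p u ∧ v0 = Fin.cons 0 v) ∨
    (∃ a w L u v, isV (m := m) L u v ∧ L0 = blkL (v - L.mulVec w) L ∧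
      u0 = Fin.cons (-(u ⬝ᵥ w)) u ∧ v0 = Fin.cons a (a • w)) := by
  constructor
  · intro h
    obtain ⟨c, L, rfl⟩ : ∃ c L, L0 = blkL c L := by
      refine ⟨fun i => L0 i.succ 0, fun i j => L0 i.succ j.succ, ?_⟩
      ext i j
      refine Fin.cases ?_ (fun i => ?_) i
      · exact h.1 0 j (Fin.zero_le _)
      · exact Fin.cases rfl (fun j => rfl) j
    obtain ⟨p, u, rfl⟩ : ∃ p u, u0 = Fin.cons p u := ⟨u0 0, Fin.tail u0, (Fin.cons_self_tail u0).symm⟩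
    obtain ⟨a, v, rfl⟩ : ∃ p u, v0 = Fin.cons p u := ⟨v0 0, Fin.tail v0, (Fin.cons_self_tail v0).symm⟩
    rw [isV_blk] at h
    obtain ⟨h1, h2, h3⟩ := h
    by_cases ha : a = 0
    · subst ha
      refine Or.inl ⟨p, c, L, u, v, ⟨h1, fun r => ?_⟩, rfl, rfl, rfl⟩
      cases r with
      | zero => simpa using h2
      | succ r => simpa [pow_succ, ← Matrix.mulVec_mulVec] using h3 r
    · refine Or.inr ⟨a, a⁻¹ • v, L, u, c + L.mulVec (a⁻¹ • v), ⟨h1, fun r => ?_⟩, ?_, ?_, ?_⟩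
      · have := h3 r
        have e : a • c + L.mulVec v = a • (c + L.mulVec (a⁻¹ • v)) := by
          rw [Matrix.mulVec_smul, smul_add, smul_smul, mul_inv_cancel₀ ha, one_smul]
        rw [e, Matrix.mulVec_smul, dotProduct_smul, smul_eq_mul] at this
        exact (mul_eq_zero.1 this).resolve_left ha
      · simp
      · congr 1
        rw [dotProduct_smul, smul_eq_mul]
        field_simp
        linear_combination h2
      · rw [smul_smul, mul_inv_cancel₀ ha, one_smul]
  · rintro (⟨p, c, L, u, v, ⟨h1, h2⟩, rfl, rfl, rfl⟩ | ⟨a, w, L, u, v, ⟨h1, h2⟩, rfl, rfl, rfl⟩)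
    · rw [isV_blk]
      refine ⟨h1, by simpa using h2 0, fun r => ?_⟩
      simpa [pow_succ, ← Matrix.mulVec_mulVec] using h2 (r + 1)
    · rw [isV_blk]
      refine ⟨h1, by simp [mul_comm], fun r => ?_⟩
      have e : a • (v - L.mulVec w) + L.mulVec (a • w) = a • v := by
        rw [Matrix.mulVec_smul, smul_sub]; abel
      rw [e, Matrix.mulVec_smul, dotProduct_smul, h2, smul_zero]

theorem alg_trans {R S : Type*} [CommRing R] [CommRing S] [IsDomain R] [IsDomain S] [Algebra R S]
    (s : S) (h : IsAlgebraic (Subalgebra.algebraicClosure R S) s) : IsAlgebraic R s :=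
  h.restrictScalars R

theorem alg_step {k κ τ : Type*} [Field k] (B : Subalgebra k (MvPolynomial (κ ⊕ τ) k))
    (h1 : ∀ i, IsAlgebraic B (MvPolynomial.X (Sum.inl i) : MvPolynomial (κ ⊕ τ) k))
    (h2 : ∀ B' : Subalgebra k (MvPolynomial τ k),
      (∀ p, p ∈ B' ↔ IsAlgebraic B (MvPolynomial.rename Sum.inr p : MvPolynomial (κ ⊕ τ) k)) →
      Algebra.IsAlgebraic B' (MvPolynomial τ k)) :
    Algebra.IsAlgebraic B (MvPolynomial (κ ⊕ τ) k) := by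
  let Q0 := Subalgebra.algebraicClosure B (MvPolynomial (κ ⊕ τ) k)
  let Q := Q0.restrictScalars k
  let ρ : MvPolynomial τ k →ₐ[k] MvPolynomial (κ ⊕ τ) k := MvPolynomial.rename Sum.inr
  have hρ : Function.Injective ρ := MvPolynomial.rename_injective _ Sum.inr_injective
  have ha := h2 (Q.comap ρ) (fun p => Iff.rfl)
  have hX : ∀ i, (MvPolynomial.X i : MvPolynomial (κ ⊕ τ) k) ∈ Q := by
    rintro (i | t)
    · exact h1 i
    · let f : Q.comap ρ →+* Q0 :=
        { toFun := fun p => ⟨ρ p.1, p.2⟩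
          map_one' := by ext1; exact map_one ρ
          map_zero' := by ext1; exact map_zero ρ
          map_mul' := fun a b => by ext1; exact map_mul ρ _ _
          map_add' := fun a b => by ext1; exact map_add ρ _ _ }
      have hf : Function.Injective f := fun a b h => Subtype.ext (hρ (congrArg Subtype.val h))
      have : IsAlgebraic Q0 ((ρ : MvPolynomial τ k →+* MvPolynomial (κ ⊕ τ) k) (MvPolynomial.X t)) :=
        (ha.isAlgebraic (MvPolynomial.X t)).ringHom_of_comp_eq f
          (ρ : MvPolynomial τ k →+* MvPolynomial (κ ⊕ τ) k) hf (RingHom.ext fun _ => rfl)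
      have h3 : IsAlgebraic B ((ρ : MvPolynomial τ k →+* MvPolynomial (κ ⊕ τ) k) (MvPolynomial.X t)) :=
        alg_trans _ this
      have h4 : (ρ : MvPolynomial τ k →+* MvPolynomial (κ ⊕ τ) k) (MvPolynomial.X t) =
        MvPolynomial.X (Sum.inr t) := by simp [ρ]
      rw [h4] at h3
      exact h3
  have hQ : Q = ⊤ := by
    rw [eq_top_iff, ← MvPolynomial.adjoin_range_X, Algebra.adjoin_le_iff]
    rintro _ ⟨i, rfl⟩
    exact hX i
  refine ⟨fun p => ?_⟩
  have : p ∈ Q := hQ ▸ Algebra.mem_top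
  exact this

theorem alg_div {R A : Type*} [CommRing R] [CommRing A] [IsDomain A] [Algebra R A]
    (B : Subalgebra R A) (a w : A) (ha : a ∈ B) (h0 : a ≠ 0) (hw : a * w ∈ B) : IsAlgebraic B w := by
  refine ⟨Polynomial.C ⟨a, ha⟩ * Polynomial.X - Polynomial.C ⟨a * w, hw⟩, fun h => h0 ?_, ?_⟩
  · have := congrArg (fun p => p.coeff 1) h
    have h2 : (⟨a, ha⟩ : B) = 0 := by simpa [Polynomial.coeff_C] using this
    exact congrArg Subtype.val h2
  · simp [Subalgebra.algebraMap_eq]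

theorem cover (k : Type*) [Field k] (m : ℕ) : ∃ (ι τ : Type) (_ : Finite ι) (_ : Fintype τ)
    (L : ι → Matrix (Fin m) (Fin m) (MvPolynomial τ k)) (u v : ι → Fin m → MvPolynomial τ k),
    Fintype.card τ = m * (m + 1) / 2 ∧
    (∀ s, ∀ B : Subalgebra k (MvPolynomial τ k), (∀ i j, L s i j ∈ B) → (∀ i, u s i ∈ B) →
      (∀ i, v s i ∈ B) → Algebra.IsAlgebraic B (MvPolynomial τ k)) ∧
    ∀ (L0 : Matrix (Fin m) (Fin m) k) (u0 v0 : Fin m → k), isV L0 u0 v0 ↔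
      ∃ s, ∃ y : τ → k, L0 = (L s).map (MvPolynomial.eval y) ∧
        u0 = (fun i => MvPolynomial.eval y (u s i)) ∧ v0 = (fun i => MvPolynomial.eval y (v s i)) := by
  induction m with
  | zero =>
    refine ⟨Unit, Empty, inferInstance, inferInstance, 0, 0, 0, rfl, ?_, ?_⟩
    · intro s B _ _ _
      refine ⟨fun p => ?_⟩
      rw [MvPolynomial.eq_C_of_isEmpty p]
      exact isAlgebraic_algebraMap (algebraMap k B _)
    · intro L0 u0 v0
      refine iff_of_true ⟨fun i => i.elim0, fun r => by simp [dotProduct]⟩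
        ⟨(), Empty.elim, ?_, ?_, ?_⟩
      all_goals exact Subsingleton.elim _ _
  | succ m ih =>
    obtain ⟨ι, τ, _, _, L, u, v, hcard, halg, hcov⟩ := ih
    let ρ : MvPolynomial τ k →ₐ[k] MvPolynomial (Fin (m + 1) ⊕ τ) k := MvPolynomial.rename Sum.inr
    let a : MvPolynomial (Fin (m + 1) ⊕ τ) k := MvPolynomial.X (Sum.inl 0)
    let w : Fin m → MvPolynomial (Fin (m + 1) ⊕ τ) k := fun i => MvPolynomial.X (Sum.inl i.succ)
    let L' : ι → Matrix (Fin m) (Fin m) (MvPolynomial (Fin (m + 1) ⊕ τ) k) := fun s => (L s).map ρ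
    let u' : ι → Fin m → MvPolynomial (Fin (m + 1) ⊕ τ) k := fun s i => ρ (u s i)
    let v' : ι → Fin m → MvPolynomial (Fin (m + 1) ⊕ τ) k := fun s i => ρ (v s i)
    have hρ : ∀ (y : Fin (m + 1) ⊕ τ → k) p, MvPolynomial.eval y (ρ p) =
      MvPolynomial.eval (y ∘ Sum.inr) p := fun y p => by simp [ρ, MvPolynomial.eval_rename]
    refine ⟨ι ⊕ ι, Fin (m + 1) ⊕ τ, inferInstance, inferInstance,
      Sum.elim (fun s => blkL w (L' s)) (fun s => blkL (v' s - (L' s).mulVec w) (L' s)),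
      Sum.elim (fun s => Fin.cons a (u' s)) (fun s => Fin.cons (-(u' s ⬝ᵥ w)) (u' s)),
      Sum.elim (fun s => Fin.cons 0 (v' s)) (fun s => Fin.cons a (a • w)), ?_, ?_, ?_⟩
    · rw [Fintype.card_sum, hcard, Fintype.card_fin]
      rw [show (m + 1) * (m + 1 + 1) = m * (m + 1) + (m + 1) * 2 by ring,
        Nat.add_mul_div_right _ _ (by norm_num)]
      ring
    · rintro (s | s) B hL hu hv
      · simp only [Sum.elim_inl] at hL hu hv
        apply alg_step
        · intro i
          refine Fin.cases ?_ (fun i => ?_) i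
          · exact isAlgebraic_algebraMap (⟨a, hu 0⟩ : B)
          · exact isAlgebraic_algebraMap (⟨w i, hL i.succ 0⟩ : B)
        · intro B' hB'
          apply halg s
          · intro i j
            rw [hB']
            exact isAlgebraic_algebraMap (⟨_, hL i.succ j.succ⟩ : B)
          · intro i
            rw [hB']
            exact isAlgebraic_algebraMap (⟨_, hu i.succ⟩ : B)
          · intro i
            rw [hB']
            exact isAlgebraic_algebraMap (⟨_, hv i.succ⟩ : B)
      · simp only [Sum.elim_inr] at hL hu hv
        have hw : ∀ i, IsAlgebraic B (w i) := fun i =>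
          alg_div B a (w i) (hv 0) (MvPolynomial.X_ne_zero _) (hv i.succ)
        have hL' : ∀ i j, IsAlgebraic B (L' s i j) := fun i j =>
          isAlgebraic_algebraMap (⟨_, hL i.succ j.succ⟩ : B)
        apply alg_step
        · intro i
          refine Fin.cases ?_ (fun i => ?_) i
          · exact isAlgebraic_algebraMap (⟨a, hv 0⟩ : B)
          · exact hw i
        · intro B' hB'
          apply halg s
          · intro i j
            rw [hB']
            exact hL' i j
          · intro i
            rw [hB']
            exact isAlgebraic_algebraMap (⟨_, hu i.succ⟩ : B)
          · intro i
            rw [hB']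
            have h1 : IsAlgebraic B ((v' s - (L' s).mulVec w) i) :=
              isAlgebraic_algebraMap (⟨_, hL i.succ 0⟩ : B)
            have h2 : IsAlgebraic B ((L' s).mulVec w i) := by
              change (∑ j, L' s i j * w j) ∈
                Subalgebra.algebraicClosure B (MvPolynomial (Fin (m + 1) ⊕ τ) k)
              exact sum_mem fun j _ => mul_mem (hL' i j) (hw j)
            have h3 := h1.add h2
            simpa using h3
    · intro L0 u0 v0
      rw [isV_step]
      have hLe : ∀ (y : Fin (m + 1) ⊕ τ → k) s, (L' s).map (MvPolynomial.eval y) =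
          (L s).map (MvPolynomial.eval (y ∘ Sum.inr)) := by
        intro y s; ext i j; exact hρ y _
      have hblk : ∀ (y : Fin (m + 1) ⊕ τ → k) (c : Fin m → MvPolynomial (Fin (m + 1) ⊕ τ) k)
          (M : Matrix (Fin m) (Fin m) (MvPolynomial (Fin (m + 1) ⊕ τ) k)), (blkL c M).map (MvPolynomial.eval y) =
          blkL (fun i => MvPolynomial.eval y (c i)) (M.map (MvPolynomial.eval y)) := by
        intro y c M; ext i j
        refine Fin.cases ?_ (fun i => ?_) i
        · simp [blkL_zero]
        · exact Fin.cases rfl (fun j => rfl) j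
      have hcons : ∀ (y : Fin (m + 1) ⊕ τ → k) p (c : Fin m → MvPolynomial (Fin (m + 1) ⊕ τ) k),
          (fun i => MvPolynomial.eval y ((Fin.cons p c : Fin (m + 1) → _) i)) =
          (Fin.cons (MvPolynomial.eval y p) (fun i => MvPolynomial.eval y (c i)) : Fin (m + 1) → k) := by
        intro y p c; ext i
        exact Fin.cases rfl (fun j => rfl) i
      have hmv : ∀ (y : Fin (m + 1) ⊕ τ → k) s i, MvPolynomial.eval y ((v' s - (L' s).mulVec w) i) =
          ((fun i => MvPolynomial.eval (y ∘ Sum.inr) (v s i)) -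
          ((L s).map (MvPolynomial.eval (y ∘ Sum.inr))).mulVec (fun i => y (Sum.inl i.succ))) i := by
        intro y s i
        simp [Matrix.mulVec, dotProduct, L', v', w, hρ]
      have hdot : ∀ (y : Fin (m + 1) ⊕ τ → k) s, MvPolynomial.eval y (-(u' s ⬝ᵥ w)) =
          -((fun i => MvPolynomial.eval (y ∘ Sum.inr) (u s i)) ⬝ᵥ (fun i => y (Sum.inl i.succ))) := by
        intro y s
        simp [dotProduct, u', w, hρ]
      rw [Sum.exists]
      refine or_congr ⟨?_, ?_⟩ ⟨?_, ?_⟩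
      · rintro ⟨p, c, L1, u1, v1, h, rfl, rfl, rfl⟩
        obtain ⟨s, y, rfl, rfl, rfl⟩ := (hcov _ _ _).1 h
        refine ⟨s, Sum.elim (Fin.cons p c) y, ?_⟩
        simp only [Sum.elim_inl, hblk, hLe, hcons, Sum.elim_comp_inr, u', v', hρ]
        simp [a, w]
      · rintro ⟨s, y, rfl, rfl, rfl⟩
        refine ⟨y (Sum.inl 0), fun i => y (Sum.inl i.succ), _, _, _,
          (hcov _ _ _).2 ⟨s, y ∘ Sum.inr, rfl, rfl, rfl⟩, ?_⟩
        simp only [Sum.elim_inl, hblk, hLe, hcons, Sum.elim_comp_inr, u', v', hρ]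
        simp [a, w]
      · rintro ⟨p, c, L1, u1, v1, h, rfl, rfl, rfl⟩
        obtain ⟨s, y, rfl, rfl, rfl⟩ := (hcov _ _ _).1 h
        refine ⟨s, Sum.elim (Fin.cons p c) y, ?_⟩
        simp only [Sum.elim_inr, hblk, hLe, hcons, hmv, hdot, Sum.elim_comp_inr]
        simp [a, w, u', hρ]
        first
          | rfl
          | exact ⟨rfl, rfl⟩
      · rintro ⟨s, y, rfl, rfl, rfl⟩
        refine ⟨y (Sum.inl 0), fun i => y (Sum.inl i.succ), _, _, _,
          (hcov _ _ _).2 ⟨s, y ∘ Sum.inr, rfl, rfl, rfl⟩, ?_⟩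
        simp only [Sum.elim_inr, hblk, hLe, hcons, hmv, hdot, Sum.elim_comp_inr]
        simp [a, w, u', hρ]
        first
          | rfl
          | exact ⟨rfl, rfl⟩

theorem path_sum {A : Type*} [CommRing A] {m : ℕ} (M : Matrix (Fin m) (Fin m) A) (v : Fin m → A)
    (r : ℕ) : ∀ u : Fin m → A,
    ∑ t : Fin (r + 1) → Fin m, u (t 0) * (∏ l : Fin r, M (t l.castSucc) (t l.succ)) *
      v (t (Fin.last r)) = u ⬝ᵥ ((M ^ r).mulVec v) := by
  induction r with
  | zero =>
    intro u
    rw [← (Equiv.funUnique (Fin 1) (Fin m)).symm.sum_comp]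
    simp [dotProduct]
  | succ r ih =>
    intro u
    rw [pow_succ', ← Matrix.mulVec_mulVec, Matrix.dotProduct_mulVec, ← ih,
      ← (Fin.consEquiv (fun _ : Fin (r + 2) => Fin m)).sum_comp, Fintype.sum_prod_type_right]
    refine Finset.sum_congr rfl fun t _ => ?_
    simp only [Fin.consEquiv_apply, Matrix.vecMul, dotProduct, Finset.sum_mul]
    refine Finset.sum_congr rfl fun a _ => ?_
    rw [Fin.prod_univ_succ]
    simp [← Fin.succ_castSucc, ← Fin.succ_last, mul_assoc]

/-- The lower triangular part. -/
def ptL {A : Type*} [CommRing A] {m : ℕ} (x : LowIdx (m + 1) → A) : Matrix (Fin m) (Fin m) A :=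
  fun i j => extendPt (m + 1) x i.castSucc j.castSucc

/-- The last row. -/
def ptU {A : Type*} [CommRing A] {m : ℕ} (x : LowIdx (m + 1) → A) : Fin m → A :=
  fun j => extendPt (m + 1) x (Fin.last m) j.castSucc

/-- The last column. -/
def ptV {A : Type*} [CommRing A] {m : ℕ} (x : LowIdx (m + 1) → A) : Fin m → A :=
  fun j => extendPt (m + 1) x j.castSucc (Fin.last m)

theorem ptL_low {A : Type*} [CommRing A] {m : ℕ} (x : LowIdx (m + 1) → A) (i j : Fin m)
    (h : i ≤ j) : ptL x i j = 0 := by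
  unfold ptL extendPt
  rw [dif_neg]
  rintro (h1 | ⟨_, h2⟩)
  · exact absurd h1 (by simpa using h)
  · have := j.2
    simp at h2
    omega

theorem low_pow {A : Type*} [CommRing A] {m : ℕ} (L : Matrix (Fin m) (Fin m) A)
    (hL : ∀ i j, i ≤ j → L i j = 0) (r : ℕ) :
    ∀ i j : Fin m, (i : ℕ) < j + r → (L ^ r) i j = 0 := by
  induction r with
  | zero =>
    intro i j h
    rw [pow_zero, Matrix.one_apply_ne]
    rintro rfl
    omega
  | succ r ih =>
    intro i j h
    rw [pow_succ, Matrix.mul_apply]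
    refine Finset.sum_eq_zero fun a _ => ?_
    by_cases ha : a ≤ j
    · rw [hL a j ha, mul_zero]
    · rw [ih i a (by rw [not_le, Fin.lt_def] at ha; omega), zero_mul]

theorem vweak_sum {A : Type*} [CommRing A] {m : ℕ} (x : LowIdx (m + 1) → A) (r : ℕ)
    (h2 : 2 ≤ r + 2) :
    (∑ t : Fin (r + 2 - 1) → Fin (m + 1),
      if StrictAnti t ∧ ∀ l, (t l : ℕ) < m + 1 - 1 then
        extendPt (m + 1) x ⟨m + 1 - 1, by omega⟩ (t ⟨0, by omega⟩) *
        (∏ l ∈ Finset.range (r + 2 - 2),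
          extendPt (m + 1) x (t ⟨l % (r + 2 - 1), Nat.mod_lt _ (by omega)⟩)
            (t ⟨(l + 1) % (r + 2 - 1), Nat.mod_lt _ (by omega)⟩)) *
        extendPt (m + 1) x (t ⟨r + 2 - 2, by omega⟩) ⟨m + 1 - 1, by omega⟩
      else 0) = ptU x ⬝ᵥ ((ptL x ^ r).mulVec (ptV x)) := by
  rw [← path_sum]
  symm
  refine Fintype.sum_of_injective (fun (t : Fin (r + 1) → Fin m) => (fun l => (t l).castSucc : Fin (r + 1) → Fin (m + 1)))
    (fun a b h => ?_) _ _ (fun t ht => ?_) (fun t => ?_)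
  · funext l
    exact Fin.castSucc_injective _ (congrFun h l)
  · rw [if_neg]
    rintro ⟨_, h⟩
    exact ht ⟨fun l => ⟨t l, h l⟩, rfl⟩
  · split_ifs with h
    · have e : ∏ l : Fin r, ptL x (t l.castSucc) (t l.succ) = ∏ l ∈ Finset.range (r + 2 - 2),
          extendPt (m + 1) x (t ⟨l % (r + 2 - 1), Nat.mod_lt _ (by omega)⟩).castSucc
            (t ⟨(l + 1) % (r + 2 - 1), Nat.mod_lt _ (by omega)⟩).castSucc := by
        change _ = ∏ l ∈ Finset.range r, _
        rw [Finset.prod_range]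
        refine Finset.prod_congr rfl fun l _ => ?_
        unfold ptL
        congr 3
        · congr 1
          ext
          have := l.2
          simp only [Fin.val_castSucc]
          rw [Nat.mod_eq_of_lt (by omega)]
        · congr 1
          ext
          have := l.2
          simp only [Fin.val_succ]
          rw [Nat.mod_eq_of_lt (by omega)]
      rw [e]
      rfl
    · have : ¬ StrictAnti t := by
        intro h'
        exact h ⟨fun a b hab => by simpa using h' hab, fun l => by simp⟩
      rw [Fin.strictAnti_iff_succ_lt] at this
      push Not at this
      obtain ⟨l, hl⟩ := this
      rw [Finset.prod_eq_zero (Finset.mem_univ l) (ptL_low x _ _ hl)]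
      simp

theorem mem_vweak {k : Type*} [CommRing k] {m : ℕ} (x : LowIdx (m + 1) → k) :
    x ∈ Vweak k (m + 1) ↔ isV (ptL x) (ptU x) (ptV x) := by
  constructor
  · intro h
    refine ⟨ptL_low x, fun r => ?_⟩
    by_cases hr : r < m
    · rw [← vweak_sum x r (by omega)]
      exact h (r + 2) (by omega) (by omega)
    · have : ptL x ^ r = 0 := by
        ext i j
        exact low_pow _ (ptL_low x) r i j (by have := i.2; omega)
      simp [this]
  · rintro ⟨_, h⟩ j hj hjn
    obtain ⟨r, rfl⟩ : ∃ r, j = r + 2 := ⟨j - 2, by omega⟩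
    exact (vweak_sum x r hj).trans (h r)

theorem extendPt_map {A B : Type*} [CommRing A] [CommRing B] (f : A →+* B) (n : ℕ)
    (x : LowIdx n → A) (a b : Fin n) : f (extendPt n x a b) = extendPt n (fun q => f (x q)) a b := by
  unfold extendPt
  split_ifs <;> simp

theorem vweak_closed (k : Type*) [Field k] (m : ℕ) : ∃ I : Ideal (MvPolynomial (LowIdx (m + 1)) k),
    Vweak k (m + 1) = MvPolynomial.zeroLocus k I := by
  let X : LowIdx (m + 1) → MvPolynomial (LowIdx (m + 1)) k := MvPolynomial.X
  refine ⟨Ideal.span (Set.range fun r : ℕ => ptU X ⬝ᵥ ((ptL X ^ r).mulVec (ptV X))), ?_⟩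
  ext x
  rw [mem_vweak, MvPolynomial.zeroLocus_span]
  have key : ∀ r : ℕ, MvPolynomial.aeval x (ptU X ⬝ᵥ ((ptL X ^ r).mulVec (ptV X))) =
      ptU x ⬝ᵥ ((ptL x ^ r).mulVec (ptV x)) := by
    intro r
    rw [← path_sum, ← path_sum, map_sum]
    simp only [map_mul, map_prod]
    have : ∀ a b, MvPolynomial.aeval x (extendPt (m + 1) X a b) = extendPt (m + 1) x a b := by
      intro a b
      have := extendPt_map (MvPolynomial.aeval x : _ →ₐ[k] k).toRingHom (m + 1) X a b
      simpa [X] using this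
    simp only [ptU, ptL, ptV, this]
  simp only [isV, Set.mem_setOf_eq, Set.forall_mem_range, key]
  exact ⟨fun h => h.2, fun h => ⟨ptL_low x, h⟩⟩

theorem ext_iff_pt {A : Type*} [CommRing A] {m : ℕ} (x y : LowIdx (m + 1) → A) :
    (∀ q, x q = y q) ↔ ptL x = ptL y ∧ ptU x = ptU y ∧ ptV x = ptV y := by
  constructor
  · intro h
    rw [funext h]
    exact ⟨rfl, rfl, rfl⟩
  · rintro ⟨h1, h2, h3⟩ ⟨⟨a, b⟩, hq⟩
    have key : extendPt (m + 1) x a b = extendPt (m + 1) y a b := by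
      refine Fin.lastCases (fun hq => ?_) (fun a hq => ?_) a hq
      · refine Fin.lastCases (fun hq => ?_) (fun b hq => ?_) b hq
        · simp at hq
        · exact congrFun h2 b
      · refine Fin.lastCases (fun hq => ?_) (fun b hq => ?_) b hq
        · exact congrFun h3 a
        · exact congrFun (congrFun h1 a) b
    unfold extendPt at key
    rwa [dif_pos hq, dif_pos hq] at key

theorem exists_pt {A : Type*} [CommRing A] {m : ℕ} (L : Matrix (Fin m) (Fin m) A) (u v : Fin m → A)
    (hL : ∀ i j, i ≤ j → L i j = 0) : ∃ x, ptL x = L ∧ ptU x = u ∧ ptV x = v := by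
  refine ⟨fun q => Fin.lastCases (Fin.lastCases 0 u q.1.2)
    (fun i => Fin.lastCases (v i) (fun j => L i j) q.1.2) q.1.1, ?_, ?_, ?_⟩
  · ext i j
    by_cases h : i ≤ j
    · rw [ptL_low _ _ _ h, hL _ _ h]
    · unfold ptL extendPt
      rw [dif_pos (Or.inl (by simpa using h))]
      simp
  · ext j
    unfold ptU extendPt
    rw [dif_pos (Or.inl (Fin.castSucc_lt_last j))]
    simp
  · ext j
    unfold ptV extendPt
    rw [dif_pos (Or.inr ⟨Fin.castSucc_lt_last j, by simp⟩)]
    simp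

theorem main_aux (k : Type*) [Field k] [IsAlgClosed k] (m : ℕ) :
    IsEquidimOfDim k (LowIdx (m + 1)) (Vweak k (m + 1)) ((m + 1) * (m + 1 - 1) / 2) := by
  obtain ⟨ι, τ, _, _, L, u, v, hcard, halg, hcov⟩ := cover k m
  haveI : Finite (LowIdx (m + 1)) := by unfold LowIdx; infer_instance
  have hL : ∀ s i j, i ≤ j → L s i j = 0 := by
    intro s i j hij
    refine MvPolynomial.funext fun y => ?_
    have := ((hcov _ _ _).2 ⟨s, y, rfl, rfl, rfl⟩).1 i j hij
    simpa using this
  choose x hx1 hx2 hx3 using fun s => exists_pt (L s) (u s) (v s) (hL s)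
  have hdim : Fintype.card τ = (m + 1) * (m + 1 - 1) / 2 := by
    rw [hcard, Nat.add_sub_cancel, mul_comm]
  refine equidim_of_cover _ _ (vweak_closed k m) hdim (fun s => MvPolynomial.aeval (x s))
    (fun s => ?_) (fun z => ?_)
  · have hr : ∀ a b, extendPt (m + 1) (x s) a b ∈ (MvPolynomial.aeval (R := k) (x s)).range := by
      intro a b
      unfold extendPt
      split_ifs with h
      · exact ⟨MvPolynomial.X ⟨(a, b), h⟩, MvPolynomial.aeval_X _ _⟩
      · exact zero_mem _
    apply halg s
    · intro i j
      rw [← hx1]; exact hr _ _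
    · intro i
      rw [← hx2]; exact hr _ _
    · intro i
      rw [← hx3]; exact hr _ _
  · rw [mem_vweak, hcov]
    refine exists_congr fun s => exists_congr fun y => ?_
    have e := ext_iff_pt z (fun q => MvPolynomial.eval y (x s q))
    have hm : ∀ a b, extendPt (m + 1) (fun q => MvPolynomial.eval y (x s q)) a b =
        MvPolynomial.eval y (extendPt (m + 1) (x s) a b) := fun a b => (extendPt_map _ _ _ _ _).symm
    have e1 : ptL (fun q => MvPolynomial.eval y (x s q)) = (L s).map (MvPolynomial.eval y) := by
      ext i j; rw [← hx1]; exact hm _ _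
    have e2 : ptU (fun q => MvPolynomial.eval y (x s q)) = fun i => MvPolynomial.eval y (u s i) := by
      ext i; rw [← hx2]; exact hm _ _
    have e3 : ptV (fun q => MvPolynomial.eval y (x s q)) = fun i => MvPolynomial.eval y (v s i) := by
      ext i; rw [← hx3]; exact hm _ _
    rw [e1, e2, e3] at e
    rw [← e]
    simp only [MvPolynomial.aeval_X]

/-- **Weak version of Ovsienko's theorem.** The variety
`V_n = V(σ_{n2}, …, σ_{nn}) ⊆ k^{(n+2)(n-1)/2}` is equidimensional of dimension
`n(n-1)/2`. -/
theorem weak_ovsienko (k : Type*) [Field k] [IsAlgClosed k] [CharZero k]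
    (n : ℕ) (hn : 1 ≤ n) :
    IsEquidimOfDim k (LowIdx n) (Vweak k n) (n * (n - 1) / 2) := by
  obtain ⟨m, rfl⟩ : ∃ m, n = m + 1 := ⟨n - 1, by omega⟩
  exact main_aux k m

end
end

section
/- Every irreducible component of the Gelfand–Tsetlin variety for gl_n that is the common zero set of a subset S of the coordinate variables {X_{ab} : 1 ≤ a,b ≤ n} satisfies |S| = n(n+1)/2; consequently every such component is a linear coordinate subspace of k^{n²} of dimension n(n−1)/2 and is isomorphic, via a linear change of coordinates, to the component V_≤ := {X ∈ k^{n²} : X_{ab} = 0 for all 1 ≤ a ≤ b ≤ n}. -/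
open scoped Classical

noncomputable section

section ZariskiAux

attribute [local instance] zariskiTopology

open MvPolynomial TopologicalSpace

theorem za_basis (k : Type*) [Field k] (σ : Type*) :
    IsTopologicalBasis {U : Set (σ → k) | ∃ f : MvPolynomial σ k, U = {x | eval x f ≠ 0}} := by
  have h := isTopologicalBasis_of_subbasis_of_inter (t := zariskiTopology k σ)
    (r := {U : Set (σ → k) | ∃ f : MvPolynomial σ k, U = {x | eval x f ≠ 0}}) rfl (by
      rintro _ ⟨f, rfl⟩ _ ⟨g, rfl⟩
      refine ⟨f * g, ?_⟩
      ext x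
      simp)
  rwa [Set.insert_eq_of_mem] at h
  exact ⟨1, by ext; simp⟩

theorem za_open (k : Type*) [Field k] (σ : Type*) (f : MvPolynomial σ k) :
    IsOpen {x : σ → k | eval x f ≠ 0} :=
  (za_basis k σ).isOpen ⟨f, rfl⟩

theorem za_aeval {k : Type*} [Field k] {σ : Type*} (f : MvPolynomial σ k) (x : σ → k) :
    aeval x f = eval x f := by
  rw [aeval_eq_eval]

theorem za_closed_zeroLocus {k : Type*} [Field k] {σ : Type*} (I : Ideal (MvPolynomial σ k)) :
    IsClosed (zeroLocus k I : Set (σ → k)) := by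
  have : (zeroLocus k I : Set (σ → k)) = ⋂ p ∈ I, {x : σ → k | eval x p ≠ 0}ᶜ := by
    ext x
    simp [za_aeval]
  rw [this]
  exact isClosed_biInter fun p _ => (za_open k σ p).isClosed_compl

theorem za_closed {k : Type*} [Field k] {σ : Type*} {Z : Set (σ → k)} (hZ : IsClosed Z) :
    zeroLocus k (vanishingIdeal k Z) = Z := by
  refine le_antisymm ?_ (zeroLocus_vanishingIdeal_le Z)
  intro x hx
  by_contra hxZ
  obtain ⟨_, ⟨f, rfl⟩, hf, hsub⟩ := (za_basis k σ).exists_subset_of_mem_open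
    (show x ∈ Zᶜ from hxZ) hZ.isOpen_compl
  refine hf ?_
  rw [← za_aeval]
  refine hx f ?_
  intro y hy
  by_contra h
  rw [za_aeval] at h
  exact hsub h hy

theorem za_irred {k : Type*} [Field k] {σ : Type*} {Z : Set (σ → k)} :
    IsIrreducible Z ↔ (vanishingIdeal k Z).IsPrime := by
  constructor
  · rintro ⟨⟨z, hz⟩, hp⟩
    refine ⟨?_, ?_⟩
    · rw [Ideal.ne_top_iff_one]
      intro h
      simpa using h z hz
    · intro f g hfg
      by_contra! hcon
      obtain ⟨hf, hg⟩ := hcon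
      simp only [mem_vanishingIdeal_iff, not_forall, za_aeval] at hf hg
      obtain ⟨x, hx, hfx⟩ := hf
      obtain ⟨y, hy, hgy⟩ := hg
      obtain ⟨w, hw, hw1, hw2⟩ := hp _ _ (za_open k σ f) (za_open k σ g) ⟨x, hx, hfx⟩ ⟨y, hy, hgy⟩
      have := hfg w hw
      rw [za_aeval, map_mul] at this
      exact mul_ne_zero hw1 hw2 this
  · intro h
    refine ⟨?_, ?_⟩
    · rw [Set.nonempty_iff_ne_empty]
      rintro rfl
      exact h.ne_top vanishingIdeal_empty
    · rintro u v hu hv ⟨x, hx, hxu⟩ ⟨y, hy, hyv⟩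
      obtain ⟨_, ⟨f, rfl⟩, hf, hfu⟩ := (za_basis k σ).exists_subset_of_mem_open hxu hu
      obtain ⟨_, ⟨g, rfl⟩, hg, hgv⟩ := (za_basis k σ).exists_subset_of_mem_open hyv hv
      by_contra hcon
      have : f * g ∈ vanishingIdeal k Z := by
        intro w hw
        by_contra hne
        rw [za_aeval, map_mul] at hne
        exact hcon ⟨w, hw, hfu (left_ne_zero_of_mul hne), hgv (right_ne_zero_of_mul hne)⟩
      rcases h.mem_or_mem this with h1 | h1
      · exact hf ((za_aeval f x).symm.trans (h1 x hx))
      · exact hg ((za_aeval g y).symm.trans (h1 y hy))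

def zaIso (k : Type*) [Field k] [IsAlgClosed k] (σ : Type*) [Finite σ] :
    IrreducibleCloseds (σ → k) ≃o (PrimeSpectrum (MvPolynomial σ k))ᵒᵈ where
  toFun Z := OrderDual.toDual ⟨vanishingIdeal k Z.carrier, za_irred.1 Z.isIrreducible'⟩
  invFun P := ⟨zeroLocus k (OrderDual.ofDual P).asIdeal, za_irred.2 (by
    have := (OrderDual.ofDual P).isPrime
    rw [IsPrime.vanishingIdeal_zeroLocus]
    exact this), za_closed_zeroLocus _⟩
  left_inv Z := by
    ext1
    exact za_closed Z.isClosed'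
  right_inv P := by
    have := (OrderDual.ofDual P).isPrime
    apply OrderDual.ofDual.injective
    ext1
    exact IsPrime.vanishingIdeal_zeroLocus _
  map_rel_iff' := by
    intro Z W
    constructor
    · intro h
      have h' : vanishingIdeal k W.carrier ≤ vanishingIdeal k Z.carrier := h
      have := zeroLocus_anti_mono (K := k) h'
      rw [za_closed Z.isClosed', za_closed W.isClosed'] at this
      exact this
    · intro h
      exact vanishingIdeal_anti_mono (show Z.carrier ≤ W.carrier from h)

theorem za_dim (k : Type*) [Field k] [IsAlgClosed k] (σ : Type*) [Finite σ] :
    topologicalKrullDim (σ → k) = (Nat.card σ : WithBot ℕ∞) := by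
  unfold topologicalKrullDim
  rw [Order.krullDim_eq_of_orderIso (zaIso k σ), Order.krullDim_orderDual]
  change ringKrullDim _ = _
  rw [MvPolynomial.ringKrullDim_of_isNoetherianRing, ringKrullDim_eq_zero_of_field, zero_add]

/-- extension by zero -/
def zaExt {k σ : Type*} [Field k] (S : Finset σ) (y : {q // q ∉ S} → k) : σ → k :=
  fun q => if h : q ∈ S then 0 else y ⟨q, h⟩

theorem za_continuous_of {k : Type*} [Field k] {σ τ : Type*} (φ : (σ → k) → (τ → k))
    (p : τ → MvPolynomial σ k) (h : ∀ x t, φ x t = eval x (p t)) : Continuous φ := by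
  refine (za_basis k τ).continuous_iff.2 ?_
  rintro _ ⟨f, rfl⟩
  have : φ ⁻¹' {x | eval x f ≠ 0} = {x | eval x (bind₁ p f) ≠ 0} := by
    ext x
    have hx : φ x = fun t => eval x (p t) := funext (h x)
    have : eval x (bind₁ p f) = eval (φ x) f := by
      rw [hx, ← za_aeval, aeval_bind₁, ← za_aeval]
      simp only [za_aeval]
    simp [this]
  rw [this]
  exact za_open k σ _

theorem zaExt_continuous {k σ : Type*} [Field k] (S : Finset σ) :
    Continuous (zaExt (k := k) S) :=
  za_continuous_of _ (fun q => if h : q ∈ S then 0 else X ⟨q, h⟩) (by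
    intro x q
    unfold zaExt
    split_ifs <;> simp)

theorem zaExt_range {k σ : Type*} [Field k] (S : Finset σ) :
    Set.range (zaExt (k := k) S) = {x | ∀ q ∈ S, x q = 0} := by
  ext x
  constructor
  · rintro ⟨y, rfl⟩ q hq
    simp [zaExt, hq]
  · intro hx
    refine ⟨fun q => x q.1, ?_⟩
    funext q
    by_cases h : q ∈ S
    · simp [zaExt, h, hx q h]
    · simp [zaExt, h]

theorem za_coord_irred {k : Type*} {σ : Type*} [Field k] [Infinite k] (S : Finset σ) :
    IsIrreducible {x : σ → k | ∀ q ∈ S, x q = 0} := by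
  rw [← zaExt_range, ← Set.image_univ]
  refine IsIrreducible.image ?_ _ (zaExt_continuous S).continuousOn
  rw [za_irred]
  have : vanishingIdeal k (Set.univ : Set ({q // q ∉ S} → k)) = ⊥ := by
    rw [eq_bot_iff]
    intro f hf
    rw [Ideal.mem_bot]
    refine MvPolynomial.funext fun x => ?_
    rw [← za_aeval, hf x trivial, map_zero]
  rw [this]
  exact Ideal.isPrime_bot

theorem za_coord_dim {k : Type*} {σ : Type*} [Field k] [IsAlgClosed k] [Finite σ] (S : Finset σ)
    {V : Set (σ → k)} (C : Set V)
    (hCS : Subtype.val '' C = {x : σ → k | ∀ q ∈ S, x q = 0}) :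
    topologicalKrullDim C = (Nat.card {q // q ∉ S} : WithBot ℕ∞) := by
  rw [← za_dim k]
  have hm : ∀ y, ∃ c : C, c.1.1 = zaExt (k := k) S y := by
    intro y
    have : zaExt S y ∈ Subtype.val '' C := by
      rw [hCS, ← zaExt_range]
      exact ⟨y, rfl⟩
    obtain ⟨c, hc, h⟩ := this
    exact ⟨⟨c, hc⟩, h⟩
  choose g hg using hm
  let e : C ≃ₜ ({q // q ∉ S} → k) :=
    { toFun := fun c q => c.1.1 q.1
      invFun := g
      left_inv := by
        intro c
        apply Subtype.ext
        apply Subtype.ext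
        rw [hg]
        have hc : c.1.1 ∈ {x : σ → k | ∀ q ∈ S, x q = 0} := hCS ▸ ⟨c.1, c.2, rfl⟩
        funext q
        by_cases h : q ∈ S
        · simp [zaExt, h, hc q h]
        · simp [zaExt, h]
      right_inv := by
        intro y
        funext q
        change (g y).1.1 q.1 = y q
        rw [hg]
        simp [zaExt, q.2]
      continuous_toFun := by
        have : Continuous (fun (x : σ → k) (q : {q // q ∉ S}) => x q.1) :=
          za_continuous_of _ (fun q => X q.1) (by intros; simp)
        exact this.comp (continuous_subtype_val.comp continuous_subtype_val)
      continuous_invFun := by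
        rw [continuous_induced_rng, continuous_induced_rng]
        have : (Subtype.val ∘ Subtype.val ∘ g) = zaExt (k := k) S := funext hg
        rw [this]
        exact zaExt_continuous S }
  exact IsHomeomorph.topologicalKrullDim_eq e e.isHomeomorph

theorem za_max {k : Type*} {σ : Type*} [Field k] [Infinite k] (S S' : Finset σ)
    {V : Set (σ → k)} (C : Set V) (hC : C ∈ zComponents k σ V)
    (hCS : Subtype.val '' C = {x : σ → k | ∀ q ∈ S, x q = 0}) (hSS : S' ⊆ S)
    (hV : {x : σ → k | ∀ q ∈ S', x q = 0} ⊆ V) : S' = S := by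
  have hmax : Maximal IsIrreducible C := hC
  let D : Set V := Subtype.val ⁻¹' {x : σ → k | ∀ q ∈ S', x q = 0}
  have himg : Subtype.val '' D = {x : σ → k | ∀ q ∈ S', x q = 0} := by
    rw [Subtype.image_preimage_coe, Set.inter_eq_right.2 hV]
  have hD : IsIrreducible D := by
    have h := za_coord_irred (k := k) S'
    rw [← himg] at h
    refine ⟨?_, ?_⟩
    · exact h.1.of_image
    · rintro u v ⟨u', hu', rfl⟩ ⟨v', hv', rfl⟩ ⟨a, ha, hau⟩ ⟨b, hb, hbv⟩
      obtain ⟨_, ⟨c, hc, rfl⟩, hcuv⟩ := h.2 u' v' hu' hv' ⟨a.1, ⟨a, ha, rfl⟩, hau⟩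
        ⟨b.1, ⟨b, hb, rfl⟩, hbv⟩
      exact ⟨c, hc, hcuv⟩
  have hCD : C ⊆ D := by
    intro c hc q hq
    have : c.1 ∈ {x : σ → k | ∀ q ∈ S, x q = 0} := hCS ▸ ⟨c, hc, rfl⟩
    exact this q (hSS hq)
  have hDC : D ⊆ C := hmax.2 hD hCD
  refine Finset.Subset.antisymm hSS ?_
  intro q hq
  by_contra hq'
  have : (Pi.single q 1 : σ → k) ∈ {x : σ → k | ∀ q ∈ S', x q = 0} := by
    intro r hr
    rw [Pi.single_eq_of_ne]
    rintro rfl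
    exact hq' hr
  rw [← himg] at this
  have h2 := Set.image_mono hDC this
  rw [hCS] at h2
  simpa using h2 q hq

end ZariskiAux

section Comb

theorem gt_of_order {k : Type*} [CommRing k] {n : ℕ} (s : Fin n → Fin n → Prop)
    [IsLinearOrder (Fin n) s] (x : Fin n × Fin n → k)
    (hx : ∀ a b, ¬ (s a b ∧ a ≠ b) → x (a, b) = 0) : x ∈ GTgl k n := by
  intro i hi j hj _
  set M := (Matrix.of fun a b : Fin i => x (Fin.castLE hi a, Fin.castLE hi b)) with hM
  have key : ∀ j, ∀ a b, ¬ (s (Fin.castLE hi a) (Fin.castLE hi b) ∧ a ≠ b) →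
      (M ^ (j + 1)) a b = 0 := by
    intro j
    induction j with
    | zero =>
      intro a b h
      rw [zero_add, pow_one, hM, Matrix.of_apply]
      apply hx
      simpa using h
    | succ j ih =>
      intro a b h
      rw [pow_succ, Matrix.mul_apply]
      refine Finset.sum_eq_zero fun c _ => ?_
      by_cases h1 : s (Fin.castLE hi a) (Fin.castLE hi c) ∧ a ≠ c
      · have : M c b = 0 := by
          rw [hM, Matrix.of_apply]
          apply hx
          rintro ⟨h2, h3⟩
          refine h ⟨_root_.trans h1.1 h2, ?_⟩
          rintro rfl
          have := antisymm (r := s) h1.1 h2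
          exact h1.2 (by simpa using this)
        rw [this, mul_zero]
      · rw [ih a c h1, zero_mul]
  obtain ⟨j, rfl⟩ : ∃ m, j = m + 1 := ⟨j - 1, by omega⟩
  rw [Matrix.trace]
  refine Finset.sum_eq_zero fun a _ => ?_
  rw [Matrix.diag_apply]
  exact key j a a (by simp)

theorem card_order {n : ℕ} (s : Fin n → Fin n → Prop) [IsLinearOrder (Fin n) s] :
    (Finset.univ.filter fun p : Fin n × Fin n => ¬ (s p.1 p.2 ∧ p.1 ≠ p.2)).card
      = n * (n + 1) / 2 := by
  set U := Finset.univ.filter fun p : Fin n × Fin n => (s p.1 p.2 ∧ p.1 ≠ p.2) with hU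
  set U' := Finset.univ.filter fun p : Fin n × Fin n => (s p.2 p.1 ∧ p.1 ≠ p.2) with hU'
  set D := Finset.univ.filter fun p : Fin n × Fin n => p.1 = p.2 with hD
  have h1 : U.card = U'.card := by
    refine Finset.card_bij (fun p _ => p.swap) ?_ ?_ ?_
    · simp [hU, hU']
      intro a b h1 h2
      exact ⟨h1, Ne.symm h2⟩
    · intro a _ b _ h
      exact Prod.swap_injective h
    · simp [hU, hU']
      intro a b h1 h2
      exact ⟨h1, Ne.symm h2⟩
  have h2 : D.card = n := by
    have : D = Finset.univ.image (fun a : Fin n => (a, a)) := by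
      ext ⟨a, b⟩
      simp [hD]
    rw [this, Finset.card_image_of_injective]
    · simp
    · intro a b h
      exact (Prod.ext_iff.1 h).1
  have h3 : (Finset.univ.filter fun p : Fin n × Fin n => ¬ (s p.1 p.2 ∧ p.1 ≠ p.2)) = U' ∪ D := by
    ext ⟨a, b⟩
    simp only [hU', hD, Finset.mem_filter, Finset.mem_univ, true_and, Finset.mem_union]
    by_cases h : a = b
    · simp [h]
    · have ht := total_of s a b
      have ha : s a b → s b a → a = b := fun u v => antisymm (r := s) u v
      tauto
  have h4 : (U' ∪ D).card = U'.card + D.card := by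
    apply Finset.card_union_of_disjoint
    rw [Finset.disjoint_left]
    intro p
    simp [hU', hD]
  have h5 := Finset.card_filter_add_card_filter_not (s := (Finset.univ : Finset (Fin n × Fin n)))
    (fun p => s p.1 p.2 ∧ p.1 ≠ p.2)
  rw [h3, h4, ← hU] at h5
  rw [h3, h4]
  simp only [Finset.card_univ, Fintype.card_prod, Fintype.card_fin] at h5
  have : n * (n + 1) = n * n + n := by ring
  omega

theorem wf_of_sub {k : Type*} [Field k] [CharZero k] {n : ℕ} (S : Finset (Fin n × Fin n))
    (hS : {x : Fin n × Fin n → k | ∀ q ∈ S, x q = 0} ⊆ GTgl k n) :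
    WellFounded (fun a b : Fin n => (b, a) ∉ S) := by
  rw [WellFounded.wellFounded_iff_has_min]
  by_contra! hcon
  obtain ⟨T, ⟨t, ht⟩, hT⟩ := hcon
  choose! f hfT hfS using hT
  let x : Fin n × Fin n → k := fun p => if p.1 ∈ T ∧ p.2 = f p.1 then 1 else 0
  have hx : x ∈ GTgl k n := by
    apply hS
    rintro ⟨a, b⟩ hq
    simp only [x]
    rw [if_neg]
    rintro ⟨h1, rfl⟩
    exact hfS a h1 hq
  have hit : ∀ j, ∀ a ∈ T, f^[j] a ∈ T := by
    intro j
    induction j with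
    | zero => intro a ha; exact ha
    | succ j ih => intro a ha; exact ih _ (hfT a ha)
  let M : Matrix (Fin n) (Fin n) k := Matrix.of fun a b => x (a, b)
  have hpow : ∀ j, ∀ a ∈ T, ∀ b, (M ^ j) a b = if b = f^[j] a then 1 else 0 := by
    intro j
    induction j with
    | zero => intro a _ b; simp [Matrix.one_apply, eq_comm]
    | succ j ih =>
      intro a ha b
      rw [pow_succ', Matrix.mul_apply, Finset.sum_eq_single (f a)]
      · rw [ih _ (hfT a ha)]
        simp [M, x, ha]
        congr
      · intro c _ hc
        simp [M, x, hc]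
      · simp
  have hpow0 : ∀ j, ∀ a, a ∉ T → ∀ b, (M ^ (j + 1)) a b = 0 := by
    intro j a ha b
    rw [pow_succ', Matrix.mul_apply]
    refine Finset.sum_eq_zero fun c _ => ?_
    simp [M, x, ha]
  obtain ⟨p, q, hne, hpq⟩ : ∃ p q : Fin (n + 1), p < q ∧ f^[p] t = f^[q] t := by
    obtain ⟨p, q, hne, h⟩ := Fintype.exists_ne_map_eq_of_card_lt
      (fun p : Fin (n + 1) => f^[p] t) (by simp)
    rcases lt_or_gt_of_ne hne with h' | h'
    · exact ⟨p, q, h', h⟩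
    · exact ⟨q, p, h', h.symm⟩
  have hlt : (p : ℕ) < q := hne
  have hqn : (q : ℕ) < n + 1 := q.2
  obtain ⟨m, hm⟩ : ∃ m, (q : ℕ) = (m + 1) + p := ⟨q - p - 1, by omega⟩
  have htr : Matrix.trace (M ^ (m + 1)) = 0 := hx n le_rfl (m + 1) (by omega) (by omega)
  have hval : Matrix.trace (M ^ (m + 1)) =
      ((Finset.univ.filter fun a => a ∈ T ∧ a = f^[m + 1] a).card : k) := by
    rw [Matrix.trace, Finset.card_filter, Nat.cast_sum]
    refine Finset.sum_congr rfl fun a _ => ?_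
    rw [Matrix.diag_apply]
    by_cases ha : a ∈ T
    · rw [hpow _ a ha]
      simp [ha]
      congr
    · rw [hpow0 m a ha]
      simp [ha]
  rw [hval, Nat.cast_eq_zero, Finset.card_eq_zero] at htr
  have : f^[p] t ∈ (Finset.univ.filter fun a => a ∈ T ∧ a = f^[m + 1] a) := by
    rw [Finset.mem_filter]
    refine ⟨Finset.mem_univ _, hit _ _ ht, ?_⟩
    rw [← Function.iterate_add_apply, ← hm]
    exact hpq
  rw [htr] at this
  simp at this

theorem exists_order {α : Type*} (r : α → α → Prop) (h : WellFounded r) :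
    ∃ s : α → α → Prop, IsLinearOrder α s ∧ ∀ a b, r a b → s a b ∧ a ≠ b := by
  have hT : WellFounded (Relation.TransGen r) := h.transGen
  have hirr : ∀ a, ¬ Relation.TransGen r a a := fun a ha => hT.irrefl.irrefl a ha
  haveI : IsPartialOrder α (Relation.ReflTransGen r) :=
    { refl := fun a => Relation.ReflTransGen.refl
      trans := fun a b c => Relation.ReflTransGen.trans
      antisymm := by
        intro a b h1 h2
        rcases Relation.reflTransGen_iff_eq_or_transGen.1 h1 with h | h
        · exact h.symm
        · exact absurd (h.trans_left h2) (hirr a) }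
  obtain ⟨s, hs, hle⟩ := extend_partialOrder (Relation.ReflTransGen r)
  refine ⟨s, hs, fun a b hab => ⟨hle _ _ (Relation.ReflTransGen.single hab), ?_⟩⟩
  rintro rfl
  exact hirr a (Relation.TransGen.single hab)

end Comb

/-- Every irreducible component of the Gelfand–Tsetlin variety for `gl_n` that is the common
zero set of a set `S` of coordinate variables satisfies `|S| = n(n+1)/2`; consequently every
such component is a coordinate subspace of dimension `n(n-1)/2` and is carried onto the
component `V_≤ = {x | x_{ab} = 0 for a ≤ b}` by a linear change of coordinates. -/
theorem regular_components (k : Type*) [Field k] [IsAlgClosed k] [CharZero k]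
    (n : ℕ) (hn : 1 ≤ n) (S : Finset (Fin n × Fin n)) (C : Set (GTgl k n))
    (hC : C ∈ zComponents k (Fin n × Fin n) (GTgl k n))
    (hCS : Subtype.val '' C = {x : Fin n × Fin n → k | ∀ q ∈ S, x q = 0}) :
    S.card = n * (n + 1) / 2 ∧
    zKrullDimSub k (Fin n × Fin n) C = ((n * (n - 1) / 2 : ℕ) : WithBot ℕ∞) ∧
    ∃ e : (Fin n × Fin n → k) ≃ₗ[k] (Fin n × Fin n → k),
      e '' (Subtype.val '' C) =
        {x : Fin n × Fin n → k | ∀ a b : Fin n, a ≤ b → x (a, b) = 0} := by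
  have hsub : {x : Fin n × Fin n → k | ∀ q ∈ S, x q = 0} ⊆ GTgl k n := by
    rw [← hCS]
    rintro _ ⟨c, _, rfl⟩
    exact c.2
  obtain ⟨s, hs, hrs⟩ := exists_order _ (wf_of_sub S hsub)
  let s' : Fin n → Fin n → Prop := fun a b => s b a
  haveI : IsLinearOrder (Fin n) s' :=
    { refl := fun a => refl_of s a
      trans := fun a b c h1 h2 => trans_of s h2 h1
      antisymm := fun a b h1 h2 => antisymm (r := s) h2 h1
      total := fun a b => total_of s b a }
  let S' := Finset.univ.filter fun p : Fin n × Fin n => ¬ (s' p.1 p.2 ∧ p.1 ≠ p.2)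
  have hSS : S' ⊆ S := by
    rintro ⟨a, b⟩ hq
    by_contra hcon
    have h := hrs b a hcon
    have hq' := (Finset.mem_filter.1 hq).2
    exact hq' ⟨h.1, Ne.symm h.2⟩
  have hEq : S' = S := by
    refine za_max S S' C hC hCS hSS ?_
    intro x hx
    refine gt_of_order s' x fun a b hab => hx (a, b) ?_
    exact Finset.mem_filter.2 ⟨Finset.mem_univ _, hab⟩
  have hcard : S.card = n * (n + 1) / 2 := by
    rw [← hEq]
    exact card_order s'
  refine ⟨hcard, ?_, ?_⟩
  · have h := za_coord_dim S C hCS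
    refine Eq.trans h ?_
    have h2 : Nat.card {q // q ∉ S} = n * (n - 1) / 2 := by
      rw [Nat.card_eq_fintype_card, Fintype.card_subtype_compl]
      simp only [Fintype.card_prod, Fintype.card_fin, Fintype.card_coe, hcard]
      obtain ⟨m, rfl⟩ : ∃ m, n = m + 1 := ⟨n - 1, by omega⟩
      have e1 : (m + 1) * (m + 1 + 1) = (m + 1) * m + 2 * (m + 1) := by ring
      have e2 : (m + 1) * (m + 1) = (m + 1) * m + (m + 1) := by ring
      have e3 : 2 ∣ (m + 1) * m := by
        rw [mul_comm]
        exact (Nat.even_mul_succ_self m).two_dvd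
      rw [Nat.add_sub_cancel]
      omega
    rw [h2]
  · let g : Fin n → Fin n → Prop := fun a b => b ≤ a
    haveI : IsLinearOrder (Fin n) g :=
      { refl := fun a => le_refl a
        trans := fun a b c h1 h2 => le_trans h2 h1
        antisymm := fun a b h1 h2 => le_antisymm h2 h1
        total := fun a b => le_total b a }
    let T := Finset.univ.filter fun p : Fin n × Fin n => ¬ (g p.1 p.2 ∧ p.1 ≠ p.2)
    have hT : T.card = S.card := by
      rw [hcard, ← card_order g]
      congr!
    have hmem : ∀ a b : Fin n, (a, b) ∈ T ↔ a ≤ b := by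
      intro a b
      simp only [T, g, Finset.mem_filter, Finset.mem_univ, true_and]
      omega
    let e0 : {q // q ∈ T} ≃ {q // q ∈ S} := Finset.equivOfCardEq hT
    let π : Equiv.Perm (Fin n × Fin n) := e0.extendSubtype
    have hπ : ∀ q, π q ∈ S ↔ q ∈ T := by
      intro q
      constructor
      · intro h
        by_contra hq
        exact e0.extendSubtype_not_mem q hq h
      · intro h
        exact e0.extendSubtype_mem q h
    refine ⟨LinearEquiv.funCongrLeft k k π, ?_⟩
    rw [hCS]
    ext x
    constructor
    · rintro ⟨y, hy, rfl⟩ a b hab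
      exact hy _ ((hπ _).2 ((hmem a b).2 hab))
    · intro hx
      refine ⟨fun q => x (π.symm q), ?_, ?_⟩
      · intro q hq
        have : π.symm q ∈ T := by
          rw [← hπ]
          simpa using hq
        exact hx _ _ ((hmem _ _).1 this)
      · funext q
        simp [LinearEquiv.funCongrLeft_apply, LinearMap.funLeft_apply]

end
end

section
/- For every integer p ≥ 1, the Gelfand–Tsetlin variety GTs for the restricted Yangian Y_p(gl_2) is equidimensional of dimension p, i.e., every irreducible component of GTs has Krull dimension p. -/
open scoped Classical

noncomputable section

/-- The `m × m` matrix `X(u)_m` over `k[u]` attached to a point `x` of `k^{n²p}`: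
its `(a,b)` entry is `δ_{ab} u^p + Σ_{t=1}^p x_{ab}^{(t)} u^{p-t}`. -/
def Xu (k : Type*) [CommRing k] (n p : ℕ) (x : Fin n × Fin n × Fin p → k)
    (m : ℕ) (hm : m ≤ n) : Matrix (Fin m) (Fin m) (Polynomial k) :=
  Matrix.of fun a b =>
    (if (a : ℕ) = (b : ℕ) then Polynomial.X ^ p else 0) +
      ∑ t : Fin p, Polynomial.C (x (Fin.castLE hm a, Fin.castLE hm b, t)) *
        Polynomial.X ^ (p - ((t : ℕ) + 1))

/-- The value at the point `x` of the polynomial `d̄_{mj}`, defined as the coefficient of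
`u^{mp-j}` in `det X(u)_m`. -/
def dbar (k : Type*) [CommRing k] (n p : ℕ) (x : Fin n × Fin n × Fin p → k) (m j : ℕ) : k :=
  if hm : m ≤ n then ((Xu k n p x m hm).det).coeff (m * p - j) else 0

/-- The Gelfand–Tsetlin variety for the restricted Yangian `Y_p(gl_n)`: the common zero
set in `k^{n²p}` of all the polynomials `d̄_{mj}` (`1 ≤ m ≤ n`, `1 ≤ j ≤ mp`). -/
def GTsYang (k : Type*) [CommRing k] (n p : ℕ) : Set (Fin n × Fin n × Fin p → k) :=
  {x | ∀ m j : ℕ, 1 ≤ m → m ≤ n → 1 ≤ j → j ≤ m * p → dbar k n p x m j = 0}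

section ZariskiAux

attribute [local instance] zariskiTopology

variable {k : Type*} [Field k] {σ : Type*}

lemma zar_isOpen (f : MvPolynomial σ k) : IsOpen {x : σ → k | MvPolynomial.eval x f ≠ 0} :=
  TopologicalSpace.isOpen_generateFrom_of_mem ⟨f, rfl⟩

lemma zar_isClosed (f : MvPolynomial σ k) : IsClosed {x : σ → k | MvPolynomial.eval x f = 0} := by
  rw [← isOpen_compl_iff]
  exact zar_isOpen f

lemma zar_basis : TopologicalSpace.IsTopologicalBasis
    {U : Set (σ → k) | ∃ f : MvPolynomial σ k, U = {x | MvPolynomial.eval x f ≠ 0}} where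
  exists_subset_inter := by
    rintro _ ⟨f, rfl⟩ _ ⟨g, rfl⟩ x ⟨hf, hg⟩
    refine ⟨_, ⟨f * g, rfl⟩, ?_, ?_⟩
    · simp at hf hg ⊢; exact ⟨hf, hg⟩
    · intro y hy; simpa using hy
  sUnion_eq := by
    rw [Set.eq_univ_iff_forall]
    intro x
    exact ⟨_, ⟨1, rfl⟩, by simp⟩
  eq_generateFrom := rfl

lemma zar_zeroLocus_closed (I : Ideal (MvPolynomial σ k)) :
    IsClosed (MvPolynomial.zeroLocus k I) := by
  have : MvPolynomial.zeroLocus k I = ⋂ f ∈ I, {x : σ → k | MvPolynomial.eval x f = 0} := by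
    ext x; simp [MvPolynomial.aeval_eq_eval]
  rw [this]
  exact isClosed_biInter fun f _ => zar_isClosed f

lemma zar_closed_eq {S : Set (σ → k)} (hS : IsClosed S) :
    MvPolynomial.zeroLocus k (MvPolynomial.vanishingIdeal k S) = S := by
  refine le_antisymm ?_ (MvPolynomial.zeroLocus_vanishingIdeal_le S)
  intro x hx
  by_contra hxS
  obtain ⟨_, ⟨f, rfl⟩, hxf, hf⟩ := zar_basis.exists_subset_of_mem_open
    (show x ∈ Sᶜ from hxS) hS.isOpen_compl
  apply hxf
  have := hx f (fun y hy => by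
    by_contra h
    exact hf (show y ∈ _ from by simpa [MvPolynomial.aeval_eq_eval] using h) hy)
  simpa [MvPolynomial.aeval_eq_eval] using this

lemma zar_prime {S : Set (σ → k)} (hS : IsIrreducible S) :
    (MvPolynomial.vanishingIdeal k S).IsPrime := by
  refine ⟨?_, ?_⟩
  · intro h
    obtain ⟨x, hx⟩ := hS.1
    have : (1 : MvPolynomial σ k) ∈ MvPolynomial.vanishingIdeal k S := by rw [h]; trivial
    simpa using this x hx
  · intro f g hfg
    have := isPreirreducible_iff_isClosed_union_isClosed.1 hS.2 _ _ (zar_isClosed f)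
      (zar_isClosed g) (fun x hx => by
        have := hfg x hx
        simpa [MvPolynomial.aeval_eq_eval] using this)
    refine this.imp ?_ ?_ <;> intro h x hx <;>
      simpa [MvPolynomial.aeval_eq_eval] using h hx

lemma zar_continuous {τ : Type*} (φ : (σ → k) → (τ → k))
    (h : ∀ c, ∃ P : MvPolynomial σ k, ∀ y, MvPolynomial.eval y P = φ y c) : Continuous φ := by
  choose P hP using h
  refine continuous_generateFrom_iff.2 ?_
  rintro _ ⟨f, rfl⟩
  convert zar_isOpen (MvPolynomial.bind₁ P f) using 1
  ext y
  have : φ y = fun c => MvPolynomial.eval y (P c) := by funext c; rw [hP]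
  simp only [Set.mem_preimage, Set.mem_ofPred_eq, this]
  rw [← MvPolynomial.aeval_eq_eval, ← MvPolynomial.aeval_eq_eval, MvPolynomial.aeval_bind₁]

variable [IsAlgClosed k] [Finite σ]

lemma zar_irred (P : Ideal (MvPolynomial σ k)) [hP : P.IsPrime] :
    IsIrreducible (MvPolynomial.zeroLocus k P) := by
  have hv := MvPolynomial.IsPrime.vanishingIdeal_zeroLocus (K := k) P
  refine ⟨?_, ?_⟩
  · rw [Set.nonempty_iff_ne_empty]
    intro h
    rw [h, MvPolynomial.vanishingIdeal_empty] at hv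
    exact hP.ne_top hv.symm
  · rw [isPreirreducible_iff_isClosed_union_isClosed]
    intro Z W hZ hW h
    have : MvPolynomial.vanishingIdeal k Z * MvPolynomial.vanishingIdeal k W ≤ P := by
      rw [← hv, Ideal.mul_le]
      intro f hf g hg x hx
      rcases h hx with hx | hx
      · rw [map_mul, hf x hx, zero_mul]
      · rw [map_mul, hg x hx, mul_zero]
    rcases hP.mul_le.1 this with h | h
    · left
      rw [← zar_closed_eq hZ]
      exact MvPolynomial.zeroLocus_anti_mono h
    · right
      rw [← zar_closed_eq hW]
      exact MvPolynomial.zeroLocus_anti_mono h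

lemma zar_dim : topologicalKrullDim (σ → k) = (Nat.card σ : WithBot ℕ∞) := by
  have h1 : ringKrullDim (MvPolynomial σ k) = (Nat.card σ : WithBot ℕ∞) := by
    rw [MvPolynomial.ringKrullDim_of_isNoetherianRing, ringKrullDim_eq_zero_of_field, zero_add]
  rw [← h1]
  unfold topologicalKrullDim ringKrullDim
  refine le_antisymm ?_ ?_
  · rw [← Order.krullDim_orderDual (α := PrimeSpectrum _)]
    refine Order.krullDim_le_of_strictMono (fun S => OrderDual.toDual
      ⟨MvPolynomial.vanishingIdeal k (S : Set (σ → k)), zar_prime S.isIrreducible'⟩) ?_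
    refine Monotone.strictMono_of_injective ?_ ?_
    · intro S T h
      exact MvPolynomial.vanishingIdeal_anti_mono h
    · intro S T h
      have h' : MvPolynomial.vanishingIdeal k (S : Set (σ → k)) =
        MvPolynomial.vanishingIdeal k (T : Set (σ → k)) :=
          congrArg PrimeSpectrum.asIdeal (OrderDual.toDual.injective h)
      apply SetLike.coe_injective
      rw [← zar_closed_eq (S := (S : Set (σ → k))) S.isClosed',
        ← zar_closed_eq (S := (T : Set (σ → k))) T.isClosed']
      exact congrArg _ h'
  · rw [← Order.krullDim_orderDual (α := PrimeSpectrum _)]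
    refine Order.krullDim_le_of_strictMono (fun P => 
      ⟨MvPolynomial.zeroLocus k (OrderDual.ofDual P).asIdeal, zar_irred _,
        zar_zeroLocus_closed _⟩) ?_
    refine Monotone.strictMono_of_injective ?_ ?_
    · intro S T h
      exact MvPolynomial.zeroLocus_anti_mono h
    · intro S T h
      have h' := congrArg TopologicalSpace.IrreducibleCloseds.carrier h
      have h2 := congrArg (MvPolynomial.vanishingIdeal k) h'
      dsimp only at h2
      rw [MvPolynomial.IsPrime.vanishingIdeal_zeroLocus,
        MvPolynomial.IsPrime.vanishingIdeal_zeroLocus] at h2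
      exact OrderDual.ofDual.injective (PrimeSpectrum.ext h2)

lemma zar_univ_irred : IsIrreducible (Set.univ : Set (σ → k)) := by
  have := zar_irred (⊥ : Ideal (MvPolynomial σ k))
  rwa [MvPolynomial.zeroLocus_bot] at this

/-- Abstract equidimensionality criterion. -/
lemma zar_equidim {τ : Type*} {ι : Type*} [Finite ι] (V : Set (τ → k)) (φ : ι → (σ → k) → V)
    (ψ : ι → (τ → k) → (σ → k)) (hφ : ∀ i, Continuous (φ i)) (hψ : ∀ i, Continuous (ψ i))
    (hl : ∀ i y, ψ i (φ i y) = y) (hc : ∀ i, IsClosed (Set.range (φ i)))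
    (hcov : ∀ x, ∃ i, x ∈ Set.range (φ i)) :
    IsEquidimOfDim k τ V (Nat.card σ) := by
  intro C hC
  have hC' : C ∈ irreducibleComponents V := hC
  have hirr : IsIrreducible C := hC'.1
  have : ∃ i, C ⊆ Set.range (φ i) := by
    obtain ⟨z, hz, hCz⟩ := isIrreducible_iff_sUnion_isClosed.1 hirr
      (Set.finite_range fun i => Set.range (φ i)).toFinset (by simp [hc]) (by
        intro x _
        obtain ⟨i, hi⟩ := hcov x
        simp only [Set.Finite.coe_toFinset]
        exact ⟨_, ⟨i, rfl⟩, hi⟩)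
    simp only [Set.Finite.mem_toFinset, Set.mem_range] at hz
    obtain ⟨i, rfl⟩ := hz
    exact ⟨i, hCz⟩
  obtain ⟨i, hi⟩ := this
  have hri : IsIrreducible (Set.range (φ i)) := by
    rw [← Set.image_univ]
    exact zar_univ_irred.image _ (hφ i).continuousOn
  obtain rfl : C = Set.range (φ i) := hi.antisymm (hC'.2 hri hi)
  show topologicalKrullDim (Set.range (φ i)) = _
  rw [← zar_dim (k := k) (σ := σ)]
  let e : (σ → k) ≃ₜ Set.range (φ i) :=
    { toFun := fun y => ⟨φ i y, y, rfl⟩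
      invFun := fun x => ψ i x.1.1
      left_inv := fun y => hl i y
      right_inv := by
        rintro ⟨_, y, rfl⟩
        simp [hl]
      continuous_toFun := (hφ i).subtype_mk _
      continuous_invFun := (hψ i).comp (continuous_subtype_val.comp continuous_subtype_val) }
  exact (e.isHomeomorph.topologicalKrullDim_eq).symm

end ZariskiAux

section PolyAux

open Polynomial

variable {k : Type*} [Field k] {p : ℕ}

/-- The polynomial with coefficients listed from degree `p - 1` downwards. -/
def gtPoly (b : Fin p → k) : k[X] := ∑ t : Fin p, C (b t) * X ^ (p - ((t : ℕ) + 1))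

lemma gtPoly_coeff (b : Fin p → k) (t : Fin p) : (gtPoly b).coeff (p - ((t : ℕ) + 1)) = b t := by
  unfold gtPoly
  rw [finsetSum_coeff, Finset.sum_eq_single t]
  · simp
  · intro s _ hs
    rw [coeff_C_mul_X_pow, if_neg]
    intro h
    apply hs
    ext
    omega
  · simp

lemma gtPoly_coeff_ge (b : Fin p → k) {n : ℕ} (hn : p ≤ n) : (gtPoly b).coeff n = 0 := by
  unfold gtPoly
  rw [finsetSum_coeff]
  refine Finset.sum_eq_zero fun s _ => ?_
  rw [coeff_C_mul_X_pow, if_neg]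
  omega

lemma gtPoly_coeff_lt (b : Fin p → k) {n : ℕ} (hn : n < p) :
    (gtPoly b).coeff n = b ⟨p - (n + 1), by omega⟩ := by
  rw [← gtPoly_coeff b]
  congr 1
  simp only
  omega

lemma gtPoly_dvd (b : Fin p → k) {i : ℕ} (hi : i ≤ p) :
    X ^ i ∣ gtPoly b ↔ ∀ t : Fin p, p ≤ t + i → b t = 0 := by
  rw [X_pow_dvd_iff]
  constructor
  · intro h t ht
    rw [← gtPoly_coeff b]
    apply h
    omega
  · intro h d hd
    rw [gtPoly_coeff_lt b (by omega)]
    apply h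
    simp only
    omega

lemma gtPoly_mul_coeff (b c : Fin p → k) {n : ℕ} (hn : p + p ≤ n) :
    (gtPoly b * gtPoly c).coeff n = 0 := by
  rw [coeff_mul]
  refine Finset.sum_eq_zero fun x hx => ?_
  rw [Finset.HasAntidiagonal.mem_antidiagonal] at hx
  by_cases h : p ≤ x.1
  · rw [gtPoly_coeff_ge b h, zero_mul]
  · rw [gtPoly_coeff_ge c (n := x.2) (by omega), mul_zero]

lemma gtPoly_div (b c : Fin p → k) (h : X ^ p ∣ gtPoly b * gtPoly c) :
    X ^ p * gtPoly (fun t : Fin p => (gtPoly b * gtPoly c).coeff (p - ((t : ℕ) + 1) + p)) =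
      gtPoly b * gtPoly c := by
  ext n
  rw [coeff_X_pow_mul']
  split_ifs with hn
  · obtain ⟨m, rfl⟩ := Nat.exists_eq_add_of_le' hn
    rw [Nat.add_sub_cancel]
    by_cases hm : m < p
    · rw [gtPoly_coeff_lt _ hm]
      congr 1
      simp only
      omega
    · rw [gtPoly_coeff_ge _ (by omega), gtPoly_mul_coeff b c (by omega)]
  · rw [X_pow_dvd_iff.1 h n (by omega)]

lemma gtPoly_zero_iff (b : Fin p → k) : gtPoly b = 0 ↔ ∀ t, b t = 0 := by
  constructor
  · intro h t
    rw [← gtPoly_coeff b, h, coeff_zero]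
  · intro h
    simp [gtPoly, h]

lemma GTsYang_mem (x : Fin 2 × Fin 2 × Fin p → k) : x ∈ GTsYang k 2 p ↔
    (∀ t, x (0, 0, t) = 0) ∧ X ^ p * gtPoly (fun t => x (1, 1, t)) =
      gtPoly (fun t => x (0, 1, t)) * gtPoly (fun t => x (1, 0, t)) := by
  have h1 : (Xu k 2 p x 1 (by norm_num)).det = X ^ p + gtPoly (fun t => x (0, 0, t)) := by
    simp [Matrix.det_fin_one, Xu, gtPoly]
  have h2 : (Xu k 2 p x 2 le_rfl).det =
      (X ^ p + gtPoly (fun t => x (0, 0, t))) * (X ^ p + gtPoly (fun t => x (1, 1, t))) -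
      gtPoly (fun t => x (0, 1, t)) * gtPoly (fun t => x (1, 0, t)) := by
    simp [Matrix.det_fin_two, Xu, gtPoly]
  constructor
  · intro h
    have hA : ∀ t, x (0, 0, t) = 0 := by
      intro t
      have := h 1 (t + 1) le_rfl (by norm_num) (by omega) (by omega)
      rw [dbar, dif_pos (by norm_num), h1, coeff_add, one_mul, gtPoly_coeff, coeff_X_pow,
        if_neg (by omega), zero_add] at this
      exact this
    refine ⟨hA, ?_⟩
    have hA0 := (gtPoly_zero_iff (fun t => x (0, 0, t))).2 hA
    ext n
    by_cases hn : n < 2 * p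
    · have := h 2 (2 * p - n) (by norm_num) le_rfl (by omega) (by omega)
      rw [dbar, dif_pos le_rfl, h2, hA0, add_zero, mul_add, ← pow_add, coeff_sub, coeff_add,
        coeff_X_pow, if_neg (by omega), zero_add, sub_eq_zero,
        show 2 * p - (2 * p - n) = n by omega] at this
      exact this
    · rw [gtPoly_mul_coeff _ _ (by omega), coeff_X_pow_mul', if_pos (by omega),
        gtPoly_coeff_ge _ (by omega)]
  · rintro ⟨hA, hD⟩ m j hm1 hm2 hj1 hj2
    have hA0 := (gtPoly_zero_iff (fun t => x (0, 0, t))).2 hA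
    obtain rfl | rfl : m = 1 ∨ m = 2 := by omega
    · rw [dbar, dif_pos (by norm_num), h1, hA0, add_zero, coeff_X_pow, if_neg (by omega)]
    · rw [dbar, dif_pos le_rfl, h2, hA0, add_zero, mul_add, hD, add_sub_cancel_right, ← pow_add,
        coeff_X_pow, if_neg (by omega)]

/-- Polynomial functions. -/
def gtIsPoly {σ : Type*} (f : (σ → k) → k) : Prop :=
  ∃ P : MvPolynomial σ k, ∀ y, MvPolynomial.eval y P = f y

lemma gtIsPoly_coord {σ : Type*} (s : σ) : gtIsPoly (fun y : σ → k => y s) :=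
  ⟨MvPolynomial.X s, by simp⟩

lemma gtIsPoly_zero {σ : Type*} : gtIsPoly (fun _ : σ → k => 0) := ⟨0, by simp⟩

lemma gtIsPoly_mul {σ : Type*} {f g : (σ → k) → k} (hf : gtIsPoly f) (hg : gtIsPoly g) :
    gtIsPoly (fun y => f y * g y) := by
  obtain ⟨P, hP⟩ := hf
  obtain ⟨Q, hQ⟩ := hg
  exact ⟨P * Q, by simp [hP, hQ]⟩

lemma gtIsPoly_sum {σ ι : Type*} (s : Finset ι) {f : ι → (σ → k) → k} (hf : ∀ i, gtIsPoly (f i)) :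
    gtIsPoly (fun y => ∑ i ∈ s, f i y) := by
  choose P hP using hf
  exact ⟨∑ i ∈ s, P i, by simp [hP]⟩

lemma gtIsPoly_coeff {σ : Type*} {b : (σ → k) → Fin p → k} (hb : ∀ t, gtIsPoly (fun y => b y t))
    (n : ℕ) : gtIsPoly (fun y => (gtPoly (b y)).coeff n) := by
  by_cases hn : n < p
  · simp only [gtPoly_coeff_lt _ hn]
    exact hb _
  · simp only [gtPoly_coeff_ge _ (not_lt.1 hn)]
    exact gtIsPoly_zero

/-- The `B` part of the parametrisation. -/
def gtB (i : ℕ) (y : Fin p → k) (t : Fin p) : k := if t + i < p then y t else 0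

/-- The `C` part of the parametrisation. -/
def gtC (i : ℕ) (y : Fin p → k) (t : Fin p) : k := if (t : ℕ) < i then y t.rev else 0

/-- The parametrisation of the `i`-th component. -/
def gtPhi (i : ℕ) (y : Fin p → k) (c : Fin 2 × Fin 2 × Fin p) : k :=
  if c.1 = 0 then (if c.2.1 = 0 then 0 else gtB i y c.2.2)
  else (if c.2.1 = 0 then gtC i y c.2.2 else
    (gtPoly (gtB i y) * gtPoly (gtC i y)).coeff (p - ((c.2.2 : ℕ) + 1) + p))

/-- Its inverse. -/
def gtPsi (i : ℕ) (x : Fin 2 × Fin 2 × Fin p → k) (t : Fin p) : k :=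
  if t + i < p then x (0, 1, t) else x (1, 0, t.rev)

lemma gtB_poly (i : ℕ) (t : Fin p) : gtIsPoly (fun y : Fin p → k => gtB i y t) := by
  unfold gtB
  split_ifs
  · exact gtIsPoly_coord _
  · exact gtIsPoly_zero

lemma gtC_poly (i : ℕ) (t : Fin p) : gtIsPoly (fun y : Fin p → k => gtC i y t) := by
  unfold gtC
  split_ifs
  · exact gtIsPoly_coord _
  · exact gtIsPoly_zero

lemma gtPhi_poly (i : ℕ) (c) : gtIsPoly (fun y : Fin p → k => gtPhi i y c) := by
  unfold gtPhi
  split_ifs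
  · exact gtIsPoly_zero
  · exact gtB_poly _ _
  · exact gtC_poly _ _
  · simp only [coeff_mul]
    exact gtIsPoly_sum _ fun a => gtIsPoly_mul (gtIsPoly_coeff (gtB_poly i) _)
      (gtIsPoly_coeff (gtC_poly i) _)

lemma gtPsi_poly (i : ℕ) (t : Fin p) :
    gtIsPoly (fun x : Fin 2 × Fin 2 × Fin p → k => gtPsi i x t) := by
  unfold gtPsi
  split_ifs <;> exact gtIsPoly_coord _

lemma gtPhi_mem {i : ℕ} (hi : i ≤ p) (y : Fin p → k) : gtPhi i y ∈ GTsYang k 2 p := by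
  rw [GTsYang_mem]
  refine ⟨fun t => by simp [gtPhi], ?_⟩
  have hB : X ^ i ∣ gtPoly (gtB i y) := by
    rw [gtPoly_dvd _ hi]
    intro t ht
    rw [gtB, if_neg (by omega)]
  have hC : X ^ (p - i) ∣ gtPoly (gtC i y) := by
    rw [gtPoly_dvd _ (by omega)]
    intro t ht
    rw [gtC, if_neg (by omega)]
  have hd := mul_dvd_mul hB hC
  rw [← pow_add, Nat.add_sub_cancel' hi] at hd
  exact gtPoly_div _ _ hd

lemma gtPsi_gtPhi (i : ℕ) (y : Fin p → k) : gtPsi i (gtPhi i y) = y := by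
  funext t
  unfold gtPsi
  split_ifs with h
  · simp [gtPhi, gtB, h]
  · simp only [gtPhi, gtC]
    have : ((t.rev : Fin p) : ℕ) < i := by rw [Fin.val_rev]; omega
    simp only [this]
    simp

lemma gtPhi_range {i : ℕ} (x : Fin 2 × Fin 2 × Fin p → k)
    (hx : x ∈ GTsYang k 2 p) (hB : ∀ t : Fin p, p ≤ t + i → x (0, 1, t) = 0)
    (hC : ∀ t : Fin p, i ≤ t → x (1, 0, t) = 0) : gtPhi i (gtPsi i x) = x := by
  have eB : gtB i (gtPsi i x) = fun t => x (0, 1, t) := by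
    funext t
    unfold gtB gtPsi
    split_ifs with h
    · rfl
    · exact (hB t (by omega)).symm
  have eC : gtC i (gtPsi i x) = fun t => x (1, 0, t) := by
    funext t
    unfold gtC gtPsi
    split_ifs with h h'
    · rw [Fin.val_rev] at h'; omega
    · rw [Fin.rev_rev]
    · exact (hC t (by omega)).symm
  obtain ⟨hA, hD⟩ := (GTsYang_mem x).1 hx
  funext ⟨a, b, t⟩
  unfold gtPhi
  rw [eB, eC, ← hD, coeff_X_pow_mul, gtPoly_coeff]
  fin_cases a <;> fin_cases b <;> simp [hA]

lemma GTsYang_cover (x : Fin 2 × Fin 2 × Fin p → k) (hx : x ∈ GTsYang k 2 p) :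
    ∃ i ≤ p, (∀ t : Fin p, p ≤ t + i → x (0, 1, t) = 0) ∧
      (∀ t : Fin p, i ≤ t → x (1, 0, t) = 0) := by
  obtain ⟨hA, hD⟩ := (GTsYang_mem x).1 hx
  obtain ⟨a, b, ha, hb, hab⟩ := exists_dvd_and_dvd_of_dvd_mul (Dvd.intro _ hD)
  obtain ⟨i, hi, hai⟩ := (dvd_prime_pow prime_X p).1 (Dvd.intro _ hab.symm)
  obtain ⟨j, hj, hbj⟩ := (dvd_prime_pow prime_X p).1 (Dvd.intro_left _ hab.symm)
  have hij : i + j = p := by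
    have : Associated ((X : k[X]) ^ p) (X ^ (i + j)) := by
      rw [hab, pow_add]
      exact hai.mul_mul hbj
    have := natDegree_eq_of_degree_eq (degree_eq_degree_of_associated this)
    simpa using this.symm
  refine ⟨i, hi, (gtPoly_dvd _ hi).1 (hai.symm.dvd.trans ha), fun t ht => ?_⟩
  exact (gtPoly_dvd _ hj).1 (hbj.symm.dvd.trans hb) t (by omega)

end PolyAux

section FinalAux

attribute [local instance] zariskiTopology

lemma GTsYang_aux (k : Type*) [Field k] [IsAlgClosed k] (p : ℕ) :
    IsEquidimOfDim k (Fin 2 × Fin 2 × Fin p) (GTsYang k 2 p) p := by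
  have := zar_equidim (k := k) (σ := Fin p) (ι := Fin (p + 1)) (GTsYang k 2 p)
    (fun i y => ⟨gtPhi i y, gtPhi_mem (by omega) y⟩) (fun i => gtPsi i)
    (fun i => (zar_continuous _ (gtPhi_poly (i : ℕ))).subtype_mk _)
    (fun i => zar_continuous _ (gtPsi_poly (i : ℕ)))
    (fun i y => gtPsi_gtPhi _ y) ?_ ?_
  · simpa using this
  · intro i
    have hcl : IsClosed ((⋂ t : Fin p, ⋂ _ : p ≤ t + i,
        {x : Fin 2 × Fin 2 × Fin p → k | MvPolynomial.eval x (MvPolynomial.X (0, 1, t)) = 0}) ∩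
        (⋂ t : Fin p, ⋂ _ : (i : ℕ) ≤ t,
        {x : Fin 2 × Fin 2 × Fin p → k | MvPolynomial.eval x (MvPolynomial.X (1, 0, t)) = 0})) :=
      (isClosed_iInter fun t => isClosed_iInter fun _ => zar_isClosed _).inter
        (isClosed_iInter fun t => isClosed_iInter fun _ => zar_isClosed _)
    convert hcl.preimage (continuous_subtype_val (p := fun x => x ∈ GTsYang k 2 p)) using 1
    ext ⟨x, hx⟩
    simp only [Set.mem_range, Set.mem_preimage, Set.mem_inter_iff, Set.mem_iInter,
      Set.mem_ofPred_eq, MvPolynomial.eval_X, Subtype.mk.injEq]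
    constructor
    · rintro ⟨y, rfl⟩
      refine ⟨fun t ht => ?_, fun t ht => ?_⟩
      · simp [gtPhi, gtB]; omega
      · simp [gtPhi, gtC]; omega
    · rintro ⟨hB, hC⟩
      exact ⟨_, gtPhi_range x hx hB hC⟩
  · rintro ⟨x, hx⟩
    obtain ⟨i, hi, hB, hC⟩ := GTsYang_cover x hx
    exact ⟨⟨i, by omega⟩, _, Subtype.ext (gtPhi_range x hx hB hC)⟩

end FinalAux

/-- The Gelfand–Tsetlin variety for the restricted Yangian `Y_p(gl_2)` is equidimensional
of dimension `p`. -/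
theorem GTsYang_gl2_equidim (k : Type*) [Field k] [IsAlgClosed k] [CharZero k]
    (p : ℕ) (hp : 1 ≤ p) :
    IsEquidimOfDim k (Fin 2 × Fin 2 × Fin p) (GTsYang k 2 p) p := by
  exact GTsYang_aux k p

end
end

section
/- The common zero set in k^{9p} of the polynomials d̄_{mj} (1 ≤ m ≤ 3, 1 ≤ j ≤ mp) equals the common zero set in k^{9p} of the polynomials p_{mj} (1 ≤ m ≤ 3, 1 ≤ j ≤ mp); that is, the Gelfand–Tsetlin variety GTs for the restricted Yangian Y_p(gl_3) is cut out by the family {p_{mj}}. -/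
open scoped Classical

noncomputable section



/-- Accessor for the coordinate `X_{ab}^{(t)}` of a point of `k^{n²p}`, with `1`-based
indices `a, b ∈ {1, …, n}` and `t ∈ {1, …, p}` (and value `0` out of range). -/
def xvn (k : Type*) [CommRing k] (n p : ℕ) (x : Fin n × Fin n × Fin p → k) (a b t : ℕ) : k :=
  if h : 1 ≤ a ∧ a ≤ n ∧ 1 ≤ b ∧ b ≤ n ∧ 1 ≤ t ∧ t ≤ p then
    x (⟨a - 1, by omega⟩, ⟨b - 1, by omega⟩, ⟨t - 1, by omega⟩) else 0

/-- The value of the polynomial `p_{1i} = X_{11}^{(i)}`. -/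
def P1v (k : Type*) [CommRing k] (n p : ℕ) (x : Fin n × Fin n × Fin p → k) (i : ℕ) : k :=
  xvn k n p x 1 1 i

/-- The value of the polynomial `p_{2i}` (for `1 ≤ i ≤ 2p`). -/
def P2v (k : Type*) [CommRing k] (n p : ℕ) (x : Fin n × Fin n × Fin p → k) (i : ℕ) : k :=
  if i ≤ p then
    xvn k n p x 2 2 i - ∑ t ∈ Finset.Icc 1 (i - 1), xvn k n p x 1 2 t * xvn k n p x 2 1 (i - t)
  else
    ∑ t ∈ Finset.Icc (i - p) p, xvn k n p x 1 2 t * xvn k n p x 2 1 (i - t)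

/-- The value of
`T(r,s,m) = −X_{13}^{(r)}X_{22}^{(s)}X_{31}^{(m)} + X_{12}^{(r)}X_{23}^{(s)}X_{31}^{(m)}
 + X_{13}^{(r)}X_{21}^{(s)}X_{32}^{(m)}`. -/
def Tv (k : Type*) [CommRing k] (n p : ℕ) (x : Fin n × Fin n × Fin p → k) (r s m : ℕ) : k :=
  -(xvn k n p x 1 3 r * xvn k n p x 2 2 s * xvn k n p x 3 1 m) +
    xvn k n p x 1 2 r * xvn k n p x 2 3 s * xvn k n p x 3 1 m +
    xvn k n p x 1 3 r * xvn k n p x 2 1 s * xvn k n p x 3 2 m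

/-- The value of the polynomial `p_{3i}` (for `1 ≤ i ≤ 3p`). -/
def P3v (k : Type*) [CommRing k] (n p : ℕ) (x : Fin n × Fin n × Fin p → k) (i : ℕ) : k :=
  if i ≤ p then
    xvn k n p x 3 3 i
      - ∑ s ∈ Finset.Icc 1 (i - 1),
          (xvn k n p x 1 3 s * xvn k n p x 3 1 (i - s) +
           xvn k n p x 2 3 s * xvn k n p x 3 2 (i - s))
      - ∑ r ∈ Finset.Icc 1 (i - 2), ∑ s ∈ Finset.Icc 2 (i - r - 1),
          xvn k n p x 1 3 r * xvn k n p x 2 2 s * xvn k n p x 3 1 (i - r - s)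
      + ∑ r ∈ Finset.Icc 1 (i - 2), ∑ s ∈ Finset.Icc 1 (i - r - 1),
          (xvn k n p x 1 2 r * xvn k n p x 2 3 s * xvn k n p x 3 1 (i - r - s) +
           xvn k n p x 1 3 r * xvn k n p x 2 1 s * xvn k n p x 3 2 (i - r - s))
  else if i = p + 1 then
    - ∑ s ∈ Finset.Icc 1 p,
          (xvn k n p x 1 3 s * xvn k n p x 3 1 (p + 1 - s) +
           xvn k n p x 2 3 s * xvn k n p x 3 2 (p + 1 - s))
      - ∑ r ∈ Finset.Icc 1 (p - 1), ∑ s ∈ Finset.Icc 2 (p - r),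
          xvn k n p x 1 3 r * xvn k n p x 2 2 s * xvn k n p x 3 1 (p + 1 - r - s)
      + ∑ r ∈ Finset.Icc 1 (p - 1), ∑ s ∈ Finset.Icc 1 (p - r),
          (xvn k n p x 1 2 r * xvn k n p x 2 3 s * xvn k n p x 3 1 (p + 1 - r - s) +
           xvn k n p x 1 3 r * xvn k n p x 2 1 s * xvn k n p x 3 2 (p + 1 - r - s))
  else if i ≤ 2 * p then
    - ∑ s ∈ Finset.Icc (i - p) p,
          (xvn k n p x 1 3 s * xvn k n p x 3 1 (i - s) +
           xvn k n p x 2 3 s * xvn k n p x 3 2 (i - s))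
      + ∑ r ∈ Finset.Icc 1 (i - p - 1), ∑ s ∈ Finset.Icc (i - p - r) p,
          Tv k n p x r s (i - r - s)
      + ∑ r ∈ Finset.Icc (i - p) p, ∑ s ∈ Finset.Icc 1 (i - r - 1),
          Tv k n p x r s (i - r - s)
  else
    ∑ r ∈ Finset.Icc (i - 2 * p) p, ∑ s ∈ Finset.Icc (i - p - r) p,
      Tv k n p x r s (i - r - s)


/-- The value of the polynomial `p_{mj}`: `p_{1j}, p_{2j}, p_{3j}` as above for `m ≤ 3`,
and `p_{mj} = d̄_{mj}` for `m ≥ 4`. -/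
def Pmv (k : Type*) [CommRing k] (n p : ℕ) (x : Fin n × Fin n × Fin p → k) (m j : ℕ) : k :=
  if m = 1 then P1v k n p x j
  else if m = 2 then P2v k n p x j
  else if m = 3 then P3v k n p x j
  else dbar k n p x m j

open Polynomial in
/-- Reversed off-diagonal part of an entry. -/
def qq (k : Type*) [CommRing k] (p : ℕ) (x : Fin 3 × Fin 3 × Fin p → k) (a b : Fin 3) :
    Polynomial k :=
  ∑ t : Fin p, C (x (a, b, t)) * X ^ ((t : ℕ) + 1)

lemma qq_coeff (k : Type*) [CommRing k] (p : ℕ) (x : Fin 3 × Fin 3 × Fin p → k) (a b : Fin 3)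
    (n : ℕ) : (qq k p x a b).coeff n = xvn k 3 p x ((a : ℕ) + 1) ((b : ℕ) + 1) n := by
  unfold qq xvn
  simp only [Polynomial.finsetSum_coeff, Polynomial.coeff_C_mul_X_pow]
  split_ifs with h
  · rw [Finset.sum_eq_single (⟨n - 1, by omega⟩ : Fin p)]
    · have : n = n - 1 + 1 := by omega
      simp [← this]
    · intro t _ ht
      rw [if_neg]
      intro h'
      apply ht
      ext
      simp; omega
    · simp
  · apply Finset.sum_eq_zero
    intro t _
    rw [if_neg]
    have := a.2
    have := b.2
    have := t.2
    omega

lemma qq_coeff_zero (k : Type*) [CommRing k] (p : ℕ) (x : Fin 3 × Fin 3 × Fin p → k) (a b : Fin 3)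
    (n : ℕ) (hn : n < 1 ∨ p < n) : (qq k p x a b).coeff n = 0 := by
  rw [qq_coeff]
  unfold xvn
  rw [dif_neg]
  omega

/-- Reflection as an additive map. -/
def reflHom (k : Type*) [CommRing k] (p : ℕ) : Polynomial k →+ Polynomial k where
  toFun := Polynomial.reflect p
  map_zero' := Polynomial.reflect_zero
  map_add' := fun f g => Polynomial.reflect_add f g p

/-- Reversed entry. -/
def QQ (k : Type*) [CommRing k] (p : ℕ) (x : Fin 3 × Fin 3 × Fin p → k) (a b : Fin 3) :
    Polynomial k := (if (a : ℕ) = b then 1 else 0) + qq k p x a b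

lemma Xu_eq (k : Type*) [CommRing k] (p : ℕ) (x : Fin 3 × Fin 3 × Fin p → k) (m : ℕ) (hm : m ≤ 3)
    (a b : Fin m) : Xu k 3 p x m hm a b =
      Polynomial.reflect p (QQ k p x (Fin.castLE hm a) (Fin.castLE hm b)) := by
  have h : ∀ f, Polynomial.reflect p f = reflHom k p f := fun _ => rfl
  have h1 : Polynomial.reflect p (1 : Polynomial k) = Polynomial.X ^ p := by
    have := Polynomial.reflect_C_mul_X_pow (R := k) (c := 1) p 0
    simpa using this
  unfold QQ qq Xu
  rw [Polynomial.reflect_add]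
  simp only [Matrix.of_apply, Fin.val_castLE]
  congr 1
  · split_ifs
    · exact h1.symm
    · simp
  · rw [h, map_sum]
    apply Finset.sum_congr rfl
    intro t _
    rw [← h, Polynomial.reflect_C_mul_X_pow, Polynomial.revAt_le (by omega)]

lemma QQ_deg (k : Type*) [CommRing k] (p : ℕ) (x : Fin 3 × Fin 3 × Fin p → k) (a b : Fin 3) :
    (QQ k p x a b).natDegree ≤ p := by
  unfold QQ
  rw [Polynomial.natDegree_le_iff_coeff_eq_zero]
  intro n hn
  rw [Polynomial.coeff_add, qq_coeff_zero _ _ _ _ _ _ (Or.inr hn)]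
  split_ifs
  · simp [Polynomial.coeff_one]; omega
  · simp

lemma reflect_det (k : Type*) [CommRing k] (p : ℕ) (m : ℕ)
    (M : Matrix (Fin m) (Fin m) (Polynomial k)) (hM : ∀ a b, (M a b).natDegree ≤ p) :
    (Matrix.of fun a b => Polynomial.reflect p (M a b)).det
      = Polynomial.reflect (m * p) M.det := by
  have h : ∀ N f, Polynomial.reflect N f = reflHom k N f := fun _ _ => rfl
  have key : ∀ (s : Finset (Fin m)) (f : Fin m → Polynomial k), (∀ i, (f i).natDegree ≤ p) →
      ∏ i ∈ s, Polynomial.reflect p (f i) = Polynomial.reflect (s.card * p) (∏ i ∈ s, f i) ∧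
      (∏ i ∈ s, f i).natDegree ≤ s.card * p := by
    intro s f hf
    induction s using Finset.induction_on with
    | empty => simp
    | insert a s ha ih =>
      rw [Finset.prod_insert ha, Finset.prod_insert ha, Finset.card_insert_of_notMem ha, ih.1,
        ← Polynomial.reflect_mul _ _ (hf a) ih.2]
      have e : (s.card + 1) * p = p + s.card * p := by ring
      rw [e]
      exact ⟨rfl, Polynomial.natDegree_mul_le.trans (add_le_add (hf a) ih.2)⟩
  rw [Matrix.det_apply, Matrix.det_apply, h, map_sum]
  apply Finset.sum_congr rfl
  intro σ _
  have := (key Finset.univ (fun i => M (σ i) i) (fun i => hM _ _)).1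
  simp only [Finset.card_univ, Fintype.card_fin] at this
  simp only [Matrix.of_apply]
  rw [this, h]
  rcases Int.units_eq_one_or (Equiv.Perm.sign σ) with h | h <;> rw [h] <;> simp

lemma dbar_eq (k : Type*) [CommRing k] (p : ℕ) (x : Fin 3 × Fin 3 × Fin p → k) (m j : ℕ)
    (hm : m ≤ 3) (hj : j ≤ m * p) : dbar k 3 p x m j =
      (Matrix.of fun a b : Fin m =>
        QQ k p x (Fin.castLE hm a) (Fin.castLE hm b)).det.coeff j := by
  unfold dbar
  rw [dif_pos hm]
  have : Xu k 3 p x m hm = Matrix.of fun a b => Polynomial.reflect p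
      ((Matrix.of fun a b : Fin m => QQ k p x (Fin.castLE hm a) (Fin.castLE hm b)) a b) := by
    ext1 a b
    rw [Xu_eq]; rfl
  rw [this, reflect_det k p m (Matrix.of fun a b : Fin m => QQ k p x (Fin.castLE hm a) (Fin.castLE hm b))
      (fun a b => QQ_deg _ _ _ _ _), Polynomial.coeff_reflect,
    Polynomial.revAt_le (by omega)]
  congr 1; omega

lemma quad_sum (k : Type*) [CommRing k] (p : ℕ) (f g : Polynomial k)
    (hf : ∀ n, n < 1 ∨ p < n → f.coeff n = 0) (hg : ∀ n, n < 1 ∨ p < n → g.coeff n = 0)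
    (j : ℕ) (R : Finset ℕ) (h1 : ∀ r ∈ R, r ≤ j)
    (h2 : ∀ r, 1 ≤ r → r ≤ p → r + 1 ≤ j → j - r ≤ p → r ∈ R) :
    ∑ r ∈ R, f.coeff r * g.coeff (j - r) = (f * g).coeff j := by
  rw [Polynomial.coeff_mul, Finset.Nat.sum_antidiagonal_eq_sum_range_succ_mk]
  apply Finset.sum_subset
  · intro r hr
    have := h1 r hr
    simp; omega
  · intro r hr hr'
    simp only [Finset.mem_range] at hr
    by_cases c1 : r < 1 ∨ p < r
    · rw [hf _ c1, zero_mul]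
    by_cases c2 : j - r < 1 ∨ p < j - r
    · rw [hg _ c2, mul_zero]
    exact absurd (h2 r (by omega) (by omega) (by omega) (by omega)) hr'

lemma cub_sum (k : Type*) [CommRing k] (p l : ℕ) (f g e : Polynomial k)
    (hf : ∀ n, n < 1 ∨ p < n → f.coeff n = 0) (hg : ∀ n, n < l ∨ p < n → g.coeff n = 0)
    (he : ∀ n, n < 1 ∨ p < n → e.coeff n = 0)
    (j : ℕ) (R : Finset ℕ) (S : ℕ → Finset ℕ) (h1 : ∀ r ∈ R, r ≤ j ∧ ∀ s ∈ S r, s ≤ j - r)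
    (h2 : ∀ r s, 1 ≤ r → r ≤ p → l ≤ s → s ≤ p → r + s + 1 ≤ j → j - r - s ≤ p →
      r ∈ R ∧ s ∈ S r) :
    ∑ r ∈ R, ∑ s ∈ S r, f.coeff r * g.coeff s * e.coeff (j - r - s) = (f * g * e).coeff j := by
  have inner : ∀ r ∈ R, ∑ s ∈ S r, f.coeff r * g.coeff s * e.coeff (j - r - s) =
      f.coeff r * (g * e).coeff (j - r) := by
    intro r hr
    rw [Polynomial.coeff_mul, Finset.Nat.sum_antidiagonal_eq_sum_range_succ_mk, Finset.mul_sum]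
    simp only [mul_assoc]
    apply Finset.sum_subset
    · intro s hs
      have := (h1 r hr).2 s hs
      simp; omega
    · intro s hs hs'
      simp only [Finset.mem_range] at hs
      by_cases c0 : r < 1 ∨ p < r
      · rw [hf _ c0, zero_mul]
      by_cases c1 : s < l ∨ p < s
      · rw [hg _ c1, zero_mul, mul_zero]
      by_cases c2 : j - r - s < 1 ∨ p < j - r - s
      · rw [he _ c2, mul_zero, mul_zero]
      exact absurd (h2 r s (by omega) (by omega) (by omega) (by omega) (by omega) (by omega)).2 hs'
  rw [Finset.sum_congr rfl inner, mul_assoc, Polynomial.coeff_mul,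
    Finset.Nat.sum_antidiagonal_eq_sum_range_succ_mk]
  apply Finset.sum_subset
  · intro r hr
    have := (h1 r hr).1
    simp; omega
  · intro r hr hr'
    simp only [Finset.mem_range] at hr
    by_cases c1 : r < 1 ∨ p < r
    · rw [hf _ c1, zero_mul]
    rw [Polynomial.coeff_mul, Finset.Nat.sum_antidiagonal_eq_sum_range_succ_mk,
      Finset.sum_eq_zero, mul_zero]
    intro s hs
    simp only [Finset.mem_range] at hs
    by_cases c1 : s < l ∨ p < s
    · rw [hg _ c1, zero_mul]
    by_cases c2 : j - r - s < 1 ∨ p < j - r - s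
    · rw [he _ c2, mul_zero]
    exact absurd (h2 r s (by omega) (by omega) (by omega) (by omega) (by omega) (by omega)).1 hr'

lemma P2_eq (k : Type*) [CommRing k] (p : ℕ) (x : Fin 3 × Fin 3 × Fin p → k) (j : ℕ) :
    P2v k 3 p x j = if j ≤ p then (qq k p x 1 1 - qq k p x 0 1 * qq k p x 1 0).coeff j
      else - (qq k p x 1 1 - qq k p x 0 1 * qq k p x 1 0).coeff j := by
  have e22 : ∀ t, xvn k 3 p x 2 2 t = (qq k p x 1 1).coeff t := fun t => (qq_coeff k p x 1 1 t).symm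
  have e12 : ∀ t, xvn k 3 p x 1 2 t = (qq k p x 0 1).coeff t := fun t => (qq_coeff k p x 0 1 t).symm
  have e21 : ∀ t, xvn k 3 p x 2 1 t = (qq k p x 1 0).coeff t := fun t => (qq_coeff k p x 1 0 t).symm
  have z := qq_coeff_zero k p x
  unfold P2v
  simp only [e22, e12, e21, Polynomial.coeff_sub]
  split_ifs with h
  · rw [quad_sum k p _ _ (z 0 1) (z 1 0)]
    · intro r hr; simp at hr; omega
    · intro r; simp; omega
  · rw [quad_sum k p _ _ (z 0 1) (z 1 0), z 1 1 j (by omega)]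
    · ring
    · intro r hr; simp at hr; omega
    · intro r; simp; omega

lemma P3_eq (k : Type*) [CommRing k] (p : ℕ) (x : Fin 3 × Fin 3 × Fin p → k) (j : ℕ)
    (h22 : (qq k p x 1 1).coeff 1 = 0) (hj : j ≤ 3 * p) :
    P3v k 3 p x j = (qq k p x 2 2 - (qq k p x 0 2 * qq k p x 2 0 + qq k p x 1 2 * qq k p x 2 1)
      - qq k p x 0 2 * qq k p x 1 1 * qq k p x 2 0
      + (qq k p x 0 1 * qq k p x 1 2 * qq k p x 2 0
        + qq k p x 0 2 * qq k p x 1 0 * qq k p x 2 1)).coeff j := by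
  have e33 : ∀ t, xvn k 3 p x 3 3 t = (qq k p x 2 2).coeff t := fun t => (qq_coeff k p x 2 2 t).symm
  have e22 : ∀ t, xvn k 3 p x 2 2 t = (qq k p x 1 1).coeff t := fun t => (qq_coeff k p x 1 1 t).symm
  have e12 : ∀ t, xvn k 3 p x 1 2 t = (qq k p x 0 1).coeff t := fun t => (qq_coeff k p x 0 1 t).symm
  have e21 : ∀ t, xvn k 3 p x 2 1 t = (qq k p x 1 0).coeff t := fun t => (qq_coeff k p x 1 0 t).symm
  have e13 : ∀ t, xvn k 3 p x 1 3 t = (qq k p x 0 2).coeff t := fun t => (qq_coeff k p x 0 2 t).symm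
  have e31 : ∀ t, xvn k 3 p x 3 1 t = (qq k p x 2 0).coeff t := fun t => (qq_coeff k p x 2 0 t).symm
  have e23 : ∀ t, xvn k 3 p x 2 3 t = (qq k p x 1 2).coeff t := fun t => (qq_coeff k p x 1 2 t).symm
  have e32 : ∀ t, xvn k 3 p x 3 2 t = (qq k p x 2 1).coeff t := fun t => (qq_coeff k p x 2 1 t).symm
  have z := qq_coeff_zero k p x
  have z2 : ∀ n, n < 2 ∨ p < n → (qq k p x 1 1).coeff n = 0 := by
    intro n hn
    by_cases h : n = 1
    · rw [h, h22]
    · exact z 1 1 n (by omega)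
  have Q := fun a b c d => quad_sum k p (qq k p x a b) (qq k p x c d) (z a b) (z c d) j
  have K := fun a b c d e f => cub_sum k p 1 (qq k p x a b) (qq k p x c d) (qq k p x e f)
    (z a b) (z c d) (z e f) j
  have K2 := fun a b e f => cub_sum k p 2 (qq k p x a b) (qq k p x 1 1) (qq k p x e f)
    (z a b) z2 (z e f) j
  unfold P3v Tv
  simp only [e33, e22, e12, e21, e13, e31, e23, e32, Polynomial.coeff_sub, Polynomial.coeff_add]
  split_ifs with c1 c2 c3
  · simp only [Finset.sum_add_distrib]
    rw [Q, Q, K2, K, K]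
    all_goals simp only [Finset.mem_Icc]
    all_goals intros
    all_goals first | omega | (refine ⟨by omega, ?_⟩; intros; omega)
  · subst c2
    simp only [Finset.sum_add_distrib]
    rw [Q, Q, K2, K, K, z 2 2 _ (by omega)]
    · ring
    all_goals simp only [Finset.mem_Icc]
    all_goals intros
    all_goals first | omega | (refine ⟨by omega, ?_⟩; intros; omega)
  · have comb : ∀ F : ℕ → ℕ → k,
        ∑ r ∈ Finset.Icc 1 (j - p - 1), ∑ s ∈ Finset.Icc (j - p - r) p, F r s +
        ∑ r ∈ Finset.Icc (j - p) p, ∑ s ∈ Finset.Icc 1 (j - r - 1), F r s =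
        ∑ r ∈ Finset.Icc 1 p, ∑ s ∈ (if r < j - p then Finset.Icc (j - p - r) p
          else Finset.Icc 1 (j - r - 1)), F r s := by
      intro F
      have hu : Finset.Icc 1 p = Finset.Icc 1 (j - p - 1) ∪ Finset.Icc (j - p) p := by
        ext r; simp; omega
      rw [hu, Finset.sum_union]
      · congr 1
        · apply Finset.sum_congr rfl
          intro r hr
          simp at hr
          rw [if_pos (by omega)]
        · apply Finset.sum_congr rfl
          intro r hr
          simp at hr
          rw [if_neg (by omega)]
      · rw [Finset.disjoint_left]
        intro r; simp; omega
    rw [add_assoc, comb]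
    simp only [Finset.sum_add_distrib, Finset.sum_neg_distrib]
    rw [Q, Q, K, K, K, z 2 2 _ (by omega)]
    · ring
    all_goals simp only [Finset.mem_Icc]
    all_goals intros
    all_goals try split_ifs
    all_goals try simp only [Finset.mem_Icc]
    all_goals first | omega | (refine ⟨by omega, ?_⟩; intros; omega)
  · have hq : ∀ a b c d, (qq k p x a b * qq k p x c d).coeff j = 0 := by
      intro a b c d
      rw [← Q a b c d ∅] <;> simp
      omega
    simp only [Finset.sum_add_distrib, Finset.sum_neg_distrib]
    rw [K, K, K, z 2 2 _ (by omega), hq, hq]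
    · ring
    all_goals simp only [Finset.mem_Icc]
    all_goals intros
    all_goals first | omega | (refine ⟨by omega, ?_⟩; intros; omega)

lemma D1 (k : Type*) [CommRing k] (p : ℕ) (x : Fin 3 × Fin 3 × Fin p → k) (j : ℕ)
    (hj : j ≤ 1 * p) : dbar k 3 p x 1 j = (1 + qq k p x 0 0).coeff j := by
  rw [dbar_eq k p x 1 j (by omega) hj, Matrix.det_fin_one]
  simp [QQ]

lemma D2 (k : Type*) [CommRing k] (p : ℕ) (x : Fin 3 × Fin 3 × Fin p → k) (j : ℕ)
    (hj : j ≤ 2 * p) : dbar k 3 p x 2 j =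
      ((1 + qq k p x 0 0) * (1 + qq k p x 1 1) - qq k p x 0 1 * qq k p x 1 0).coeff j := by
  rw [dbar_eq k p x 2 j (by omega) hj, Matrix.det_fin_two]
  have e0 : Fin.castLE (by omega : 2 ≤ 3) (0 : Fin 2) = 0 := rfl
  have e1 : Fin.castLE (by omega : 2 ≤ 3) (1 : Fin 2) = 1 := rfl
  simp only [Matrix.of_apply, e0, e1, QQ]
  simp

lemma D3 (k : Type*) [CommRing k] (p : ℕ) (x : Fin 3 × Fin 3 × Fin p → k) (j : ℕ)
    (hj : j ≤ 3 * p) (h11 : qq k p x 0 0 = 0)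
    (h22 : qq k p x 1 1 - qq k p x 0 1 * qq k p x 1 0 = 0) : dbar k 3 p x 3 j =
      (1 + (qq k p x 2 2 - (qq k p x 0 2 * qq k p x 2 0 + qq k p x 1 2 * qq k p x 2 1)
      - qq k p x 0 2 * qq k p x 1 1 * qq k p x 2 0
      + (qq k p x 0 1 * qq k p x 1 2 * qq k p x 2 0
        + qq k p x 0 2 * qq k p x 1 0 * qq k p x 2 1))).coeff j := by
  rw [dbar_eq k p x 3 j (by omega) hj, Matrix.det_fin_three]
  have e0 : ∀ a, Fin.castLE (by omega : 3 ≤ 3) (a : Fin 3) = a := fun _ => rfl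
  simp only [Matrix.of_apply, e0, QQ, h11]
  congr 1
  simp
  linear_combination (1 + qq k p x 2 2) * h22

/-- The Gelfand–Tsetlin variety for the restricted Yangian `Y_p(gl_3)`, defined as the
common zero set of the `d̄_{mj}`, coincides with the common zero set of the polynomials
`p_{mj}` (`1 ≤ m ≤ 3`, `1 ≤ j ≤ mp`). -/
theorem GTsYang_gl3_eq_zeroSet_p (k : Type*) [Field k] [IsAlgClosed k] [CharZero k]
    (p : ℕ) (hp : 1 ≤ p) :
    GTsYang k 3 p =
      {x : Fin 3 × Fin 3 × Fin p → k |
        ∀ m j : ℕ, 1 ≤ m → m ≤ 3 → 1 ≤ j → j ≤ m * p → Pmv k 3 p x m j = 0} := by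
  ext x
  have one0 : ∀ j, 1 ≤ j → (1 : Polynomial k).coeff j = 0 := by
    intro j hj
    rw [Polynomial.coeff_one, if_neg (by omega)]
  have z := qq_coeff_zero k p x
  have l1 : (∀ j, 1 ≤ j → j ≤ 1 * p → dbar k 3 p x 1 j = 0) ↔ qq k p x 0 0 = 0 := by
    constructor
    · intro h
      ext j
      by_cases hj : 1 ≤ j ∧ j ≤ p
      · have := h j hj.1 (by omega)
        rwa [D1 k p x j (by omega), Polynomial.coeff_add, one0 j hj.1, zero_add] at this
      · rw [z 0 0 j (by omega), Polynomial.coeff_zero]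
    · intro h j h1 h2
      rw [D1 k p x j h2, h, add_zero, one0 j h1]
  have l1' : (∀ j, 1 ≤ j → j ≤ 1 * p → Pmv k 3 p x 1 j = 0) ↔ qq k p x 0 0 = 0 := by
    have e : ∀ j, Pmv k 3 p x 1 j = (qq k p x 0 0).coeff j := fun j => by
      rw [qq_coeff]; simp [Pmv, P1v]
    constructor
    · intro h
      ext j
      by_cases hj : 1 ≤ j ∧ j ≤ p
      · rw [← e, h j hj.1 (by omega), Polynomial.coeff_zero]
      · rw [z 0 0 j (by omega), Polynomial.coeff_zero]
    · intro h j h1 h2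
      rw [e, h, Polynomial.coeff_zero]
  have o2 : ∀ j, ¬ (1 ≤ j ∧ j ≤ 2 * p) →
      (qq k p x 1 1 - qq k p x 0 1 * qq k p x 1 0).coeff j = 0 := by
    intro j hj
    rw [Polynomial.coeff_sub, z 1 1 j (by omega),
      ← quad_sum k p _ _ (z 0 1) (z 1 0) j ∅ (by simp) (by intros; omega)]
    simp
  have l2 : qq k p x 0 0 = 0 → ((∀ j, 1 ≤ j → j ≤ 2 * p → dbar k 3 p x 2 j = 0) ↔
      qq k p x 1 1 - qq k p x 0 1 * qq k p x 1 0 = 0) := by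
    intro h0
    have e : ∀ j, 1 ≤ j → j ≤ 2 * p → dbar k 3 p x 2 j =
        (qq k p x 1 1 - qq k p x 0 1 * qq k p x 1 0).coeff j := by
      intro j h1 h2
      rw [D2 k p x j h2, h0, add_zero, one_mul, add_sub_assoc, Polynomial.coeff_add, one0 j h1,
        zero_add]
    constructor
    · intro h
      ext j
      by_cases hj : 1 ≤ j ∧ j ≤ 2 * p
      · rw [← e j hj.1 hj.2, h j hj.1 hj.2, Polynomial.coeff_zero]
      · rw [o2 j hj, Polynomial.coeff_zero]
    · intro h j h1 h2
      rw [e j h1 h2, h, Polynomial.coeff_zero]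
  have l2' : (∀ j, 1 ≤ j → j ≤ 2 * p → Pmv k 3 p x 2 j = 0) ↔
      qq k p x 1 1 - qq k p x 0 1 * qq k p x 1 0 = 0 := by
    have e : ∀ j, Pmv k 3 p x 2 j = 0 ↔
        (qq k p x 1 1 - qq k p x 0 1 * qq k p x 1 0).coeff j = 0 := by
      intro j
      have : Pmv k 3 p x 2 j = P2v k 3 p x j := by simp [Pmv]
      rw [this, P2_eq]
      split_ifs
      · rfl
      · exact neg_eq_zero
    constructor
    · intro h
      ext j
      by_cases hj : 1 ≤ j ∧ j ≤ 2 * p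
      · rw [(e j).1 (h j hj.1 hj.2), Polynomial.coeff_zero]
      · rw [o2 j hj, Polynomial.coeff_zero]
    · intro h j h1 h2
      rw [e j, h, Polynomial.coeff_zero]
  have l3 : qq k p x 0 0 = 0 → qq k p x 1 1 - qq k p x 0 1 * qq k p x 1 0 = 0 →
      ∀ j, 1 ≤ j → j ≤ 3 * p → dbar k 3 p x 3 j = Pmv k 3 p x 3 j := by
    intro h0 h2 j hj1 hj2
    have : Pmv k 3 p x 3 j = P3v k 3 p x j := by simp [Pmv]
    rw [this, P3_eq k p x j _ hj2, D3 k p x j hj2 h0 h2, Polynomial.coeff_add, one0 j hj1, zero_add]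
    rw [sub_eq_zero.1 h2, ← quad_sum k p _ _ (z 0 1) (z 1 0) 1 ∅ (by simp) (by intros; omega)]
    simp
  simp only [GTsYang, Set.mem_setOf_eq]
  constructor
  · intro h
    have a1 := l1.1 (fun j => h 1 j (by omega) (by omega))
    have a2 := (l2 a1).1 (fun j => h 2 j (by omega) (by omega))
    intro m j hm1 hm3 hj1 hj2
    obtain rfl | rfl | rfl : m = 1 ∨ m = 2 ∨ m = 3 := by omega
    · exact l1'.2 a1 j hj1 hj2
    · exact l2'.2 a2 j hj1 hj2
    · rw [← l3 a1 a2 j hj1 hj2]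
      exact h 3 j hm1 hm3 hj1 hj2
  · intro h
    have a1 := l1'.1 (fun j => h 1 j (by omega) (by omega))
    have a2 := l2'.1 (fun j => h 2 j (by omega) (by omega))
    intro m j hm1 hm3 hj1 hj2
    obtain rfl | rfl | rfl : m = 1 ∨ m = 2 ∨ m = 3 := by omega
    · exact l1.2 a1 j hj1 hj2
    · exact (l2 a1).2 a2 j hj1 hj2
    · rw [l3 a1 a2 j hj1 hj2]
      exact h 3 j hm1 hm3 hj1 hj2

end
end
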